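/- arXiv:1506.06426 — 12 statements merged into one kernel-verified Lean document; each statement's English description precedes it below -/
import Mathlib

section
/- (Digital intermediate value theorem for Lipschitz functions.) Let (X,κ) be a connected digital image, let f : X → ℤ have (κ,c₁)-Lipschitz constant m > 0, and let x, y ∈ X and c ∈ ℤ satisfy f(x) ≤ c ≤ f(y). Then there is a point z ∈ X with |f(z) − c| < m. -/
/-- There is a `κ`-path of length at most `m` from `a` to `b`. -/
def DigPathLe {X : Type*} (κ : X → X → Prop) (m : ℕ) (a b : X) : Prop :=
  ∃ n ≤ m, ∃ p : ℕ → X, p 0 = a ∧ p n = b ∧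
    ∀ i < n, κ (p i) (p (i + 1)) ∨ p i = p (i + 1)

/-- `(X,κ)` is connected: any two points are joined by a `κ`-path. -/
def DigConnected {X : Type*} (κ : X → X → Prop) : Prop :=
  ∀ a b : X, ∃ m : ℕ, DigPathLe κ m a b

/-- Digital intermediate value theorem for Lipschitz functions: if `f : X → ℤ`
has `(κ,c₁)`-Lipschitz constant `m > 0` on a connected digital image, and
`f x ≤ c ≤ f y`, then some `z` satisfies `|f z - c| < m`. -/
theorem digital_ivt {X : Type*} (κ : X → X → Prop)
    (hsymm : ∀ a b, κ a b → κ b a) (hirrefl : ∀ a, ¬ κ a a)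
    (hconn : DigConnected κ)
    (f : X → ℤ) (m : ℤ) (hm : 0 < m)
    (hf : ∀ a b, κ a b → |f a - f b| ≤ m)
    (x y : X) (c : ℤ) (hxc : f x ≤ c) (hcy : c ≤ f y) :
    ∃ z : X, |f z - c| < m := by
  by_contra! hfar
  obtain ⟨-, n, -, p, rfl, rfl, hp⟩ := hconn x y
  have hbelow : ∀ i ≤ n, f (p i) ≤ c - m := by
    intro i
    induction i with
    | zero =>
      intro _
      rcases le_abs.mp (hfar (p 0)) with h | h <;> lia
    | succ i ih =>
      intro hi
      have hprev := ih (by lia)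
      rcases hp i (by lia) with hadj | heq
      · have hstep := abs_le.mp (hf _ _ hadj)
        rcases le_abs.mp (hfar (p (i + 1))) with h | h <;> lia
      · rwa [← heq]
  have hend := hbelow n le_rfl
  lia
end

section
/- (Digital Borsuk–Ulam theorem for ℤ-valued functions.) Let (X,κ) be a nonempty connected digital image admitting a κ-continuous free involution τ : X → X (τ is (κ,κ)-continuous, τ(τ(x)) = x for all x, and τ(x) ≠ x for all x). Let f : X → ℤ have (κ,c₁)-Lipschitz constant m > 0. Then there is a point x ∈ X such that |f(x) − f(τ(x))| < 2m. -/
/-- A predicate preserved by adjacency holds on all of a connected digital image as soon as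
it holds at one point. -/
theorem DigConnected.forall_of_adj {X : Type*} {κ : X → X → Prop} (hconn : DigConnected κ)
    {P : X → Prop} (hP : ∀ a b, κ a b → P a → P b) {a : X} (ha : P a) (b : X) : P b := by
  obtain ⟨_, n, _, p, rfl, rfl, hp⟩ := hconn a b
  have key : ∀ i ≤ n, P (p i) := by
    intro i
    induction i with
    | zero => exact fun _ => ha
    | succ i ih =>
      intro hi
      rcases hp i hi with h | h
      · exact hP _ _ h (ih (by omega))
      · exact h ▸ ih (by omega)
  exact key n le_rfl

/-- Digital Borsuk–Ulam theorem for `ℤ`-valued functions: if `(X,κ)` is a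
nonempty connected digital image with a continuous free involution `τ`, and
`f : X → ℤ` has `(κ,c₁)`-Lipschitz constant `m > 0`, then some point `x`
satisfies `|f x - f (τ x)| < 2 * m`. -/
theorem digital_borsuk_ulam {X : Type*} [Nonempty X] (κ : X → X → Prop)
    (hsymm : ∀ a b, κ a b → κ b a) (hirrefl : ∀ a, ¬ κ a a)
    (hconn : DigConnected κ)
    (τ : X → X)
    (hτcont : ∀ a b, κ a b → κ (τ a) (τ b) ∨ τ a = τ b)
    (hτinv : ∀ x, τ (τ x) = x) (hτfree : ∀ x, τ x ≠ x)
    (f : X → ℤ) (m : ℤ) (hm : 0 < m)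
    (hf : ∀ a b, κ a b → |f a - f b| ≤ m) :
    ∃ x : X, |f x - f (τ x)| < 2 * m := by
  by_contra! hfar
  have hstep : ∀ a b, κ a b → 0 < f a - f (τ a) → 0 < f b - f (τ b) := by
    intro a b hab ha
    have hτ : |f (τ a) - f (τ b)| ≤ m := by
      rcases hτcont a b hab with h | h
      · exact hf _ _ h
      · simpa [h] using hm.le
    have hab' := abs_le.mp (hf a b hab)
    have hτ' := abs_le.mp hτ
    have hfa := hfar a
    rw [abs_of_pos ha] at hfa
    have hne : f b - f (τ b) ≠ 0 := by
      intro h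
      have hfb := hfar b
      rw [h, abs_zero] at hfb
      omega
    omega
  have hnonpos : ∀ x, ¬ 0 < f x - f (τ x) := by
    intro x hx
    have := hconn.forall_of_adj hstep hx (τ x)
    rw [hτinv] at this
    omega
  obtain ⟨x⟩ := ‹Nonempty X›
  have h₁ := hnonpos x
  have h₂ := hnonpos (τ x)
  rw [hτinv] at h₂
  have h₃ := hfar x
  rw [show f x - f (τ x) = 0 by omega, abs_zero] at h₃
  omega
end

section
/- Let (X,κ) be a nonempty connected digital image admitting a κ-continuous free involution τ : X → X, let m ≥ 1, and let f : X → ℤ be (κ, c₁^m)-continuous, i.e. a ↔_κ b implies |f(a)−f(b)| ≤ m. Then there is a point x ∈ X such that |f(x) − f(τ(x))| ≤ 2m − 1. -/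
/-- A property preserved by adjacency that holds at one point of a connected digital image
holds everywhere. -/
theorem DigConnected.forall_of_step {X : Type*} {κ : X → X → Prop} (hconn : DigConnected κ)
    {P : X → Prop} (hstep : ∀ a b, κ a b → P a → P b) {a : X} (ha : P a) (b : X) : P b := by
  obtain ⟨_, n, _, p, rfl, rfl, hp⟩ := hconn a b
  have key : ∀ i ≤ n, P (p i) := by
    intro i
    induction i with
    | zero => exact fun _ => ha
    | succ i ih =>
      intro hi
      have hPi := ih (by omega)
      rcases hp i (by omega) with h | h
      · exact hstep _ _ h hPi
      · exact h ▸ hPi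
  exact key n le_rfl

/-- Digital Borsuk–Ulam theorem for `(κ,c₁^m)`-continuous `ℤ`-valued functions:
if `(X,κ)` is a nonempty connected digital image with a continuous free
involution `τ`, and `f : X → ℤ` is `(κ,c₁^m)`-continuous (`m ≥ 1`), then some
point `x` satisfies `|f x - f (τ x)| ≤ 2 * m - 1`. -/
theorem digital_borsuk_ulam_pow {X : Type*} [Nonempty X] (κ : X → X → Prop)
    (hsymm : ∀ a b, κ a b → κ b a) (hirrefl : ∀ a, ¬ κ a a)
    (hconn : DigConnected κ)
    (τ : X → X)
    (hτcont : ∀ a b, κ a b → κ (τ a) (τ b) ∨ τ a = τ b)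
    (hτinv : ∀ x, τ (τ x) = x) (hτfree : ∀ x, τ x ≠ x)
    (f : X → ℤ) (m : ℤ) (hm : 1 ≤ m)
    (hf : ∀ a b, κ a b → |f a - f b| ≤ m) :
    ∃ x : X, |f x - f (τ x)| ≤ 2 * m - 1 := by
  by_contra! hbig
  have hstep : ∀ a b, κ a b → 0 < f a - f (τ a) → 0 < f b - f (τ b) := by
    intro a b hab ha
    have h₁ := abs_le.1 (hf a b hab)
    have h₂ : |f (τ a) - f (τ b)| ≤ m := by
      rcases hτcont a b hab with h | h
      · exact hf _ _ h
      · rw [h, sub_self, abs_zero]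
        omega
    have h₃ := abs_le.1 h₂
    have h₄ := hbig a
    have h₅ := lt_abs.1 (hbig b)
    rw [abs_of_pos ha] at h₄
    omega
  obtain ⟨x⟩ := ‹Nonempty X›
  have hx := lt_abs.1 (hbig x)
  have hττ := hτinv x
  obtain ⟨y, hy⟩ : ∃ y, 0 < f y - f (τ y) := by
    rcases hx with h | h
    · exact ⟨x, by omega⟩
    · exact ⟨τ x, by rw [hττ]; omega⟩
  have hyτ := hconn.forall_of_step hstep hy (τ y)
  rw [hτinv y] at hyτ
  omega
end

section
/- Let (X,κ) be a nonempty connected digital image admitting a κ-continuous free involution τ : X → X, and let f : X → ℤ be (κ,c₁)-continuous. Then there is a point x ∈ X with |f(x) − f(τ(x))| ≤ 1. -/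
/-- If `P` is preserved by single `κ`-steps, it is preserved along `κ`-paths. -/
theorem DigPathLe.preserves {X : Type*} {κ : X → X → Prop} {P : X → Prop}
    (hP : ∀ a b, κ a b → P a → P b) {m : ℕ} {a b : X} (h : DigPathLe κ m a b) (ha : P a) :
    P b := by
  obtain ⟨n, -, p, rfl, rfl, hp⟩ := h
  have key : ∀ i ≤ n, P (p i) := by
    intro i
    induction i with
    | zero => exact fun _ => ha
    | succ k ih =>
      intro hk
      rcases hp k hk with h | h
      · exact hP _ _ h (ih (by omega))
      · exact h ▸ ih (by omega)
  exact key n le_rfl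

/-- Digital Borsuk–Ulam theorem for continuous `ℤ`-valued functions: if `(X,κ)`
is a nonempty connected digital image with a continuous free involution `τ`,
and `f : X → ℤ` is `(κ,c₁)`-continuous, then some point `x` satisfies
`|f x - f (τ x)| ≤ 1`. -/
theorem digital_borsuk_ulam_continuous {X : Type*} [Nonempty X] (κ : X → X → Prop)
    (hsymm : ∀ a b, κ a b → κ b a) (hirrefl : ∀ a, ¬ κ a a)
    (hconn : DigConnected κ)
    (τ : X → X)
    (hτcont : ∀ a b, κ a b → κ (τ a) (τ b) ∨ τ a = τ b)
    (hτinv : ∀ x, τ (τ x) = x) (hτfree : ∀ x, τ x ≠ x)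
    (f : X → ℤ)
    (hf : ∀ a b, κ a b → |f a - f b| ≤ 1) :
    ∃ x : X, |f x - f (τ x)| ≤ 1 := by
  by_contra! hne
  have step : ∀ a b, κ a b → |(f a - f (τ a)) - (f b - f (τ b))| ≤ 2 := by
    intro a b hab
    have h₁ := abs_le.mp (hf a b hab)
    have h₂ : |f (τ a) - f (τ b)| ≤ 1 := by
      rcases hτcont a b hab with h | h
      · exact hf _ _ h
      · simp [h]
    have h₃ := abs_le.mp h₂
    exact abs_le.mpr ⟨by linarith, by linarith⟩
  have pos_step : ∀ a b, κ a b → 0 < f a - f (τ a) → 0 < f b - f (τ b) := by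
    intro a b hab ha
    have h := abs_le.mp (step a b hab)
    rcases lt_abs.mp (hne a) with h₁ | h₁ <;> rcases lt_abs.mp (hne b) with h₂ | h₂ <;> omega
  have pos_all : ∀ a b, 0 < f a - f (τ a) → 0 < f b - f (τ b) := fun a b ha =>
    (hconn a b).elim fun _ h => h.preserves (P := fun x => 0 < f x - f (τ x)) pos_step ha
  obtain ⟨x⟩ := ‹Nonempty X›
  have h₁ := pos_all x (τ x)
  have h₂ := pos_all (τ x) x
  rw [hτinv] at h₁ h₂
  rcases lt_abs.mp (hne x) with h | h <;> omega
end

section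
/- (Graph-theoretic Borsuk–Ulam.) Let G be a nonempty connected simple graph with an automorphism τ that is a free involution (τ∘τ = id and τ(v) ≠ v for every vertex v). Let f be any integer-valued function on the vertex set of G such that |f(a) − f(b)| ≤ m whenever a and b are joined by an edge, with m > 0. Then there is a vertex x with |f(x) − f(τ(x))| < 2m. -/
/-- Graph-theoretic Borsuk–Ulam: if `G` is a connected simple graph (hence
nonempty) with an automorphism `τ` which is a free involution, and `f` is an
integer-valued function on the vertices with `|f a - f b| ≤ m` across every
edge (`m > 0`), then some vertex `x` satisfies `|f x - f (τ x)| < 2 * m`. -/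
theorem graph_borsuk_ulam {V : Type*} (G : SimpleGraph V)
    (hconn : G.Connected)
    (τ : G ≃g G) (hτinv : ∀ v, τ (τ v) = v) (hτfree : ∀ v, τ v ≠ v)
    (f : V → ℤ) (m : ℤ) (hm : 0 < m)
    (hf : ∀ a b, G.Adj a b → |f a - f b| ≤ m) :
    ∃ x : V, |f x - f (τ x)| < 2 * m := by
  by_contra! hfar
  have key : ∀ a b, G.Walk a b → 0 < f a - f (τ a) → 0 < f b - f (τ b) := by
    intro a b p
    induction p with
    | nil => exact id
    | @cons u v w h _ ih =>
      intro hu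
      apply ih
      have h₁ := abs_le.mp (hf u v h)
      have h₂ := abs_le.mp (hf (τ u) (τ v) (τ.map_adj_iff.mpr h))
      have h₃ := hfar u
      rw [abs_of_pos hu] at h₃
      rcases le_abs.mp (hfar v) with h₄ | h₄ <;> linarith
  obtain ⟨x⟩ := hconn.nonempty
  obtain ⟨p⟩ := hconn.preconnected x (τ x)
  have h₁ := key _ _ p
  have h₂ := key _ _ p.reverse
  rw [hτinv] at h₁ h₂
  rcases le_abs.mp (hfar x) with h₃ | h₃
  · linarith [h₁ (by linarith)]
  · linarith [h₂ (by linarith)]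
end

section
/- Let n ≥ 1, let B ⊂ ℤⁿ be an n-box with boundary ∂B and canonical involution τ, and let f : ∂B → ℤ^{n−1} be any function. Then there is a cₙ-simplex σ ⊆ ∂B such that the convex hulls in ℝ^{n−1} of f(σ) and of f(τ(σ)) have nonempty intersection. -/
/-- The adjacency `c_k` on `ℤⁿ`: two points are adjacent iff they are distinct,
every coordinate differs by at most 1, and at most `k` coordinates differ. -/
def CAdj (n k : ℕ) (x y : Fin n → ℤ) : Prop :=
  x ≠ y ∧ (∀ i, |x i - y i| ≤ 1) ∧
    (Finset.univ.filter fun i => x i ≠ y i).card ≤ k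

/-- The standard inclusion `ℤⁿ ⊂ ℝⁿ`. -/
def intToReal (n : ℕ) (x : Fin n → ℤ) : Fin n → ℝ := fun i => (x i : ℝ)

namespace SimplexChain

/-- Chains modulo two of the augmented ordered simplicial complex spanned by `V`. -/
abbrev Chain (V : Type*) := List V →₀ ZMod 2

/-- The linear map prepending a vertex to every simplex. -/
noncomputable def cons {V : Type*} (x : V) : Chain V →ₗ[ZMod 2] Chain V :=
  Finsupp.lmapDomain _ _ (List.cons x)

/-- The chain map induced by a map of vertices. -/
noncomputable def push {V W : Type*} (g : V → W) : Chain V →ₗ[ZMod 2] Chain W :=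
  Finsupp.lmapDomain _ _ (List.map g)

/-- The boundary of a simplex. -/
noncomputable def bdList {V : Type*} : List V → Chain V
  | [] => 0
  | x :: l => Finsupp.single l 1 + cons x (bdList l)

/-- The augmented boundary operator. -/
noncomputable def bd {V : Type*} : Chain V →ₗ[ZMod 2] Chain V :=
  Finsupp.linearCombination (ZMod 2) bdList

/-- The prism over a simplex spanned by the simplex and its image under `g`. -/
noncomputable def prismList {V : Type*} (g : V → V) : List V → Chain V
  | [] => 0
  | x :: l => Finsupp.single (x :: g x :: l.map g) 1 + cons x (prismList g l)

/-- The prism operator between the identity and the chain map induced by `g`. -/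
noncomputable def prism {V : Type*} (g : V → V) : Chain V →ₗ[ZMod 2] Chain V :=
  Finsupp.linearCombination (ZMod 2) (prismList g)

section Operators

variable {V : Type*}

@[simp] lemma cons_single (x : V) (l : List V) :
    cons x (Finsupp.single l 1) = Finsupp.single (x :: l) 1 := by
  simp [cons]

@[simp] lemma push_single {W : Type*} (g : V → W) (l : List V) :
    push g (Finsupp.single l 1) = Finsupp.single (l.map g) 1 := by
  simp [push]

@[simp] lemma bd_single (l : List V) : bd (Finsupp.single l 1) = bdList l := by
  simp [bd]

@[simp] lemma prism_single (g : V → V) (l : List V) :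
    prism g (Finsupp.single l 1) = prismList g l := by
  simp [prism]

lemma linearMap_congr {M : Type*} [AddCommMonoid M] [Module (ZMod 2) M]
    {φ ψ : Chain V →ₗ[ZMod 2] M}
    (h : ∀ l, φ (Finsupp.single l 1) = ψ (Finsupp.single l 1)) (c : Chain V) : φ c = ψ c := by
  have : φ = ψ := Finsupp.lhom_ext' fun l => LinearMap.ext_ring (h l)
  rw [this]

lemma push_cons {W : Type*} (g : V → W) (x : V) (c : Chain V) :
    push g (cons x c) = cons (g x) (push g c) :=
  linearMap_congr (φ := push g ∘ₗ cons x) (ψ := cons (g x) ∘ₗ push g) (by simp) c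

lemma bd_cons (x : V) (c : Chain V) : bd (cons x c) = c + cons x (bd c) :=
  linearMap_congr (φ := bd ∘ₗ cons x) (ψ := LinearMap.id + cons x ∘ₗ bd) (by simp [bdList]) c

lemma prism_cons (g : V → V) (x : V) (c : Chain V) :
    prism g (cons x c) = cons x (cons (g x) (push g c)) + cons x (prism g c) :=
  linearMap_congr (φ := prism g ∘ₗ cons x)
    (ψ := cons x ∘ₗ cons (g x) ∘ₗ push g + cons x ∘ₗ prism g) (by simp [prismList]) c

lemma push_bd (g : V → V) (c : Chain V) : push g (bd c) = bd (push g c) := by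
  refine linearMap_congr (φ := push g ∘ₗ bd) (ψ := bd ∘ₗ push g) (fun l => ?_) c
  induction l with
  | nil => simp [bdList]
  | cons x l ih => simp_all [bdList, push_cons]

lemma push_prism {g g' h : V → V} (hg : ∀ x, h (g x) = g' (h x)) (c : Chain V) :
    push h (prism g c) = prism g' (push h c) := by
  refine linearMap_congr (φ := push h ∘ₗ prism g) (ψ := prism g' ∘ₗ push h) (fun l => ?_) c
  induction l with
  | nil => simp [prismList]
  | cons x l ih =>
    have hc : h ∘ g = g' ∘ h := funext hg
    simp_all [prismList, push_cons]

lemma push_push (g h : V → V) (c : Chain V) : push g (push h c) = push (g ∘ h) c :=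
  linearMap_congr (φ := push g ∘ₗ push h) (ψ := push (g ∘ h)) (by simp) c

lemma bd_bd (c : Chain V) : bd (bd c) = 0 := by
  refine linearMap_congr (φ := bd ∘ₗ bd) (ψ := 0) (fun l => ?_) c
  induction l with
  | nil => simp [bdList]
  | cons x l ih => simp_all [bdList, bd_cons, ZModModule.add_self]

lemma bd_prism (g : V → V) (c : Chain V) :
    bd (prism g c) = push g c + c + prism g (bd c) := by
  refine linearMap_congr (φ := bd ∘ₗ prism g) (ψ := push g + LinearMap.id + prism g ∘ₗ bd)
    (fun l => ?_) c
  induction l with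
  | nil => simp [prismList, bdList, ZModModule.add_self]
  | cons x l ih =>
    simp only [LinearMap.coe_comp, Function.comp_apply, prism_single, LinearMap.add_apply,
      push_single, LinearMap.id_coe, id_eq, bd_single] at ih
    simp only [LinearMap.coe_comp, Function.comp_apply, prism_single, prismList, map_add,
      bd_single, bdList, cons_single, bd_cons, ih, LinearMap.add_apply, push_single, List.map_cons,
      LinearMap.id_coe, id_eq, prism_cons]
    rw [← bd_single (l.map g), ← push_single, ← push_bd, bd_single]
    have h := ZModModule.add_self (Finsupp.single (x :: l.map g) (1 : ZMod 2))
    linear_combination (norm := module) h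

end Operators

section Translation

variable {V : Type*} [AddCommGroup V]

/-- The prism operator along the segment from `0` to `N • v`. -/
noncomputable def sweep (v : V) (N : ℕ) : Chain V →ₗ[ZMod 2] Chain V :=
  ∑ i ∈ Finset.range N, push (· + i • v) ∘ₗ prism (· + v)

lemma bd_sweep (v : V) (N : ℕ) (c : Chain V) :
    bd (sweep v N c) = push (· + N • v) c + c + sweep v N (bd c) := by
  induction N with
  | zero =>
    have : push (· + 0 • v) c = c :=
      linearMap_congr (φ := push (· + 0 • v)) (ψ := LinearMap.id) (by simp) c
    rw [this, ZModModule.add_self]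
    simp [sweep]
  | succ N ih =>
    have hs (c : Chain V) :
        sweep v (N + 1) c = sweep v N c + push (· + N • v) (prism (· + v) c) := by
      simp [sweep, Finset.sum_range_succ]
    have hp : push (· + N • v) (push (· + v) c) = push (· + (N + 1) • v) c := by
      rw [push_push]
      congr 2
      funext x
      simp only [Function.comp_apply, succ_nsmul]
      abel
    rw [hs, hs, map_add, ih, ← push_bd, bd_prism, map_add, map_add, hp]
    have h := ZModModule.add_self (push (· + N • v) c)
    linear_combination (norm := module) h

lemma push_neg_sweep (v : V) (N : ℕ) (c : Chain V) :
    push Neg.neg (sweep v N c) = sweep (-v) N (push Neg.neg c) := by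
  simp only [sweep, LinearMap.sum_apply, map_sum, LinearMap.comp_apply]
  refine Finset.sum_congr rfl fun i _ => ?_
  rw [← push_prism (g := (· + v)) (h := Neg.neg) (fun x => neg_add x v), push_push, push_push]
  congr 2
  funext x
  simp [add_comm]

/-- The chain of the box `[-N, N]^k` in the directions `e 0, …, e (k - 1)`. -/
noncomputable def boxChain (e : ℕ → V) (N : ℕ) : ℕ → Chain V
  | 0 => Finsupp.single [0] 1
  | k + 1 => sweep (e k) N (boxChain e N k) + sweep (-e k) N (boxChain e N k)

/-- One half of the boundary of the box chain of dimension `k + 1`. -/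
noncomputable def halfSphere (e : ℕ → V) (N k : ℕ) : Chain V :=
  push (· + N • e k) (boxChain e N k) + sweep (e k) N (bd (boxChain e N k))

lemma bd_halfSphere (e : ℕ → V) (N k : ℕ) : bd (halfSphere e N k) = bd (boxChain e N k) := by
  rw [halfSphere, map_add, ← push_bd, bd_sweep, bd_bd, map_zero]
  have h := ZModModule.add_self (push (· + N • e k) (bd (boxChain e N k)))
  linear_combination (norm := module) h

lemma push_neg_boxChain (e : ℕ → V) (N k : ℕ) :
    push Neg.neg (boxChain e N k) = boxChain e N k := by
  induction k with
  | zero => simp [boxChain]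
  | succ k ih => simp only [boxChain, map_add, push_neg_sweep, ih, neg_neg, add_comm]

lemma halfSphere_add_push_neg (e : ℕ → V) (N k : ℕ) :
    halfSphere e N k + push Neg.neg (halfSphere e N k) = bd (boxChain e N (k + 1)) := by
  have hp : push Neg.neg (push (· + N • e k) (boxChain e N k)) =
      push (· + N • -e k) (boxChain e N k) := by
    conv_rhs => rw [← push_neg_boxChain e N k]
    rw [push_push, push_push]
    congr 2
    funext x
    simp [add_comm]
  rw [halfSphere, boxChain, map_add, map_add, bd_sweep, bd_sweep, push_neg_sweep, push_bd,
    push_neg_boxChain, hp]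
  have h := ZModModule.add_self (boxChain e N k)
  linear_combination (norm := module) -h

end Translation

/-- The indicator of lists of natural numbers of alternating parity, the first being odd exactly
when `b` is true. -/
def alt : Bool → List ℕ → ZMod 2
  | _, [] => 1
  | b, a :: s => if decide (a % 2 = 1) = b then alt (!b) s else 0

/-- The sum of a function over all lists with one entry removed. -/
def del {α : Type*} (F : List α → ZMod 2) : List α → ZMod 2
  | [] => 0
  | a :: s => F s + del (fun t => F (a :: t)) s

lemma del_alt (s : List ℕ) (b : Bool) : del (alt b) s = alt b s + alt (!b) s := by
  induction s generalizing b with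
  | nil => simp [del, alt, ZModModule.add_self]
  | cons a s ih =>
    by_cases h : decide (a % 2 = 1) = b
    · have h' : ¬ decide (a % 2 = 1) = !b := by simp [h]
      have hF : (fun t => alt b (a :: t)) = alt (!b) := funext fun t => by simp [alt, h]
      rw [del, hF, ih, alt, alt, if_pos h, if_neg h', Bool.not_not]
      have := ZModModule.add_self (alt b s)
      linear_combination this
    · have h' : decide (a % 2 = 1) = !b := by
        revert h; cases b <;> simp
      have hF : (fun t => alt b (a :: t)) = fun _ => 0 := funext fun t => by simp [alt, h]
      have h0 (t : List ℕ) : del (fun _ => 0) t = 0 := by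
        induction t with
        | nil => rfl
        | cons a t iht => simp [del, iht]
      rw [del, hF, h0, alt, alt, if_neg h, if_pos h', Bool.not_not, add_zero, zero_add]

lemma del_map {α β : Type*} (F : List β → ZMod 2) (g : α → β) (l : List α) :
    del (fun t => F (t.map g)) l = del F (l.map g) := by
  induction l generalizing F with
  | nil => rfl
  | cons a l ih => simp [del, ih fun t => F (g a :: t)]

lemma del_congr {α : Type*} {F G : List α → ZMod 2} {l : List α}
    (h : ∀ t, t.Sublist l → F t = G t) : del F l = del G l := by
  induction l generalizing F G with
  | nil => rfl
  | cons a l ih =>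
    rw [del, del, h l (List.sublist_cons_self a l), ih fun t ht => h _ (ht.cons_cons a)]

lemma del_perm {α : Type*} {F : List α → ZMod 2} (hF : ∀ s t : List α, s.Perm t → F s = F t)
    {s t : List α} (h : s.Perm t) : del F s = del F t := by
  induction h generalizing F with
  | nil => rfl
  | cons a h ih => rw [del, del, hF _ _ h, ih fun _ _ h' => hF _ _ (h'.cons a)]
  | swap a b l =>
    have : (fun t => F (b :: a :: t)) = fun t => F (a :: b :: t) :=
      funext fun t => hF _ _ (List.Perm.swap a b t)
    simp only [del, this]
    ring
  | trans _ _ ih₁ ih₂ => rw [ih₁ hF, ih₂ hF]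

/-- The indicator of lists of natural numbers whose increasing rearrangement is of alternating
parity. -/
def sortAlt (b : Bool) (s : List ℕ) : ZMod 2 := alt b (s.insertionSort (· ≤ ·))

lemma sortAlt_perm (b : Bool) {s t : List ℕ} (h : s.Perm t) : sortAlt b s = sortAlt b t := by
  have : s.insertionSort (· ≤ ·) = t.insertionSort (· ≤ ·) :=
    List.Perm.eq_of_pairwise (fun _ _ _ _ => le_antisymm) (List.pairwise_insertionSort _ s)
      (List.pairwise_insertionSort _ t)
      (((List.perm_insertionSort _ s).trans h).trans (List.perm_insertionSort _ t).symm)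
  rw [sortAlt, sortAlt, this]

lemma del_sortAlt (s : List ℕ) (b : Bool) :
    del (sortAlt b) s = sortAlt b s + sortAlt (!b) s := by
  have hs := List.perm_insertionSort (· ≤ ·) s
  rw [del_perm (fun _ _ => sortAlt_perm b) hs.symm, sortAlt, sortAlt, ← del_alt]
  refine del_congr fun t ht => ?_
  rw [sortAlt, ((List.pairwise_insertionSort _ s).sublist ht).insertionSort_eq]

/-- The involution of the natural numbers exchanging `2 * i` and `2 * i + 1`. -/
def swapParity (a : ℕ) : ℕ := if a % 2 = 0 then a + 1 else a - 1

lemma alt_map_swapParity (b : Bool) (s : List ℕ) : alt b (s.map swapParity) = alt (!b) s := by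
  induction s generalizing b with
  | nil => rfl
  | cons a s ih =>
    have : decide (swapParity a % 2 = 1) = !decide (a % 2 = 1) := by
      rw [swapParity, ← decide_not, decide_eq_decide]
      split_ifs <;> omega
    rw [List.map_cons, alt, alt, ih, this]
    cases b <;> simp

lemma sortAlt_map_swapParity (b : Bool) {s : List ℕ}
    (hs : ∀ x ∈ s, ∀ y ∈ s, x ≠ swapParity y) :
    sortAlt b (s.map swapParity) = sortAlt (!b) s := by
  rw [sortAlt, sortAlt, ← alt_map_swapParity,
    List.map_insertionSort (r := (· ≤ ·)) (s := (· ≤ ·))]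
  intro x hx y hy
  have h₁ := hs x hx y hy
  have h₂ := hs y hy x hx
  unfold swapParity at *
  split_ifs at * <;> omega

lemma pairwise_of_alt_ne_zero {b : Bool} {s : List ℕ} (hs : s.Pairwise (· ≤ ·))
    (hc : ∀ x ∈ s, ∀ y ∈ s, x ≠ swapParity y) (h : alt b s ≠ 0) :
    s.Pairwise fun x y => x / 2 < y / 2 := by
  induction s generalizing b with
  | nil => exact List.Pairwise.nil
  | cons a s ih =>
    rw [alt] at h
    split_ifs at h with hb
    · have hp := ih hs.of_cons (fun x hx y hy => hc x (by simp [hx]) y (by simp [hy])) h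
      refine List.pairwise_cons.2 ⟨?_, hp⟩
      cases s with
      | nil => simp
      | cons a' s =>
        have ha : a / 2 < a' / 2 := by
          have h₁ : a ≤ a' := (List.pairwise_cons.1 hs).1 a' (by simp)
          have h₂ := hc a' (by simp) a (by simp)
          rw [alt] at h
          split_ifs at h with hb'
          · have : ¬ (a' % 2 = 1 ↔ a % 2 = 1) := by
              rw [← decide_eq_decide, hb, hb']
              simp
            unfold swapParity at h₂
            split_ifs at h₂ <;> omega
          · exact absurd rfl h
        intro c hc'
        rcases List.mem_cons.1 hc' with rfl | hc'
        · exact ha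
        · exact ha.trans ((List.pairwise_cons.1 hp).1 c hc')
    · exact absurd rfl h

lemma sortAlt_eq_zero {b : Bool} {s : List ℕ} {m : ℕ} (hm : ∀ x ∈ s, x < 2 * m)
    (hc : ∀ x ∈ s, ∀ y ∈ s, x ≠ swapParity y) (hl : m < s.length) : sortAlt b s = 0 := by
  by_contra h
  have hp := pairwise_of_alt_ne_zero (List.pairwise_insertionSort _ s) (by simpa using hc) h
  have hn : ((s.insertionSort (· ≤ ·)).map (· / 2)).Nodup :=
    List.pairwise_map.2 (hp.imp fun h => h.ne)
  have hsub : (s.insertionSort (· ≤ ·)).map (· / 2) ⊆ List.range m := by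
    intro x hx
    simp only [List.mem_map, List.mem_insertionSort] at hx
    obtain ⟨y, hy, rfl⟩ := hx
    have := hm y hy
    simp only [List.mem_range]
    omega
  have := (hn.subperm hsub).length_le
  simp only [List.length_map, List.length_insertionSort, List.length_range] at this
  omega

/-- The number modulo two of the simplices of a chain whose labels alternate in parity. -/
noncomputable def altCount {V : Type*} (lab : V → ℕ) (b : Bool) : Chain V →ₗ[ZMod 2] ZMod 2 :=
  Finsupp.linearCombination (ZMod 2) fun l => sortAlt b (l.map lab)

lemma linearCombination_bdList {V : Type*} (F : List V → ZMod 2) (l : List V) :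
    Finsupp.linearCombination (ZMod 2) F (bdList l) = del F l := by
  induction l generalizing F with
  | nil => simp [bdList, del]
  | cons x l ih =>
    have hc (c : Chain V) : Finsupp.linearCombination (ZMod 2) F (cons x c) =
        Finsupp.linearCombination (ZMod 2) (fun t => F (x :: t)) c :=
      linearMap_congr (φ := Finsupp.linearCombination (ZMod 2) F ∘ₗ cons x) (by simp) c
    simp [bdList, del, hc, ih]

lemma altCount_bd {V : Type*} (lab : V → ℕ) (b : Bool) (c : Chain V) :
    altCount lab b (bd c) = altCount lab b c + altCount lab (!b) c := by
  refine linearMap_congr (φ := altCount lab b ∘ₗ bd) (ψ := altCount lab b + altCount lab (!b))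
    (fun l => ?_) c
  simp only [LinearMap.comp_apply, bd_single, altCount, linearCombination_bdList,
    LinearMap.add_apply, Finsupp.linearCombination_single, one_smul]
  rw [del_map, del_sortAlt]

section Support

variable {V : Type*}

lemma eq_of_mem_supported {M : Type*} [AddCommMonoid M] [Module (ZMod 2) M]
    {φ ψ : Chain V →ₗ[ZMod 2] M} {S : Set (List V)}
    (h : ∀ l ∈ S, φ (Finsupp.single l 1) = ψ (Finsupp.single l 1)) {c : Chain V}
    (hc : c ∈ Finsupp.supported (ZMod 2) (ZMod 2) S) : φ c = ψ c := by
  rw [Finsupp.supported_eq_span_single] at hc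
  exact LinearMap.eqOn_span (by rintro _ ⟨l, hl, rfl⟩; exact h l hl) hc

lemma map_mem_supported {W : Type*} {φ : Chain V →ₗ[ZMod 2] Chain W} {S : Set (List V)}
    {T : Set (List W)}
    (h : ∀ l ∈ S, φ (Finsupp.single l 1) ∈ Finsupp.supported (ZMod 2) (ZMod 2) T) {c : Chain V}
    (hc : c ∈ Finsupp.supported (ZMod 2) (ZMod 2) S) :
    φ c ∈ Finsupp.supported (ZMod 2) (ZMod 2) T := by
  rw [Finsupp.supported_eq_span_single] at hc
  refine (Submodule.map_span_le φ _ _).2 ?_ (Submodule.mem_map_of_mem hc)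
  rintro _ ⟨l, hl, rfl⟩
  exact h l hl

lemma push_mem_supported {W : Type*} {g : V → W} {S : Set (List V)} {T : Set (List W)}
    (h : ∀ l ∈ S, l.map g ∈ T) {c : Chain V}
    (hc : c ∈ Finsupp.supported (ZMod 2) (ZMod 2) S) :
    push g c ∈ Finsupp.supported (ZMod 2) (ZMod 2) T := by
  refine map_mem_supported (fun l hl => ?_) hc
  rw [push_single]
  exact Finsupp.single_mem_supported _ _ (h l hl)

lemma prismList_mem_supported (g : V → V) (l : List V) :
    prismList g l ∈ Finsupp.supported (ZMod 2) (ZMod 2)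
      {t | t.length = l.length + 1 ∧ ∀ z ∈ t, ∃ x ∈ l, z = x ∨ z = g x} := by
  induction l with
  | nil => exact Submodule.zero_mem _
  | cons x l ih =>
    refine Submodule.add_mem _ (Finsupp.single_mem_supported _ _ ?_) (map_mem_supported ?_ ih)
    · simp only [Set.mem_ofPred_eq, List.length_cons, List.length_map, true_and]
      intro z hz
      simp only [List.mem_cons, List.mem_map] at hz
      rcases hz with rfl | rfl | ⟨y, hy, rfl⟩
      · exact ⟨z, by simp, Or.inl rfl⟩
      · exact ⟨x, by simp, Or.inr rfl⟩
      · exact ⟨y, by simp [hy], Or.inr rfl⟩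
    · rintro t ⟨ht, hz⟩
      rw [cons_single]
      refine Finsupp.single_mem_supported _ _ ⟨by simp [ht], fun z h => ?_⟩
      rcases List.mem_cons.1 h with rfl | h
      · exact ⟨z, by simp, Or.inl rfl⟩
      · obtain ⟨y, hy, h⟩ := hz z h
        exact ⟨y, by simp [hy], h⟩

end Support

section Lattice

variable {n : ℕ}

/-- Lists of `r` points of `A` whose coordinates pairwise differ by at most one. -/
def smallLists (A : Set (Fin n → ℤ)) (r : ℕ) : Set (List (Fin n → ℤ)) :=
  {l | l.length = r ∧ (∀ x ∈ l, x ∈ A) ∧ ∀ x ∈ l, ∀ y ∈ l, ∀ j, |x j - y j| ≤ 1}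

lemma push_add_mem_supported {A A' : Set (Fin n → ℤ)} {v : Fin n → ℤ} (h : ∀ x ∈ A, x + v ∈ A')
    {r : ℕ} {c : Chain (Fin n → ℤ)}
    (hc : c ∈ Finsupp.supported (ZMod 2) (ZMod 2) (smallLists A r)) :
    push (· + v) c ∈ Finsupp.supported (ZMod 2) (ZMod 2) (smallLists A' r) := by
  refine push_mem_supported ?_ hc
  rintro l ⟨hl, hA, hs⟩
  refine ⟨by simp [hl], ?_, ?_⟩
  · simp only [List.mem_map]
    rintro _ ⟨x, hx, rfl⟩
    exact h x (hA x hx)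
  · simp only [List.mem_map]
    rintro _ ⟨x, hx, rfl⟩ _ ⟨y, hy, rfl⟩ j
    simpa using hs x hx y hy j

lemma push_neg_mem_supported {A : Set (Fin n → ℤ)} (h : ∀ x ∈ A, -x ∈ A)
    {r : ℕ} {c : Chain (Fin n → ℤ)}
    (hc : c ∈ Finsupp.supported (ZMod 2) (ZMod 2) (smallLists A r)) :
    push Neg.neg c ∈ Finsupp.supported (ZMod 2) (ZMod 2) (smallLists A r) := by
  refine push_mem_supported ?_ hc
  rintro l ⟨hl, hA, hs⟩
  refine ⟨by simp [hl], ?_, ?_⟩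
  · simp only [List.mem_map]
    rintro _ ⟨x, hx, rfl⟩
    exact h x (hA x hx)
  · simp only [List.mem_map]
    rintro _ ⟨x, hx, rfl⟩ _ ⟨y, hy, rfl⟩ j
    have := hs y hy x hx j
    simpa [neg_add_eq_sub] using this

lemma sweep_mem_supported {A A' : Set (Fin n → ℤ)} {v : Fin n → ℤ} {N : ℕ}
    (h : ∀ x ∈ A, ∀ i ≤ N, x + i • v ∈ A') (hv : ∀ j, |v j| ≤ 1)
    (h0 : ∀ x ∈ A, ∀ j, v j ≠ 0 → x j = 0) {r : ℕ} {c : Chain (Fin n → ℤ)}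
    (hc : c ∈ Finsupp.supported (ZMod 2) (ZMod 2) (smallLists A r)) :
    sweep v N c ∈ Finsupp.supported (ZMod 2) (ZMod 2) (smallLists A' (r + 1)) := by
  simp only [sweep, LinearMap.sum_apply, LinearMap.comp_apply]
  refine Submodule.sum_mem _ fun i hi => ?_
  rw [Finset.mem_range] at hi
  refine push_add_mem_supported (A := {z | ∃ x ∈ A, z = x ∨ z = x + v}) ?_
    (map_mem_supported ?_ hc)
  · rintro z ⟨x, hx, rfl | rfl⟩
    · exact h z hx i hi.le
    · have := h x hx (i + 1) hi
      rwa [succ_nsmul', ← add_assoc] at this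
  · rintro l ⟨hl, hA, hs⟩
    rw [prism_single]
    refine Finsupp.supported_mono ?_ (prismList_mem_supported _ l)
    rintro t ⟨ht, hz⟩
    refine ⟨by rw [ht, hl], fun z h => ?_, fun z h z' h' j => ?_⟩
    · obtain ⟨x, hx, hzx⟩ := hz z h
      exact ⟨x, hA x hx, hzx⟩
    · obtain ⟨x, hx, hzx⟩ := hz z h
      obtain ⟨y, hy, hzy⟩ := hz z' h'
      have hxy := hs x hx y hy j
      have hvj := hv j
      by_cases hj : v j = 0
      · rcases hzx with rfl | rfl <;> rcases hzy with rfl | rfl <;> simpa [hj] using hxy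
      · have h₁ := h0 x (hA x hx) j hj
        have h₂ := h0 y (hA y hy) j hj
        rcases hzx with rfl | rfl <;> rcases hzy with rfl | rfl <;> simp [h₁, h₂, hvj]

/-- The unit vector in direction `k`, or zero if `k` is out of range. -/
def unitVec (n k : ℕ) : Fin n → ℤ := fun j => if j.val = k then 1 else 0

/-- The lattice points of `[-N, N]^k`. -/
def cube (n N k : ℕ) : Set (Fin n → ℤ) := {x | (∀ j, |x j| ≤ N) ∧ ∀ j : Fin n, k ≤ j → x j = 0}

/-- The lattice points of the boundary of `[-N, N]^k`. -/
def cubeSphere (n N k : ℕ) : Set (Fin n → ℤ) := {x ∈ cube n N k | ∃ j, |x j| = N}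

lemma neg_mem_cube {N k : ℕ} {x : Fin n → ℤ} (h : x ∈ cube n N k) : -x ∈ cube n N k :=
  ⟨fun j => by simpa using h.1 j, fun j hj => by simpa using h.2 j hj⟩

lemma neg_mem_cubeSphere {N k : ℕ} {x : Fin n → ℤ} (h : x ∈ cubeSphere n N k) :
    -x ∈ cubeSphere n N k :=
  ⟨neg_mem_cube h.1, h.2.imp fun j hj => by simpa using hj⟩

lemma abs_unitVec_le (k : ℕ) (j : Fin n) : |unitVec n k j| ≤ 1 := by
  unfold unitVec
  split_ifs <;> simp

lemma add_mem_cube {N k i : ℕ} (hi : i ≤ N) {x : Fin n → ℤ} (h : x ∈ cube n N k) :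
    x + i • unitVec n k ∈ cube n N (k + 1) := by
  refine ⟨fun j => ?_, fun j hj => ?_⟩
  · by_cases hj : j.val = k
    · simpa [unitVec, hj, h.2 j hj.ge] using hi
    · simpa [unitVec, hj] using h.1 j
  · have hk : ¬ j.val = k := by omega
    simpa [unitVec, hk] using h.2 j (by omega)

lemma sub_mem_cube {N k i : ℕ} (hi : i ≤ N) {x : Fin n → ℤ} (h : x ∈ cube n N k) :
    x + i • -unitVec n k ∈ cube n N (k + 1) := by
  have := neg_mem_cube (add_mem_cube hi (neg_mem_cube h))
  simpa [add_comm] using this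

lemma eq_zero_of_unitVec_ne_zero {N k : ℕ} {x : Fin n → ℤ} (h : x ∈ cube n N k) {j : Fin n}
    (hj : unitVec n k j ≠ 0) : x j = 0 := by
  refine h.2 j ?_
  by_contra! hlt
  exact hj (by simp [unitVec, hlt.ne])

lemma boxChain_mem_supported (N k : ℕ) :
    boxChain (unitVec n) N k ∈
      Finsupp.supported (ZMod 2) (ZMod 2) (smallLists (cube n N k) (k + 1)) := by
  induction k with
  | zero => exact Finsupp.single_mem_supported _ _ (by simp [smallLists, cube])
  | succ k ih =>
    refine Submodule.add_mem _
      (sweep_mem_supported (fun x hx i hi => add_mem_cube hi hx) (abs_unitVec_le k)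
        (fun x hx j hj => eq_zero_of_unitVec_ne_zero hx hj) ih)
      (sweep_mem_supported (fun x hx i hi => sub_mem_cube hi hx)
        (fun j => by simpa using abs_unitVec_le k j)
        (fun x hx j hj => eq_zero_of_unitVec_ne_zero hx (by simpa using hj)) ih)

lemma add_mem_cubeSphere {N k i : ℕ} (hN : 0 < N) (hi : i ≤ N) {x : Fin n → ℤ}
    (h : x ∈ cubeSphere n N k) : x + i • unitVec n k ∈ cubeSphere n N (k + 1) := by
  refine ⟨add_mem_cube hi h.1, ?_⟩
  obtain ⟨j, hj⟩ := h.2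
  refine ⟨j, ?_⟩
  have hk : unitVec n k j = 0 := by
    by_contra hk
    rw [eq_zero_of_unitVec_ne_zero h.1 hk] at hj
    simp at hj
    omega
  simpa [hk] using hj

lemma halfSphere_mem_supported_of_bd {N k : ℕ} (hN : 0 < N) (hk : k < n)
    (h : bd (boxChain (unitVec n) N k) ∈
      Finsupp.supported (ZMod 2) (ZMod 2) (smallLists (cubeSphere n N k) k)) :
    halfSphere (unitVec n) N k ∈
      Finsupp.supported (ZMod 2) (ZMod 2) (smallLists (cubeSphere n N (k + 1)) (k + 1)) := by
  refine Submodule.add_mem _ (push_add_mem_supported ?_ (boxChain_mem_supported N k))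
    (sweep_mem_supported (fun x hx i hi => add_mem_cubeSphere hN hi hx) (abs_unitVec_le k)
        (fun x hx j hj => eq_zero_of_unitVec_ne_zero hx.1 hj) h)
  intro x hx
  refine ⟨add_mem_cube le_rfl hx, ⟨k, hk⟩, ?_⟩
  simp [unitVec, hx.2 ⟨k, hk⟩ le_rfl]

lemma bd_boxChain_mem_supported {N k : ℕ} (hN : 0 < N) (hk : k ≤ n) :
    bd (boxChain (unitVec n) N k) ∈
      Finsupp.supported (ZMod 2) (ZMod 2) (smallLists (cubeSphere n N k) k) := by
  induction k with
  | zero =>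
    simp only [boxChain, bd_single, bdList, map_zero, add_zero]
    exact Finsupp.single_mem_supported _ _ (by simp [smallLists])
  | succ k ih =>
    have := halfSphere_mem_supported_of_bd hN hk (ih (by omega))
    rw [← halfSphere_add_push_neg]
    exact Submodule.add_mem _ this (push_neg_mem_supported (fun x => neg_mem_cubeSphere) this)

/-- **Tucker's lemma** on the boundary of a cube, the labels `2 * i` and `2 * i + 1` being opposite
to each other. -/
theorem tucker {m N : ℕ} (hN : 0 < N) (lab : (Fin (m + 1) → ℤ) → ℕ)
    (hlt : ∀ x : Fin (m + 1) → ℤ, (∀ j, |x j| ≤ N) → (∃ j, |x j| = N) → lab x < 2 * m)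
    (hneg : ∀ x : Fin (m + 1) → ℤ, (∀ j, |x j| ≤ N) → (∃ j, |x j| = N) →
      lab (-x) = swapParity (lab x)) :
    ∃ x y : Fin (m + 1) → ℤ, ((∀ j, |x j| ≤ N) ∧ ∃ j, |x j| = N) ∧
      ((∀ j, |y j| ≤ N) ∧ ∃ j, |y j| = N) ∧
      (∀ j, |x j - y j| ≤ 1) ∧ lab x = swapParity (lab y) := by
  by_contra! hcon
  set e := unitVec (m + 1)
  have hsupp {k : ℕ} (hk : k ≤ m) : halfSphere e N k ∈ Finsupp.supported (ZMod 2) (ZMod 2)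
      (smallLists (cubeSphere (m + 1) N (k + 1)) (k + 1)) :=
    halfSphere_mem_supported_of_bd hN (by omega) (bd_boxChain_mem_supported hN (by omega))
  have hgood {k r : ℕ} {l : List (Fin (m + 1) → ℤ)}
      (hl : l ∈ smallLists (cubeSphere (m + 1) N k) r) :
      ∀ a ∈ l.map lab, ∀ b ∈ l.map lab, a ≠ swapParity b := by
    simp only [List.mem_map]
    rintro _ ⟨x, hx, rfl⟩ _ ⟨y, hy, rfl⟩
    have h₁ := hl.2.1 x hx
    have h₂ := hl.2.1 y hy
    exact hcon x y ⟨h₁.1.1, h₁.2⟩ ⟨h₂.1.1, h₂.2⟩ (hl.2.2 x hx y hy)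
  have hflip {k : ℕ} (hk : k ≤ m) : altCount lab true (push Neg.neg (halfSphere e N k)) =
      altCount lab false (halfSphere e N k) := by
    refine eq_of_mem_supported (φ := altCount lab true ∘ₗ push Neg.neg) (fun l hl => ?_) (hsupp hk)
    have : (l.map Neg.neg).map lab = (l.map lab).map swapParity := by
      rw [List.map_map, List.map_map, List.map_inj_left]
      intro x hx
      have h := hl.2.1 x hx
      exact hneg x h.1.1 h.2
    simp only [LinearMap.comp_apply, push_single, altCount, Finsupp.linearCombination_single,
      one_smul, this]
    exact sortAlt_map_swapParity true (hgood hl)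
  have hstep {k : ℕ} (hk : k ≤ m) : altCount lab true (bd (boxChain e N (k + 1))) =
      altCount lab true (bd (boxChain e N k)) := by
    rw [← halfSphere_add_push_neg, map_add, hflip hk, ← bd_halfSphere, altCount_bd, Bool.not_true]
  have hone {k : ℕ} (hk : k ≤ m + 1) : altCount lab true (bd (boxChain e N k)) = 1 := by
    induction k with
    | zero => simp [boxChain, bdList, altCount, sortAlt, alt]
    | succ k ih => rw [hstep (by omega), ih (by omega)]
  have hzero : altCount lab true (bd (boxChain e N (m + 1))) = 0 := by
    refine eq_of_mem_supported (ψ := 0) (fun l hl => ?_) (bd_boxChain_mem_supported hN le_rfl)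
    simp only [altCount, Finsupp.linearCombination_single, one_smul, LinearMap.zero_apply]
    refine sortAlt_eq_zero (m := m) ?_ (hgood hl) (by simp [hl.1])
    simp only [List.mem_map]
    rintro _ ⟨x, hx, rfl⟩
    have h := hl.2.1 x hx
    exact hlt x h.1.1 h.2
  rw [hone le_rfl] at hzero
  exact one_ne_zero hzero

end Lattice

end SimplexChain

/-- The **Borsuk-Ulam theorem** on the unit sphere of the sup norm. -/
theorem exists_norm_eq_one_and_eq_zero_of_odd {m : ℕ} {G : (Fin (m + 1) → ℝ) → Fin m → ℝ}
    (hG : Continuous G) (hodd : ∀ t, G (-t) = -G t) : ∃ t, ‖t‖ = 1 ∧ G t = 0 := by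
  by_contra! hne
  have hK : IsCompact (Metric.sphere (0 : Fin (m + 1) → ℝ) 1) := isCompact_sphere 0 1
  obtain ⟨t₀, ht₀, hmin⟩ := hK.exists_isMinOn (NormedSpace.sphere_nonempty.2 zero_le_one)
    hG.norm.continuousOn
  obtain ⟨δ, hδ⟩ : ∃ δ, ‖G t₀‖ = δ := ⟨_, rfl⟩
  have hδ0 : 0 < δ := hδ ▸ norm_pos_iff.2 (hne t₀ (by simpa using ht₀))
  have hδG : ∀ t, ‖t‖ = 1 → δ ≤ ‖G t‖ := fun t ht => hδ ▸ hmin (by simpa using ht)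
  have hidx (v : Fin m → ℝ) : ∃ i, δ ≤ ‖v‖ → δ ≤ |v i| := by
    have : Nonempty (Fin m) := by
      by_contra h
      rw [not_nonempty_iff] at h
      exact hne t₀ (by simpa using ht₀) (Subsingleton.elim _ _)
    obtain ⟨i, hi⟩ := Finite.exists_max fun i => |v i|
    exact ⟨i, fun h => h.trans ((pi_norm_le_iff_of_nonneg (abs_nonneg _)).2 hi)⟩
  choose idx hidx using hidx
  obtain ⟨η, hη, hunif⟩ := Metric.uniformContinuousOn_iff.1
    (hK.uniformContinuousOn_of_continuous hG.continuousOn) δ hδ0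
  obtain ⟨N, hN⟩ := exists_nat_one_div_lt hη
  obtain ⟨pt, hpt⟩ : ∃ pt : (Fin (m + 1) → ℤ) → Fin (m + 1) → ℝ,
      ∀ y j, pt y j = (y j : ℝ) / (N + 1) := ⟨_, fun _ _ => rfl⟩
  have hN0 : (0 : ℝ) < N + 1 := by positivity
  have hpt_norm {y : Fin (m + 1) → ℤ} (h₁ : ∀ j, |y j| ≤ (N + 1 : ℕ))
      (h₂ : ∃ j, |y j| = (N + 1 : ℕ)) : ‖pt y‖ = 1 := by
    have habs (j) : ‖pt y j‖ = ((|y j| : ℤ) : ℝ) / (N + 1) := by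
      rw [hpt, Real.norm_eq_abs, abs_div, abs_of_pos hN0, Int.cast_abs]
    refine le_antisymm ((pi_norm_le_iff_of_nonneg zero_le_one).2 fun j => ?_) ?_
    · rw [habs, div_le_one hN0]
      exact_mod_cast h₁ j
    · obtain ⟨j, hj⟩ := h₂
      refine le_trans (le_of_eq ?_) (norm_le_pi_norm (pt y) j)
      rw [habs, hj]
      push_cast
      exact (div_self hN0.ne').symm
  have hpt_neg (y) : pt (-y) = -pt y := by
    ext j
    simp [hpt, neg_div]
  obtain ⟨c, hc⟩ : ∃ c : (Fin (m + 1) → ℤ) → Fin m,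
      ∀ y, c y = idx fun i => |G (pt y) i| := ⟨_, fun _ => rfl⟩
  have hc_neg (y) : c (-y) = c y := by simp [hc, hpt_neg, hodd]
  have hc_le {y : Fin (m + 1) → ℤ} (h : ‖pt y‖ = 1) : δ ≤ |G (pt y) (c y)| := by
    have := hidx (fun i => |G (pt y) i|) (by simpa [Pi.norm_def] using hδG _ h)
    rwa [← hc, abs_abs] at this
  obtain ⟨x, y, hx, hy, hxy, hlab⟩ := SimplexChain.tucker (m := m) (Nat.succ_pos N)
    (fun y => 2 * (c y : ℕ) + if 0 < G (pt y) (c y) then 1 else 0)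
    (fun y _ _ => by
      have := (c y).isLt
      split_ifs <;> omega)
    (fun y h₁ h₂ => by
      have h := hc_le (hpt_norm h₁ h₂)
      have h0 : G (pt y) (c y) ≠ 0 := abs_pos.1 (hδ0.trans_le h)
      simp only [hc_neg, hpt_neg, hodd, Pi.neg_apply, SimplexChain.swapParity]
      rcases h0.lt_or_gt with h0 | h0
      · simp only [if_pos (neg_pos.2 h0), if_neg h0.not_gt]
        split_ifs <;> omega
      · simp only [if_neg (neg_neg_of_pos h0).not_gt, if_pos h0]
        split_ifs <;> omega)
  have hx' := hpt_norm hx.1 hx.2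
  have hy' := hpt_norm hy.1 hy.2
  have hcxy : c x = c y ∧ (0 < G (pt x) (c x) ↔ ¬ 0 < G (pt y) (c y)) := by
    rw [← Fin.val_inj]
    unfold SimplexChain.swapParity at hlab
    split_ifs at hlab <;> constructor <;> first | omega | simp_all
  have hdist : dist (pt x) (pt y) < η := by
    refine lt_of_le_of_lt ((dist_pi_le_iff (by positivity)).2 fun j => ?_) hN
    rw [hpt, hpt, Real.dist_eq, ← sub_div, abs_div, abs_of_pos hN0]
    gcongr
    exact_mod_cast hxy j
  have hd := (dist_le_pi_dist _ _ (c y)).trans_lt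
    (hunif (pt x) (by simpa using hx') (pt y) (by simpa using hy') hdist)
  have h₁ := hc_le hx'
  have h₂ := hc_le hy'
  rw [hcxy.1] at h₁ hcxy
  rw [Real.dist_eq, abs_lt] at hd
  by_cases h : 0 < G (pt y) (c y)
  · have h' : ¬ 0 < G (pt x) (c y) := fun h' => hcxy.2.1 h' h
    rw [abs_of_pos h] at h₂
    linarith
  · have h' : 0 < G (pt x) (c y) := hcxy.2.2 h
    rw [abs_of_pos h'] at h₁
    linarith

/-- Lemma on digital simplices: for any `n`-box `B ⊂ ℤⁿ` (here `n = m + 1 ≥ 1`)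
with boundary `∂B` and canonical involution `τ`, and any function
`f : ∂B → ℤ^{n-1}`, there is a `cₙ`-simplex `σ ⊆ ∂B` such that the convex hulls
of `f(σ)` and `f(τ(σ))` intersect. -/
theorem digital_simplex_lemma (m : ℕ) (a b : Fin (m + 1) → ℤ)
    (hab : ∀ i, a i < b i)
    (B : Set (Fin (m + 1) → ℤ))
    (hB : B = {x | ∀ i, a i ≤ x i ∧ x i ≤ b i})
    (bdry : Set (Fin (m + 1) → ℤ))
    (hbdry : bdry = {x ∈ B | ∃ i, x i = a i ∨ x i = b i})
    (τ : (Fin (m + 1) → ℤ) → (Fin (m + 1) → ℤ))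
    (hτ : τ = fun x i => a i + b i - x i)
    (f : (Fin (m + 1) → ℤ) → (Fin m → ℤ)) :
    ∃ σ : Finset (Fin (m + 1) → ℤ), σ.Nonempty ∧ ↑σ ⊆ bdry ∧
      (∀ x ∈ σ, ∀ y ∈ σ, x ≠ y → CAdj (m + 1) (m + 1) x y) ∧
      (convexHull ℝ (intToReal m '' (f '' ↑σ)) ∩
        convexHull ℝ (intToReal m '' (f '' (τ '' ↑σ)))).Nonempty := by
  subst hB hbdry
  have hτ_apply (v : Fin (m + 1) → ℤ) (i) : τ v i = a i + b i - v i := by rw [hτ]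
  have hττ (v) : τ (τ v) = v := by
    ext i
    simp [hτ_apply]
  have hτ_mem {v} (hv : v ∈ Finset.Icc a b) : τ v ∈ Finset.Icc a b := by
    rw [Finset.mem_Icc] at hv ⊢
    refine ⟨fun i => ?_, fun i => ?_⟩ <;> have h₁ := hv.1 i <;> have h₂ := hv.2 i <;>
      rw [hτ_apply] <;> linarith
  obtain ⟨pos, hpos⟩ : ∃ pos : (Fin (m + 1) → ℝ) → Fin (m + 1) → ℝ,
      ∀ t i, pos t i = (a i + b i) / 2 + (b i - a i) / 2 * t i := ⟨_, fun _ _ => rfl⟩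
  obtain ⟨w, hw⟩ : ∃ w : (Fin (m + 1) → ℝ) → (Fin (m + 1) → ℤ) → ℝ,
      ∀ t v, w t v = ∏ i, max 0 (1 - |pos t i - v i|) := ⟨_, fun _ _ => rfl⟩
  have hw_nonneg (t v) : 0 ≤ w t v := by
    rw [hw]
    exact Finset.prod_nonneg fun i _ => le_max_left _ _
  have hw_pos {t v} : 0 < w t v ↔ ∀ i, |pos t i - v i| < 1 := by
    rw [(hw_nonneg t v).lt_iff_ne', hw, Finset.prod_ne_zero_iff]
    simp only [Finset.mem_univ, forall_const]
    refine forall_congr' fun i => ?_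
    rw [← (le_max_left (0 : ℝ) _).lt_iff_ne']
    simp
  have hw_neg (t v) : w (-t) v = w t (τ v) := by
    rw [hw, hw]
    refine Finset.prod_congr rfl fun i _ => ?_
    rw [← abs_neg, hpos, hpos, hτ_apply, Pi.neg_apply]
    push_cast
    ring_nf
  obtain ⟨G, hG⟩ : ∃ G : (Fin (m + 1) → ℝ) → Fin m → ℝ, ∀ t, G t =
      ∑ v ∈ Finset.Icc a b, w t v • (intToReal m (f v) - intToReal m (f (τ v))) :=
    ⟨_, fun _ => rfl⟩
  have hG_cont : Continuous G := by
    rw [funext hG]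
    simp only [hw, hpos]
    fun_prop
  have hG_odd (t) : G (-t) = -G t := by
    rw [hG, hG, ← Finset.sum_neg_distrib]
    refine Finset.sum_nbij' τ τ (fun _ => hτ_mem) (fun _ => hτ_mem) (fun v _ => hττ v)
      (fun v _ => hττ v) fun v _ => ?_
    rw [hw_neg, hττ, ← smul_neg, neg_sub]
  obtain ⟨t, ht, hGt⟩ := exists_norm_eq_one_and_eq_zero_of_odd hG_cont hG_odd
  have ht_le (i) : |t i| ≤ 1 := ht ▸ norm_le_pi_norm t i
  obtain ⟨k, hk⟩ : ∃ k, |t k| = 1 := by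
    by_contra! h
    exact ((pi_norm_lt_iff one_pos).2 fun i => (ht_le i).lt_of_ne (h i)).ne ht
  have hab' (i) : (a i : ℝ) < b i := by exact_mod_cast hab i
  have hpos_mem (i) : (a i : ℝ) ≤ pos t i ∧ pos t i ≤ b i := by
    have h := abs_le.1 (ht_le i)
    have h' := hab' i
    rw [hpos]
    constructor <;> nlinarith
  set σ := (Finset.Icc a b).filter fun v => 0 < w t v with hσ
  have hσ_mem {v} (hv : v ∈ σ) : (∀ i, a i ≤ v i ∧ v i ≤ b i) ∧ ∀ i, |pos t i - v i| < 1 := by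
    rw [hσ, Finset.mem_filter, Finset.mem_Icc, hw_pos] at hv
    exact ⟨fun i => ⟨hv.1.1 i, hv.1.2 i⟩, hv.2⟩
  have hσ_ne : σ.Nonempty := by
    refine ⟨fun i => ⌊pos t i⌋, Finset.mem_filter.2 ⟨Finset.mem_Icc.2 ⟨fun i => ?_, fun i => ?_⟩,
      hw_pos.2 fun i => ?_⟩⟩
    · exact Int.le_floor.2 (hpos_mem i).1
    · exact_mod_cast (Int.floor_le _).trans (hpos_mem i).2
    · rw [Int.self_sub_floor, abs_of_nonneg (Int.fract_nonneg _)]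
      exact Int.fract_lt_one _
  have hw_sum : 0 < ∑ v ∈ σ, w t v :=
    Finset.sum_pos (fun v hv => (Finset.mem_filter.1 hv).2) hσ_ne
  have hsum : ∑ v ∈ σ, w t v • intToReal m (f v) = ∑ v ∈ σ, w t v • intToReal m (f (τ v)) := by
    rw [← sub_eq_zero, ← Finset.sum_sub_distrib, ← hGt, hG, hσ]
    simp only [← smul_sub]
    refine Finset.sum_filter_of_ne fun v _ hv => (hw_nonneg t v).lt_of_ne' ?_
    exact fun h => hv (by rw [h, zero_smul])
  refine ⟨σ, hσ_ne, fun v hv => ⟨(hσ_mem hv).1, k, ?_⟩, fun x hx y hy hxy => ⟨hxy, fun i => ?_,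
    (Finset.card_filter_le _ _).trans_eq (by simp)⟩,
    σ.centerMass (w t) fun v => intToReal m (f v), ?_, ?_⟩
  · have h := abs_lt.1 ((hσ_mem hv).2 k)
    have hv' := (hσ_mem hv).1 k
    rw [hpos] at h
    rcases eq_or_eq_neg_of_abs_eq hk with hk | hk <;> rw [hk] at h
    · right
      have : b k < v k + 1 := by
        rify
        linarith
      omega
    · left
      have : v k < a k + 1 := by
        rify
        linarith
      omega
  · have hx' := abs_lt.1 ((hσ_mem hx).2 i)
    have hy' := abs_lt.1 ((hσ_mem hy).2 i)
    have h : |x i - y i| < 2 := by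
      rify
      rw [abs_lt]
      constructor <;> linarith
    omega
  · exact Finset.centerMass_mem_convexHull _ (fun v _ => hw_nonneg t v) hw_sum
      fun v hv => ⟨f v, ⟨v, hv, rfl⟩, rfl⟩
  · rw [Finset.centerMass, hsum, ← Finset.centerMass]
    exact Finset.centerMass_mem_convexHull _ (fun v _ => hw_nonneg t v) hw_sum
      fun v hv => ⟨f (τ v), ⟨τ v, ⟨v, hv, rfl⟩, rfl⟩, rfl⟩
end

section
/- (Digital Borsuk–Ulam for (cₙ,c₁)-continuous maps.) Let n ≥ 1, let B ⊂ ℤⁿ be an n-box with boundary ∂B and canonical involution τ, and let f : ∂B → ℤ^{n−1} be (cₙ,c₁)-continuous. Then there is a point x ∈ ∂B such that f(x) = f(τ(x)) or f(x) is c₁-adjacent to f(τ(x)). -/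
namespace ListChain

variable {V : Type*}

/-- Formal sums modulo 2 of finite sequences in `V` (the empty sequence plays the role of the
augmentation). -/
abbrev Chain (V : Type*) := List V →₀ ZMod 2

/-- Prepending a vertex to every sequence of a chain. -/
noncomputable def cons (x : V) : Chain V →ₗ[ZMod 2] Chain V :=
  Finsupp.lmapDomain _ _ (List.cons x)

@[simp] lemma cons_single (x : V) (l : List V) (t : ZMod 2) :
    cons x (Finsupp.single l t) = Finsupp.single (x :: l) t := by
  simp [cons]

/-- The sum of all sequences obtained by deleting one entry. -/
noncomputable def faces : List V → Chain V
  | [] => 0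
  | x :: l => Finsupp.single l 1 + cons x (faces l)

/-- The simplicial boundary modulo 2. -/
noncomputable def bd : Chain V →ₗ[ZMod 2] Chain V := Finsupp.linearCombination _ faces

@[simp] lemma bd_single (l : List V) : bd (Finsupp.single l 1) = faces l := by
  simp [bd]

/-- Applying a vertex map to a chain. -/
noncomputable def push (f : V → V) : Chain V →ₗ[ZMod 2] Chain V :=
  Finsupp.lmapDomain _ _ (List.map f)

@[simp] lemma push_single (f : V → V) (l : List V) (t : ZMod 2) :
    push f (Finsupp.single l t) = Finsupp.single (l.map f) t := by
  simp [push]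

/-- The prism between the images of a sequence under two vertex maps. -/
noncomputable def prismFaces (f g : V → V) : List V → Chain V
  | [] => 0
  | x :: l => Finsupp.single (f x :: g x :: l.map g) 1 + cons (f x) (prismFaces f g l)

/-- The prism operator between two vertex maps. -/
noncomputable def prism (f g : V → V) : Chain V →ₗ[ZMod 2] Chain V :=
  Finsupp.linearCombination _ (prismFaces f g)

@[simp] lemma prism_single (f g : V → V) (l : List V) :
    prism f g (Finsupp.single l 1) = prismFaces f g l := by
  simp [prism]

lemma add_self_eq_zero (c : Chain V) : c + c = 0 := by
  ext l
  exact CharTwo.add_self_eq_zero _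

lemma hom_ext {M : Type*} [AddCommMonoid M] [Module (ZMod 2) M]
    {φ ψ : Chain V →ₗ[ZMod 2] M}
    (h : ∀ l, φ (Finsupp.single l 1) = ψ (Finsupp.single l 1)) : φ = ψ := by
  refine Finsupp.lhom_ext' fun l => LinearMap.ext_ring ?_
  simpa using h l

lemma bd_cons (x : V) (c : Chain V) : bd (cons x c) = c + cons x (bd c) := by
  have : bd ∘ₗ cons x = LinearMap.id + cons x ∘ₗ bd := hom_ext fun l => by simp [faces]
  exact LinearMap.congr_fun this c

lemma push_cons (f : V → V) (x : V) (c : Chain V) :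
    push f (cons x c) = cons (f x) (push f c) := by
  have : push f ∘ₗ cons x = cons (f x) ∘ₗ push f := hom_ext fun l => by simp
  exact LinearMap.congr_fun this c

lemma prism_cons (f g : V → V) (x : V) (c : Chain V) :
    prism f g (cons x c) = cons (f x) (cons (g x) (push g c)) + cons (f x) (prism f g c) := by
  have : prism f g ∘ₗ cons x =
      cons (f x) ∘ₗ cons (g x) ∘ₗ push g + cons (f x) ∘ₗ prism f g :=
    hom_ext fun l => by simp [prismFaces]
  exact LinearMap.congr_fun this c

lemma faces_map (f : V → V) (l : List V) : faces (l.map f) = push f (faces l) := by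
  induction l with
  | nil => simp [faces]
  | cons x l ih => simp [faces, ih, push_cons]

lemma bd_push (f : V → V) (c : Chain V) : bd (push f c) = push f (bd c) := by
  have : bd ∘ₗ push f = push f ∘ₗ bd := hom_ext fun l => by simp [faces_map]
  exact LinearMap.congr_fun this c

lemma push_push (f g : V → V) (c : Chain V) : push f (push g c) = push (f ∘ g) c := by
  have : push f ∘ₗ push g = push (f ∘ g) := hom_ext fun l => by simp
  exact LinearMap.congr_fun this c

lemma bd_prism (f g : V → V) (c : Chain V) :
    bd (prism f g c) + prism f g (bd c) = push f c + push g c := by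
  have : bd ∘ₗ prism f g + prism f g ∘ₗ bd = push f + push g := hom_ext fun l => by
    simp only [LinearMap.add_apply, LinearMap.comp_apply, prism_single, bd_single, push_single]
    induction l with
    | nil => simp [faces, prismFaces, add_self_eq_zero]
    | cons x l ih =>
      have e := congrArg (cons (f x)) ih
      simp only [map_add, cons_single] at e
      simp only [faces, prismFaces, map_add, bd_single, prism_single, bd_cons, prism_cons,
        List.map_cons, cons_single, faces_map]
      have h1 := add_self_eq_zero (prismFaces f g l)
      have h2 := add_self_eq_zero (cons (f x) (cons (g x) (push g (faces l))))
      have h3 := add_self_eq_zero (Finsupp.single (f x :: l.map g) (1 : ZMod 2))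
      linear_combination (norm := abel) e + h1 + h2 + h3
  exact LinearMap.congr_fun this c

/-- Chains of sequences of length `k` in `S` whose entries increase for the relation `r`. -/
noncomputable def monoChains (r : V → V → Prop) (S : Set V) (k : ℕ) :
    Submodule (ZMod 2) (Chain V) :=
  Finsupp.supported _ _ {l | l.length = k ∧ l.Pairwise r ∧ ∀ x ∈ l, x ∈ S}

lemma single_mem {r : V → V → Prop} {S : Set V} {k : ℕ} {l : List V} (hk : l.length = k)
    (hr : l.Pairwise r) (hS : ∀ x ∈ l, x ∈ S) : Finsupp.single l 1 ∈ monoChains r S k :=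
  Finsupp.single_mem_supported _ _ ⟨hk, hr, hS⟩

lemma map_mem {r : V → V → Prop} {S : Set V} {k : ℕ} {M : Type*} [AddCommGroup M]
    [Module (ZMod 2) M] (φ : Chain V →ₗ[ZMod 2] M) (N : Submodule (ZMod 2) M)
    (h : ∀ l : List V, l.length = k → l.Pairwise r → (∀ x ∈ l, x ∈ S) →
      φ (Finsupp.single l 1) ∈ N) {c : Chain V} (hc : c ∈ monoChains r S k) : φ c ∈ N := by
  rw [monoChains, Finsupp.supported_eq_span_single] at hc
  induction hc using Submodule.span_induction with
  | mem x hx =>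
    obtain ⟨l, ⟨h1, h2, h3⟩, rfl⟩ := hx
    exact h l h1 h2 h3
  | zero => simp
  | add x y _ _ hx hy => simpa using N.add_mem hx hy
  | smul t x _ hx => simpa using N.smul_mem t hx

lemma hom_eq_of_mem {r : V → V → Prop} {S : Set V} {k : ℕ} {M : Type*} [AddCommGroup M]
    [Module (ZMod 2) M] {φ ψ : Chain V →ₗ[ZMod 2] M}
    (h : ∀ l : List V, l.length = k → l.Pairwise r → (∀ x ∈ l, x ∈ S) →
      φ (Finsupp.single l 1) = ψ (Finsupp.single l 1)) {c : Chain V}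
    (hc : c ∈ monoChains r S k) : φ c = ψ c := by
  have := map_mem (φ - ψ) ⊥ (fun l h1 h2 h3 => by simp [h l h1 h2 h3]) hc
  simpa [sub_eq_zero] using this

lemma push_mem {r : V → V → Prop} {S S' : Set V} {k : ℕ} {f : V → V}
    (hf : ∀ x y, r x y → r (f x) (f y)) (hS : ∀ x ∈ S, f x ∈ S') {c : Chain V}
    (hc : c ∈ monoChains r S k) : push f c ∈ monoChains r S' k := by
  refine map_mem _ _ (fun l h1 h2 h3 => ?_) hc
  rw [push_single]
  refine single_mem (by simpa using h1) (h2.map f hf) ?_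
  simp only [List.mem_map]
  rintro _ ⟨x, hx, rfl⟩
  exact hS x (h3 x hx)

lemma cons_mem {r : V → V → Prop} {S : Set V} {k : ℕ} {x : V} (hx : x ∈ S) {c : Chain V}
    (hc : c ∈ monoChains r (S ∩ {y | r x y}) k) : cons x c ∈ monoChains r S (k + 1) := by
  refine map_mem _ _ (fun l h1 h2 h3 => ?_) hc
  rw [cons_single]
  refine single_mem (by simpa using h1) (List.pairwise_cons.2 ⟨fun y hy => (h3 y hy).2, h2⟩) ?_
  intro y hy
  rcases List.mem_cons.1 hy with rfl | hy
  · exact hx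
  · exact (h3 y hy).1

lemma prism_mem {r : V → V → Prop} (hr : ∀ x y z, r x y → r y z → r x z)
    {S S' : Set V} {k : ℕ} {f g : V → V}
    (hf : ∀ x y, r x y → r (f x) (f y)) (hg : ∀ x y, r x y → r (g x) (g y))
    (hfg : ∀ x, r (f x) (g x)) (hS : ∀ x ∈ S, f x ∈ S' ∧ g x ∈ S') {c : Chain V}
    (hc : c ∈ monoChains r S k) : prism f g c ∈ monoChains r S' (k + 1) := by
  refine map_mem _ _ (fun l h1 h2 h3 => ?_) hc
  clear hc
  rw [prism_single]
  induction l generalizing k S S' with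
  | nil => simp [prismFaces]
  | cons x l ih =>
    obtain ⟨hx, h2⟩ := List.pairwise_cons.1 h2
    rw [List.length_cons] at h1
    subst h1
    have hxS := hS x (h3 x (by simp))
    refine Submodule.add_mem _ (single_mem (by simp) ?_ ?_) (cons_mem hxS.1 ?_)
    · refine List.pairwise_cons.2 ⟨?_, List.pairwise_cons.2 ⟨?_, h2.map g hg⟩⟩
      · intro y hy
        rcases List.mem_cons.1 hy with rfl | hy
        · exact hfg x
        · obtain ⟨z, hz, rfl⟩ := List.mem_map.1 hy
          exact hr _ _ _ (hfg x) (hg _ _ (hx z hz))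
      · intro y hy
        obtain ⟨z, hz, rfl⟩ := List.mem_map.1 hy
        exact hg _ _ (hx z hz)
    · intro y hy
      rcases List.mem_cons.1 hy with rfl | hy
      · exact hxS.1
      rcases List.mem_cons.1 hy with rfl | hy
      · exact hxS.2
      obtain ⟨z, hz, rfl⟩ := List.mem_map.1 hy
      exact (hS z (h3 z (by simp [hz]))).2
    · refine ih (S := {y ∈ S | r x y}) (fun y hy => ?_) rfl h2
        (fun y hy => ⟨h3 y (by simp [hy]), hx y hy⟩)
      exact ⟨⟨(hS y hy.1).1, hf _ _ hy.2⟩, (hS y hy.1).2, hr _ _ _ (hfg x) (hg _ _ hy.2)⟩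

end ListChain

namespace DoubledBox

open ListChain

variable {m : ℕ}

/-- The specialization order of the Khalimsky topology on `ℤⁿ`: points of the doubled lattice
are cells of the cubical lattice, and `Incident x y` says that `x` is a face of `y`. -/
def Incident (x y : Fin (m + 1) → ℤ) : Prop :=
  ∀ i, x i = y i ∨ (y i % 2 = 1 ∧ (x i = y i + 1 ∨ x i = y i - 1))

/-- The central reflection of the doubled box. -/
def reflect (a b z : Fin (m + 1) → ℤ) : Fin (m + 1) → ℤ := fun i => 2 * a i + 2 * b i - z i

/-- Raising all coordinates of `z` to at least those of `T`. -/
def clamp (T z : Fin (m + 1) → ℤ) : Fin (m + 1) → ℤ := fun i => max (z i) (T i)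

/-- The boundary of the section of the doubled box on which the coordinates beyond the `k`-th are
central. -/
def sphere (a b : Fin (m + 1) → ℤ) (k : ℕ) : Set (Fin (m + 1) → ℤ) :=
  {z | (∀ i, 2 * a i ≤ z i ∧ z i ≤ 2 * b i) ∧ (∀ i : Fin (m + 1), k < i → z i = a i + b i) ∧
    ∃ i : Fin (m + 1), (i : ℕ) ≤ k ∧ (z i = 2 * a i ∨ z i = 2 * b i)}

lemma Incident.trans (x y z : Fin (m + 1) → ℤ) (h₁ : Incident x y) (h₂ : Incident y z) :
    Incident x z := by
  intro i
  have := h₁ i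
  have := h₂ i
  omega

lemma reflect_incident (a b x y : Fin (m + 1) → ℤ) (h : Incident x y) :
    Incident (reflect a b x) (reflect a b y) := by
  intro i
  have := h i
  simp only [reflect]
  omega

lemma reflect_mem {a b : Fin (m + 1) → ℤ} {k : ℕ} (z : Fin (m + 1) → ℤ)
    (hz : z ∈ sphere a b k) : reflect a b z ∈ sphere a b k := by
  obtain ⟨h1, h2, i, hi, h3⟩ := hz
  refine ⟨fun j => ?_, fun j hj => ?_, i, hi, ?_⟩
  · have := h1 j
    simp only [reflect]
    omega
  · have := h2 j hj
    simp only [reflect]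
    omega
  · simp only [reflect]
    omega

lemma reflect_reflect (a b : Fin (m + 1) → ℤ) : reflect a b ∘ reflect a b = id := by
  ext z i
  simp [reflect]

lemma clamp_incident (T x y : Fin (m + 1) → ℤ) (h : Incident x y) :
    Incident (clamp T x) (clamp T y) := by
  intro i
  have := h i
  simp only [clamp]
  omega

lemma clamp_update_incident (T : Fin (m + 1) → ℤ) (i : Fin (m + 1)) (t : ℤ) :
    (∀ z, Incident (clamp (Function.update T i t) z) (clamp (Function.update T i (t + 1)) z)) ∨
    (∀ z, Incident (clamp (Function.update T i (t + 1)) z) (clamp (Function.update T i t) z)) := by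
  rcases Int.emod_two_eq_zero_or_one t with ht | ht
  · left
    intro z j
    by_cases hj : j = i
    · subst hj
      simp only [clamp, Function.update_self]
      omega
    · simp [clamp, Function.update_of_ne hj]
  · right
    intro z j
    by_cases hj : j = i
    · subst hj
      simp only [clamp, Function.update_self]
      omega
    · simp [clamp, Function.update_of_ne hj]

/-- The thresholds that are used to contract `sphere a b k` inside `sphere a b (k + 1)`. -/
def Admissible (a b : Fin (m + 1) → ℤ) (k : ℕ) (T : Fin (m + 1) → ℤ) : Prop :=
  (∀ i, 2 * a i ≤ T i ∧ T i ≤ 2 * b i) ∧ (∀ i : Fin (m + 1), k + 1 < i → T i = 2 * a i) ∧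
    ((∃ i : Fin (m + 1), (i : ℕ) = k + 1 ∧ T i = 2 * b i) ∨
      ∀ i : Fin (m + 1), (i : ℕ) ≠ k + 1 → T i = 2 * a i)

lemma clamp_mem {a b : Fin (m + 1) → ℤ} {k : ℕ} {T : Fin (m + 1) → ℤ}
    (hT : Admissible a b k T) (hab : ∀ i, a i < b i) (z : Fin (m + 1) → ℤ)
    (hz : z ∈ sphere a b k) : clamp T z ∈ sphere a b (k + 1) := by
  obtain ⟨h1, h2, i, hi, h3⟩ := hz
  obtain ⟨t1, t2, t3⟩ := hT
  refine ⟨fun j => ?_, fun j hj => ?_, ?_⟩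
  · have := h1 j
    have := t1 j
    simp only [clamp]
    omega
  · have := h2 j (by omega)
    have := t2 j hj
    have := hab j
    simp only [clamp]
    omega
  · rcases t3 with ⟨j, hj, t3⟩ | t3
    · refine ⟨j, hj.le, Or.inr ?_⟩
      have := h1 j
      simp only [clamp]
      omega
    · refine ⟨i, by omega, ?_⟩
      have := t3 i (by omega)
      have := h1 i
      simp only [clamp]
      omega

/-- Two chains differ by the boundary of a chain in `sphere a b (k + 1)`. -/
def Homologous (a b : Fin (m + 1) → ℤ) (k : ℕ) (c c' : Chain (Fin (m + 1) → ℤ)) : Prop :=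
  ∃ e ∈ monoChains Incident (sphere a b (k + 1)) (k + 2), bd e = c + c'

lemma Homologous.refl (a b : Fin (m + 1) → ℤ) (k : ℕ) (c : Chain (Fin (m + 1) → ℤ)) :
    Homologous a b k c c :=
  ⟨0, Submodule.zero_mem _, by simp [ListChain.add_self_eq_zero]⟩

lemma Homologous.trans {a b : Fin (m + 1) → ℤ} {k : ℕ} {c c' c'' : Chain (Fin (m + 1) → ℤ)}
    (h : Homologous a b k c c') (h' : Homologous a b k c' c'') : Homologous a b k c c'' := by
  obtain ⟨e, he, h⟩ := h
  obtain ⟨e', he', h'⟩ := h'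
  refine ⟨e + e', Submodule.add_mem _ he he', ?_⟩
  have := ListChain.add_self_eq_zero c'
  rw [map_add, h, h']
  linear_combination (norm := abel) this

lemma homologous_of_incident {a b : Fin (m + 1) → ℤ} {k : ℕ} {T T' : Fin (m + 1) → ℤ}
    (hab : ∀ i, a i < b i) (hT : Admissible a b k T) (hT' : Admissible a b k T')
    (h : ∀ z, Incident (clamp T z) (clamp T' z)) {c : Chain (Fin (m + 1) → ℤ)}
    (hc : c ∈ monoChains Incident (sphere a b k) (k + 1)) (hbd : bd c = 0) :
    Homologous a b k (push (clamp T) c) (push (clamp T') c) := by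
  refine ⟨prism (clamp T) (clamp T') c, prism_mem Incident.trans (clamp_incident T)
    (clamp_incident T') h (fun z hz => ⟨clamp_mem hT hab z hz, clamp_mem hT' hab z hz⟩) hc, ?_⟩
  have := bd_prism (clamp T) (clamp T') c
  rwa [hbd, map_zero, add_zero] at this

lemma homologous_update {a b : Fin (m + 1) → ℤ} {k : ℕ} {T : Fin (m + 1) → ℤ}
    (hab : ∀ i, a i < b i) (i : Fin (m + 1))
    (hT : ∀ t, 2 * a i ≤ t → t ≤ 2 * b i → Admissible a b k (Function.update T i t))
    {c : Chain (Fin (m + 1) → ℤ)}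
    (hc : c ∈ monoChains Incident (sphere a b k) (k + 1)) (hbd : bd c = 0) :
    Homologous a b k (push (clamp (Function.update T i (2 * a i))) c)
      (push (clamp (Function.update T i (2 * b i))) c) := by
  have key : ∀ t, 2 * a i ≤ t → t ≤ 2 * b i →
      Homologous a b k (push (clamp (Function.update T i (2 * a i))) c)
        (push (clamp (Function.update T i t)) c) := by
    intro t ht
    induction t, ht using Int.leInduction with
    | base => exact fun _ => Homologous.refl _ _ _ _
    | succ t ht ih =>
      intro ht'
      refine (ih (by omega)).trans ?_
      have h1 := hT t ht (by omega)
      have h2 := hT (t + 1) (by omega) ht'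
      rcases clamp_update_incident T i t with h | h
      · exact homologous_of_incident hab h1 h2 h hc hbd
      · obtain ⟨e, he, h⟩ := homologous_of_incident hab h2 h1 h hc hbd
        exact ⟨e, he, h.trans (add_comm _ _)⟩
  exact key _ (by have := hab i; omega) le_rfl

/-- The threshold that is maximal on `s` and minimal elsewhere. -/
def threshold (a b : Fin (m + 1) → ℤ) (s : Finset (Fin (m + 1))) : Fin (m + 1) → ℤ :=
  fun i => if i ∈ s then 2 * b i else 2 * a i

lemma homologous_threshold_insert {a b : Fin (m + 1) → ℤ} {k : ℕ} (hab : ∀ i, a i < b i)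
    (s : Finset (Fin (m + 1))) (i : Fin (m + 1)) (hi : i ∉ s) (hik : (i : ℕ) ≤ k + 1)
    (hs : ∀ j ∈ s, (j : ℕ) ≤ k + 1)
    (h : (∃ j ∈ s, (j : ℕ) = k + 1) ∨ (s = ∅ ∧ (i : ℕ) = k + 1))
    {c : Chain (Fin (m + 1) → ℤ)}
    (hc : c ∈ monoChains Incident (sphere a b k) (k + 1)) (hbd : bd c = 0) :
    Homologous a b k (push (clamp (threshold a b s)) c)
      (push (clamp (threshold a b (insert i s))) c) := by
  have e1 : threshold a b s = Function.update (threshold a b s) i (2 * a i) := by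
    rw [eq_comm, Function.update_eq_self_iff]
    simp [threshold, hi]
  have e2 : threshold a b (insert i s) = Function.update (threshold a b s) i (2 * b i) := by
    ext j
    by_cases hj : j = i
    · subst hj
      simp [threshold]
    · simp [threshold, hj]
  rw [e2]
  nth_rewrite 1 [e1]
  refine homologous_update hab i (fun t ht ht' => ⟨fun j => ?_, fun j hj => ?_, ?_⟩) hc hbd
  · have := hab j
    by_cases hj : j = i
    · subst hj
      simp only [Function.update_self]
      omega
    · simp only [Function.update_of_ne hj, threshold]
      split_ifs <;> omega
  · have : j ≠ i := by rintro rfl; omega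
    have hjs : j ∉ s := fun h => by have := hs j h; omega
    simp [Function.update_of_ne this, threshold, hjs]
  · rcases h with ⟨j, hj, hjk⟩ | ⟨rfl, hik'⟩
    · have : j ≠ i := by rintro rfl; exact hi hj
      exact Or.inl ⟨j, hjk, by simp [Function.update_of_ne this, threshold, hj]⟩
    · refine Or.inr fun j hj => ?_
      have : j ≠ i := by rintro rfl; omega
      simp [Function.update_of_ne this, threshold]

lemma homologous_threshold {a b : Fin (m + 1) → ℤ} {k : ℕ} (hab : ∀ i, a i < b i)
    (i₀ : Fin (m + 1)) (hi₀ : (i₀ : ℕ) = k + 1)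
    (s : Finset (Fin (m + 1))) (hs : ∀ j ∈ s, (j : ℕ) ≤ k + 1) {c : Chain (Fin (m + 1) → ℤ)}
    (hc : c ∈ monoChains Incident (sphere a b k) (k + 1)) (hbd : bd c = 0) :
    Homologous a b k (push (clamp (threshold a b ∅)) c)
      (push (clamp (threshold a b (insert i₀ s))) c) := by
  induction s using Finset.induction_on with
  | empty =>
    exact homologous_threshold_insert hab ∅ i₀ (by simp) hi₀.le (by simp)
      (Or.inr ⟨rfl, hi₀⟩) hc hbd
  | insert i s hi ih =>
    have ih := ih fun j hj => hs j (by simp [hj])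
    by_cases h : i = i₀
    · subst h
      simpa using ih
    · rw [Finset.insert_comm]
      refine ih.trans (homologous_threshold_insert hab _ i (by simp [h, hi]) (hs i (by simp))
        ?_ (Or.inl ⟨i₀, by simp, hi₀⟩) hc hbd)
      intro j hj
      rcases Finset.mem_insert.1 hj with rfl | hj
      · exact hi₀.le
      · exact hs j (by simp [hj])

lemma push_eq_of_eqOn {S : Set (Fin (m + 1) → ℤ)} {k : ℕ}
    {f g : (Fin (m + 1) → ℤ) → (Fin (m + 1) → ℤ)} (h : ∀ z ∈ S, f z = g z)
    {c : Chain (Fin (m + 1) → ℤ)} (hc : c ∈ monoChains Incident S k) : push f c = push g c := by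
  refine hom_eq_of_mem (fun l _ _ hl => ?_) hc
  rw [push_single, push_single, List.map_congr_left fun z hz => h z (hl z hz)]

lemma exists_filling {a b : Fin (m + 1) → ℤ} {k : ℕ} (hab : ∀ i, a i < b i) (hk : k < m)
    {c : Chain (Fin (m + 1) → ℤ)} (hc : c ∈ monoChains Incident (sphere a b k) (k + 1))
    (hbd : bd (c + push (reflect a b) c) = 0) :
    ∃ e ∈ monoChains Incident (sphere a b (k + 1)) (k + 2),
      bd e = c + push (reflect a b) c := by
  have hc' := push_mem (reflect_incident a b) reflect_mem hc
  set s : Finset (Fin (m + 1)) := Finset.univ.filter fun j => (j : ℕ) ≤ k + 1 with hs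
  let i₀ : Fin (m + 1) := ⟨k + 1, by omega⟩
  have hi₀ : insert i₀ s = s := Finset.insert_eq_self.2 (by simp [hs, i₀])
  obtain ⟨e, he, h⟩ := homologous_threshold hab i₀ rfl s (by simp [hs])
    (Submodule.add_mem _ hc hc') hbd
  refine ⟨e, he, ?_⟩
  rw [hi₀, push_eq_of_eqOn (g := id) _ (Submodule.add_mem _ hc hc')] at h
  · have h2 : push (clamp (threshold a b s) ∘ reflect a b) c = push (clamp (threshold a b s)) c := by
      refine push_eq_of_eqOn (fun z hz => ?_) hc
      have hz' := reflect_mem z hz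
      ext j
      have h1 := hz.1 j
      have h2 := hz'.1 j
      by_cases hj : (j : ℕ) ≤ k + 1
      · simp only [Function.comp, clamp, threshold, hs, Finset.mem_filter, Finset.mem_univ,
          true_and, hj, if_true]
        omega
      · have h3 := hz.2.1 j (by omega)
        have h4 := hz'.2.1 j (by omega)
        simp only [Function.comp, clamp, h3, h4]
    have h3 : ∀ c : Chain (Fin (m + 1) → ℤ), push id c = c := fun c => by simp [push]
    rw [h3, map_add (push (clamp _)), push_push, h2, ListChain.add_self_eq_zero, add_zero] at h
    exact h
  · intro z hz
    ext j
    have := hz.1 j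
    simp only [clamp, threshold, Finset.notMem_empty, if_false, id]
    omega

/-- The value of a cochain on a chain. -/
noncomputable def eval (α : List (Fin (m + 1) → ℤ) → ZMod 2) :
    Chain (Fin (m + 1) → ℤ) →ₗ[ZMod 2] ZMod 2 :=
  Finsupp.linearCombination _ α

@[simp] lemma eval_single (α : List (Fin (m + 1) → ℤ) → ZMod 2) (l : List (Fin (m + 1) → ℤ)) :
    eval α (Finsupp.single l 1) = α l := by
  simp [eval]

lemma sphere_subset (a b : Fin (m + 1) → ℤ) {k k' : ℕ} (h : k ≤ k') :
    sphere a b k ⊆ sphere a b k' := by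
  rintro z ⟨h1, h2, i, hi, h3⟩
  exact ⟨h1, fun j hj => h2 j (by omega), i, by omega, h3⟩

lemma exists_chain {a b : Fin (m + 1) → ℤ} (hab : ∀ i, a i < b i)
    (α : List (Fin (m + 1) → ℤ) → ZMod 2)
    (h0 : ∀ z ∈ sphere a b m, α [z] + α [reflect a b z] = 1) (K : ℕ) (hK : K ≤ m)
    (hα : ∀ l : List (Fin (m + 1) → ℤ), 2 ≤ l.length → l.length ≤ K + 1 →
      l.Pairwise Incident → (∀ z ∈ l, z ∈ sphere a b m) →
      eval α (faces l) = α l + α (l.map (reflect a b))) :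
    ∃ c ∈ monoChains Incident (sphere a b K) (K + 1),
      bd (c + push (reflect a b) c) = 0 ∧ eval α (c + push (reflect a b) c) = 1 := by
  induction K with
  | zero =>
    let z₀ : Fin (m + 1) → ℤ := fun i => if i = 0 then 2 * b i else a i + b i
    have hz₀ : z₀ ∈ sphere a b 0 := by
      refine ⟨fun i => ?_, fun i hi => ?_, 0, by simp, Or.inr (by simp [z₀])⟩
      · have := hab i
        simp only [z₀]
        split_ifs <;> omega
      · have : i ≠ 0 := by rintro rfl; simp at hi
        simp [z₀, this]
    refine ⟨Finsupp.single [z₀] 1, single_mem rfl (by simp) (by simpa using hz₀), ?_, ?_⟩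
    · simp [faces, ListChain.add_self_eq_zero]
    · simpa using h0 z₀ (sphere_subset a b (by omega) hz₀)
  | succ k ih =>
    obtain ⟨c, hc, hbd, h1⟩ := ih (by omega) fun l h1 h2 => hα l h1 (by omega)
    obtain ⟨e, he, hbe⟩ := exists_filling hab (by omega) hc hbd
    have h3 : ∀ c : Chain (Fin (m + 1) → ℤ), push id c = c := fun c => by simp [push]
    refine ⟨e, he, ?_, ?_⟩
    · rw [map_add, bd_push, hbe, map_add, push_push, reflect_reflect, h3, add_comm (push _ c),
        ListChain.add_self_eq_zero]
    · rw [← h1, ← hbe]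
      have : (eval α ∘ₗ (LinearMap.id + push (reflect a b))) e = (eval α ∘ₗ bd) e := by
        refine hom_eq_of_mem (fun l hl hr hS => ?_) he
        simp only [LinearMap.comp_apply, LinearMap.add_apply, LinearMap.id_apply, push_single,
          map_add, eval_single, bd_single]
        exact (hα l (by omega) (by omega) hr fun z hz => sphere_subset a b hK (hS z hz)).symm
      simpa using this

/-- There is no equivariant cochain detecting the antipodal class that vanishes in degree `K`. -/
lemma not_vanishing {a b : Fin (m + 1) → ℤ} (hab : ∀ i, a i < b i)
    (α : List (Fin (m + 1) → ℤ) → ZMod 2)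
    (h0 : ∀ z ∈ sphere a b m, α [z] + α [reflect a b z] = 1) (K : ℕ) (hK : K ≤ m)
    (hα : ∀ l : List (Fin (m + 1) → ℤ), 2 ≤ l.length → l.length ≤ K + 1 →
      l.Pairwise Incident → (∀ z ∈ l, z ∈ sphere a b m) →
      eval α (faces l) = α l + α (l.map (reflect a b)))
    (hz : ∀ l : List (Fin (m + 1) → ℤ), l.length = K + 1 → l.Pairwise Incident →
      (∀ z ∈ l, z ∈ sphere a b m) → α l = 0) : False := by
  obtain ⟨c, hc, -, h1⟩ := exists_chain hab α h0 K hK hα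
  have hc' := push_mem (reflect_incident a b) reflect_mem hc
  have := hom_eq_of_mem (φ := eval α) (ψ := 0) (fun l hl hr hS => by
    simpa using hz l hl hr fun z hz => sphere_subset a b hK (hS z hz))
    (Submodule.add_mem _ hc hc')
  rw [h1] at this
  simp at this

end DoubledBox

namespace DoubledBox

open ListChain

variable {m : ℕ}

/-- The lattice points in the closed cell encoded by a point of the doubled lattice. -/
def corners (z : Fin (m + 1) → ℤ) : Set (Fin (m + 1) → ℤ) :=
  {x | ∀ i, 2 * x i ≤ z i + 1 ∧ z i ≤ 2 * x i + 1}

lemma corners_nonempty (z : Fin (m + 1) → ℤ) : (corners z).Nonempty :=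
  ⟨fun i => z i / 2, fun i => by dsimp only; omega⟩

lemma corners_mono {y z : Fin (m + 1) → ℤ} (h : Incident y z) : corners y ⊆ corners z := by
  intro x hx i
  have := hx i
  have := h i
  omega

lemma reflect_corners (a b : Fin (m + 1) → ℤ) {x z : Fin (m + 1) → ℤ} (hx : x ∈ corners z) :
    (fun i => a i + b i - x i) ∈ corners (reflect a b z) := by
  intro i
  have := hx i
  simp only [reflect]
  omega

lemma reflect_reflect_apply (a b z : Fin (m + 1) → ℤ) : reflect a b (reflect a b z) = z :=
  congrFun (reflect_reflect a b) z

/-- The cochains built from a two-valued function by taking cup products with its coboundary. -/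
def cupPower (s : (Fin (m + 1) → ℤ) → ZMod 2) : List (Fin (m + 1) → ℤ) → ZMod 2
  | [x] => s x
  | [x, y] => s x * (s x + s y)
  | [x, y, z] => s x * (s x + s y) * (s y + s z)
  | [x, y, z, w] => s x * (s x + s y) * (s y + s z) * (s z + s w)
  | _ => 0

/-- An antisymmetric sign on the cells changes along every step of some chain of four cells. -/
lemma exists_alternating {a b : Fin (m + 1) → ℤ} (hab : ∀ i, a i < b i) (hm : 3 ≤ m)
    (s : (Fin (m + 1) → ℤ) → ZMod 2)
    (hs : ∀ z ∈ sphere a b m, s z + s (reflect a b z) = 1) :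
    ∃ x ∈ sphere a b m, ∃ y ∈ sphere a b m, ∃ z ∈ sphere a b m, ∃ w ∈ sphere a b m,
      Incident x y ∧ Incident y z ∧ Incident z w ∧ s x ≠ s y ∧ s y ≠ s z ∧ s z ≠ s w := by
  by_contra hcon
  have hs' : ∀ z ∈ sphere a b m, s (reflect a b z) = s z + 1 := by
    intro z hz
    have := hs z hz
    generalize s z = u at *
    generalize s (reflect a b z) = v at *
    revert u v
    decide
  refine not_vanishing hab (cupPower s) hs 3 hm ?_ ?_
  · intro l h1 h2 _ hl
    match l with
    | [] | [_] => simp at h1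
    | [x, y] =>
      simp only [List.mem_cons, forall_eq_or_imp] at hl
      simp only [faces, cupPower, map_add, map_zero, cons_single, eval_single, List.map, hs' x hl.1,
        hs' y hl.2.1]
      generalize s x = u
      generalize s y = v
      revert u v
      decide
    | [x, y, z] =>
      simp only [List.mem_cons, forall_eq_or_imp] at hl
      simp only [faces, cupPower, map_add, map_zero, cons_single, eval_single, List.map, hs' x hl.1,
        hs' y hl.2.1, hs' z hl.2.2.1]
      generalize s x = u
      generalize s y = v
      generalize s z = w
      revert u v w
      decide
    | [x, y, z, t] =>
      simp only [List.mem_cons, forall_eq_or_imp] at hl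
      simp only [faces, cupPower, map_add, map_zero, cons_single, eval_single, List.map, hs' x hl.1,
        hs' y hl.2.1, hs' z hl.2.2.1, hs' t hl.2.2.2.1]
      generalize s x = u
      generalize s y = v
      generalize s z = w
      generalize s t = t
      revert u v w t
      decide
    | _ :: _ :: _ :: _ :: _ :: _ =>
      simp only [List.length_cons] at h2
      omega
  · intro l h1 hr hl
    match l with
    | [] | [_] | [_, _] | [_, _, _] => simp at h1
    | [x, y, z, t] =>
      simp only [List.mem_cons, forall_eq_or_imp] at hl
      simp only [List.pairwise_cons, List.mem_cons, forall_eq_or_imp] at hr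
      have := fun h1 h2 h3 => hcon ⟨x, hl.1, y, hl.2.1, z, hl.2.2.1, t, hl.2.2.2.1, hr.1.1,
        hr.2.1.1, hr.2.2.1.1, h1, h2, h3⟩
      simp only [cupPower]
      generalize s x = u at *
      generalize s y = v at *
      generalize s z = w at *
      generalize s t = t at *
      clear * - this
      revert u v w t
      decide
    | _ :: _ :: _ :: _ :: _ :: _ =>
      simp only [List.length_cons] at h1
      omega

/-- Ky Fan's cochains for labels in the square with vertices `0, 1, 2, 3`, where `u` and `u + 2`
are opposite. -/
def squareCochain (L : (Fin (m + 1) → ℤ) → ZMod 4) : List (Fin (m + 1) → ℤ) → ZMod 2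
  | [x] => if L x = 0 ∨ L x = 1 then 1 else 0
  | [x, y] => if (L x = 0 ∧ L y = 3) ∨ (L x = 3 ∧ L y = 0) then 1 else 0
  | _ => 0

/-- Tucker's lemma with labels in a square. -/
lemma exists_opposite {a b : Fin (m + 1) → ℤ} (hab : ∀ i, a i < b i)
    (L : (Fin (m + 1) → ℤ) → ZMod 4)
    (hL : ∀ z ∈ sphere a b m, L (reflect a b z) = L z + 2)
    (hm : 2 ≤ m ∨ (1 ≤ m ∧ ∀ z ∈ sphere a b m, L z = 0 ∨ L z = 2)) :
    ∃ x ∈ sphere a b m, ∃ y ∈ sphere a b m, Incident x y ∧ L y = L x + 2 := by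
  by_contra! hcon
  have h0 : ∀ z ∈ sphere a b m,
      squareCochain L [z] + squareCochain L [reflect a b z] = 1 := by
    intro z hz
    simp only [squareCochain, hL z hz]
    generalize L z = u
    revert u
    decide
  have h : ∀ l : List (Fin (m + 1) → ℤ), 2 ≤ l.length → l.length ≤ 2 + 1 →
      l.Pairwise Incident → (∀ z ∈ l, z ∈ sphere a b m) →
      eval (squareCochain L) (faces l) =
        squareCochain L l + squareCochain L (l.map (reflect a b)) := by
    intro l h1 h2 hr hl
    match l with
    | [] | [_] => simp at h1
    | [x, y] =>
      simp only [List.mem_cons, forall_eq_or_imp] at hl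
      simp only [List.pairwise_cons, List.mem_cons, forall_eq_or_imp] at hr
      have := hcon x hl.1 y hl.2.1 hr.1.1
      simp only [faces, squareCochain, map_add, map_zero, cons_single, eval_single, List.map,
        hL x hl.1, hL y hl.2.1]
      generalize L x = u at *
      generalize L y = v at *
      clear * - this
      revert u v
      decide
    | [x, y, z] =>
      simp only [List.mem_cons, forall_eq_or_imp] at hl
      simp only [List.pairwise_cons, List.mem_cons, forall_eq_or_imp] at hr
      have e1 := hcon x hl.1 y hl.2.1 hr.1.1
      have e2 := hcon x hl.1 z hl.2.2.1 hr.1.2.1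
      have e3 := hcon y hl.2.1 z hl.2.2.1 hr.2.1.1
      simp only [faces, squareCochain, map_add, map_zero, cons_single, eval_single, List.map]
      generalize L x = u at *
      generalize L y = v at *
      generalize L z = w at *
      clear * - e1 e2 e3
      revert u v w
      decide
    | _ :: _ :: _ :: _ :: _ =>
      simp only [List.length_cons] at h2
      omega
  rcases hm with hm | ⟨hm, h02⟩
  · refine not_vanishing hab _ h0 2 hm h fun l h1 _ _ => ?_
    match l with
    | [] | [_] | [_, _] => simp at h1
    | _ :: _ :: _ :: _ => rfl
  · refine not_vanishing hab _ h0 1 hm (fun l h1 h2 => h l h1 (by omega)) fun l h1 _ hl => ?_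
    match l with
    | [] | [_] => simp at h1
    | [x, y] =>
      simp only [List.mem_cons, forall_eq_or_imp] at hl
      have e1 := h02 x hl.1
      have e2 := h02 y hl.2.1
      simp only [squareCochain]
      generalize L x = u at *
      generalize L y = v at *
      clear * - e1 e2
      revert u v
      decide
    | _ :: _ :: _ :: _ => simp at h1

/-- The vector `(u, v)` has `ℓ¹`-norm at most one. -/
def Small (u v : ℤ) : Prop := u + v ≤ 1 ∧ u - v ≤ 1 ∧ v - u ≤ 1 ∧ -u - v ≤ 1

lemma planar_exists {z : Fin (m + 1) → ℤ} {f₀ f₁ : (Fin (m + 1) → ℤ) → ℤ}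
    (hf : ∀ x ∈ corners z, ∀ y ∈ corners z, Small (f₀ x - f₀ y) (f₁ x - f₁ y)) :
    ∃ x ∈ corners z, ∃ y ∈ corners z, ∀ t ∈ corners z,
      (f₀ t = f₀ x ∧ f₁ t = f₁ x) ∨ (f₀ t = f₀ y ∧ f₁ t = f₁ y) := by
  obtain ⟨x, hx⟩ := corners_nonempty z
  by_cases h : ∃ y ∈ corners z, ¬(f₀ y = f₀ x ∧ f₁ y = f₁ x)
  · obtain ⟨y, hy, h⟩ := h
    refine ⟨x, hx, y, hy, fun t ht => ?_⟩
    have h1 := hf x hx y hy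
    have h2 := hf x hx t ht
    have h3 := hf y hy t ht
    simp only [Small] at h1 h2 h3
    omega
  · push Not at h
    exact ⟨x, hx, x, hx, fun t ht => Or.inl (h t ht)⟩

lemma planar_borsuk_ulam {a b : Fin (m + 1) → ℤ} (hab : ∀ i, a i < b i)
    (f₀ f₁ : (Fin (m + 1) → ℤ) → ℤ)
    (hf : ∀ z ∈ sphere a b m, ∀ x ∈ corners z, ∀ y ∈ corners z,
      Small (f₀ x - f₀ y) (f₁ x - f₁ y))
    (hm : 2 ≤ m ∨ (1 ≤ m ∧ ∀ x, f₁ x = 0)) :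
    ∃ z ∈ sphere a b m, ∃ x ∈ corners z,
      Small (f₀ x - f₀ fun i => a i + b i - x i) (f₁ x - f₁ fun i => a i + b i - x i) := by
  by_contra! hcon
  choose! p hp q hq hpq using fun z hz => planar_exists (hf z hz)
  let g (f : (Fin (m + 1) → ℤ) → ℤ) (z : Fin (m + 1) → ℤ) : ℤ :=
    f (p z) + f (q z) - f (p (reflect a b z)) - f (q (reflect a b z))
  have hg : ∀ f z, g f z =
    f (p z) + f (q z) - f (p (reflect a b z)) - f (q (reflect a b z)) := fun _ _ => rfl
  have hgr : ∀ f z, g f (reflect a b z) = -g f z := by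
    intro f z
    simp only [hg, reflect_reflect_apply]
    ring
  have hne : ∀ z ∈ sphere a b m, ¬(g f₀ z = 0 ∧ g f₁ z = 0) := by
    intro z hz
    have hz' := reflect_mem z hz
    have h1 := hf z hz _ (hp z hz) _ (hq z hz)
    have h2 := hf _ hz' _ (hp _ hz') _ (hq _ hz')
    have h3 := hcon z hz _ (hp z hz)
    have h4 := hpq _ hz' _ (reflect_corners a b (hp z hz))
    have h5 := hcon z hz _ (hq z hz)
    have h6 := hpq _ hz' _ (reflect_corners a b (hq z hz))
    simp only [Small, hg] at *
    omega
  have hcomp : ∀ x ∈ sphere a b m, ∀ y ∈ sphere a b m, Incident x y →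
      ¬(0 < g f₀ x ∧ g f₀ y < 0) ∧ ¬(g f₀ x < 0 ∧ 0 < g f₀ y) ∧
      ¬(0 < g f₁ x ∧ g f₁ y < 0) ∧ ¬(g f₁ x < 0 ∧ 0 < g f₁ y) := by
    intro x hx y hy hxy
    have hx' := reflect_mem x hx
    have hy' := reflect_mem y hy
    have hxy' := reflect_incident a b x y hxy
    have h1 := hpq y hy _ (corners_mono hxy (hp x hx))
    have h2 := hpq y hy _ (corners_mono hxy (hq x hx))
    have h3 := hpq _ hy' _ (corners_mono hxy' (hp _ hx'))
    have h4 := hpq _ hy' _ (corners_mono hxy' (hq _ hx'))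
    have h5 := hf y hy _ (hp y hy) _ (hq y hy)
    have h6 := hf _ hy' _ (hp _ hy') _ (hq _ hy')
    simp only [Small, hg] at *
    clear hcon hpq hf hne
    rcases h1 with h1 | h1 <;> rcases h2 with h2 | h2 <;> rcases h3 with h3 | h3 <;>
      rcases h4 with h4 | h4 <;> refine ⟨?_, ?_, ?_, ?_⟩ <;> omega
  let L : (Fin (m + 1) → ℤ) → ZMod 4 := fun z =>
    if 0 < g f₀ z then 0 else if g f₀ z < 0 then 2 else if 0 < g f₁ z then 1 else 3
  obtain ⟨x, hx, y, hy, hxy, h⟩ := exists_opposite hab L (fun z hz => by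
      have := hne z hz
      simp only [L, hgr]
      split_ifs <;> first | decide | omega) (by
      refine hm.imp_right fun h => ⟨h.1, fun z hz => ?_⟩
      have := hne z hz
      have h0 : g f₁ z = 0 := by simp [hg, h.2]
      simp only [L]
      split_ifs <;> first | decide | omega)
  have h1 := hcomp x hx y hy hxy
  have h2 := hne x hx
  have h3 := hne y hy
  simp only [L] at h
  split_ifs at h <;> first | omega | exact absurd h (by decide)

end DoubledBox

lemma CAdj.exists_eq_off {m : ℕ} {p q : Fin m → ℤ} (h : CAdj m 1 p q) :
    ∃ i, p i ≠ q i ∧ |p i - q i| ≤ 1 ∧ ∀ j, j ≠ i → p j = q j := by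
  obtain ⟨h1, h2, h3⟩ := h
  obtain ⟨i, hi⟩ := Function.ne_iff.1 h1
  refine ⟨i, hi, h2 i, fun j hj => ?_⟩
  by_contra hne
  exact hj (Finset.card_le_one.1 h3 j (by simpa using hne) i (by simpa using hi))

lemma CAdj.no_triangle {m : ℕ} {p q r : Fin m → ℤ} (hpq : CAdj m 1 p q) (hpr : CAdj m 1 p r)
    (hqr : CAdj m 1 q r) : False := by
  obtain ⟨i, hi, hi1, hi'⟩ := hpq.exists_eq_off
  obtain ⟨j, hj, hj1, hj'⟩ := hpr.exists_eq_off
  obtain ⟨k, hk, hk1, hk'⟩ := hqr.exists_eq_off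
  rw [abs_le] at hi1 hj1 hk1
  by_cases hij : i = j
  · subst hij
    by_cases hik : i = k
    · subst hik
      omega
    · exact hk ((hi' k (Ne.symm hik)).symm.trans (hj' k (Ne.symm hik)))
  · have h1 : q i ≠ r i := by rw [← hj' i hij]; exact hi.symm
    have h2 : q j ≠ r j := by rw [← hi' j (Ne.symm hij)]; exact hj
    have h3 : i = k := by by_contra h; exact h1 (hk' i h)
    have h4 : j = k := by by_contra h; exact h2 (hk' j h)
    exact hij (h3.trans h4.symm)

namespace DoubledBox

open ListChain

variable {m : ℕ}

lemma image_corners {z : Fin (m + 1) → ℤ} {f : (Fin (m + 1) → ℤ) → (Fin m → ℤ)}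
    (hf : ∀ x ∈ corners z, ∀ y ∈ corners z, f x = f y ∨ CAdj m 1 (f x) (f y)) :
    ∃ p q, f '' corners z = {p, q} ∧ (p = q ∨ CAdj m 1 p q) := by
  obtain ⟨x, hx⟩ := corners_nonempty z
  by_cases h : ∃ y ∈ corners z, f x ≠ f y
  · obtain ⟨y, hy, h⟩ := h
    refine ⟨f x, f y, Set.Subset.antisymm ?_ ?_, hf x hx y hy⟩
    · rintro _ ⟨t, ht, rfl⟩
      by_contra hcon
      simp only [Set.mem_insert_iff, Set.mem_singleton_iff, not_or] at hcon
      exact ((hf x hx y hy).resolve_left h).no_triangle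
        ((hf x hx t ht).resolve_left (Ne.symm hcon.1))
        ((hf y hy t ht).resolve_left (Ne.symm hcon.2))
    · rintro _ (rfl | rfl)
      exacts [⟨x, hx, rfl⟩, ⟨y, hy, rfl⟩]
  · push Not at h
    refine ⟨f x, f x, Set.Subset.antisymm ?_ ?_, Or.inl rfl⟩
    · rintro _ ⟨t, ht, rfl⟩
      simp [h t ht]
    · rintro _ (rfl | rfl) <;> exact ⟨x, hx, rfl⟩

lemma borsuk_ulam_of_three_le {a b : Fin (m + 1) → ℤ} (hab : ∀ i, a i < b i) (hm : 3 ≤ m)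
    (f : (Fin (m + 1) → ℤ) → (Fin m → ℤ))
    (hf : ∀ z ∈ sphere a b m, ∀ x ∈ corners z, ∀ y ∈ corners z,
      f x = f y ∨ CAdj m 1 (f x) (f y)) :
    ∃ z ∈ sphere a b m, ∃ x ∈ corners z,
      f x = f (fun i => a i + b i - x i) ∨ CAdj m 1 (f x) (f fun i => a i + b i - x i) := by
  classical
  by_contra! hcon
  let F (z : Fin (m + 1) → ℤ) : Set (Fin m → ℤ) := f '' corners z
  have hF : ∀ z ∈ sphere a b m, F z ≠ F (reflect a b z) := by
    intro z hz h
    obtain ⟨x, hx⟩ := corners_nonempty z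
    obtain ⟨y, hy, hxy⟩ : f (fun i => a i + b i - x i) ∈ F z :=
      h ▸ ⟨_, reflect_corners a b hx, rfl⟩
    have h1 := hf z hz x hx y hy
    rw [hxy] at h1
    exact h1.elim (hcon z hz x hx).1 (hcon z hz x hx).2
  have hcard : ∀ z ∈ sphere a b m, (F z).Finite ∧ 1 ≤ (F z).ncard ∧ (F z).ncard ≤ 2 := by
    intro z hz
    obtain ⟨p, q, h, -⟩ := image_corners (hf z hz)
    have hfin : (F z).Finite := by
      simp only [F, h]
      exact Set.toFinite _
    refine ⟨hfin, ?_, ?_⟩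
    · exact (Set.ncard_pos hfin).2 ((corners_nonempty z).image f)
    · simp only [F, h]
      exact (Set.ncard_insert_le _ _).trans (by simp)
  let s (z : Fin (m + 1) → ℤ) : ZMod 2 :=
    if WellOrderingRel (F z) (F (reflect a b z)) then 1 else 0
  have hstep : ∀ x ∈ sphere a b m, ∀ y ∈ sphere a b m, Incident x y → s x ≠ s y →
      (F x).ncard + (F (reflect a b x)).ncard < (F y).ncard + (F (reflect a b y)).ncard := by
    intro x hx y hy hxy hs
    have h1 : F x ⊆ F y := Set.image_mono (corners_mono hxy)
    have h2 : F (reflect a b x) ⊆ F (reflect a b y) :=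
      Set.image_mono (corners_mono (reflect_incident a b x y hxy))
    have f1 := (hcard y hy).1
    have f2 := (hcard _ (reflect_mem y hy)).1
    by_contra hlt
    have n1 := Set.ncard_le_ncard h1 f1
    have n2 := Set.ncard_le_ncard h2 f2
    have e1 := Set.eq_of_subset_of_ncard_le h1 (by omega) f1
    have e2 := Set.eq_of_subset_of_ncard_le h2 (by omega) f2
    exact hs (by simp only [s, e1, e2])
  obtain ⟨x, hx, y, hy, z, hz, w, hw, hxy, hyz, hzw, h1, h2, h3⟩ :=
    exists_alternating hab hm s fun z hz => by
      simp only [s, reflect_reflect_apply]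
      rcases trichotomous_of WellOrderingRel (F z) (F (reflect a b z)) with h | h | h
      · simp [h, asymm_of WellOrderingRel h]
      · exact absurd h (hF z hz)
      · simp [h, asymm_of WellOrderingRel h]
  have := hstep x hx y hy hxy h1
  have := hstep y hy z hz hyz h2
  have := hstep z hz w hw hzw h3
  have := (hcard x hx).2
  have := (hcard _ (reflect_mem x hx)).2
  have := (hcard w hw).2
  have := (hcard _ (reflect_mem w hw)).2
  omega

lemma borsuk_ulam {a b : Fin (m + 1) → ℤ} (hab : ∀ i, a i < b i) (hm : 1 ≤ m)
    (f : (Fin (m + 1) → ℤ) → (Fin m → ℤ))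
    (hf : ∀ z ∈ sphere a b m, ∀ x ∈ corners z, ∀ y ∈ corners z,
      f x = f y ∨ CAdj m 1 (f x) (f y)) :
    ∃ z ∈ sphere a b m, ∃ x ∈ corners z,
      f x = f (fun i => a i + b i - x i) ∨ CAdj m 1 (f x) (f fun i => a i + b i - x i) := by
  match m, hm with
  | 1, _ =>
    obtain ⟨z, hz, x, hx, h⟩ := planar_borsuk_ulam hab (fun x => f x 0) (fun _ => 0)
      (fun z hz x hx y hy => by
        rcases hf z hz x hx y hy with h | h
        · simp [h, Small]
        · have := abs_le.1 (h.2.1 0)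
          simp only [Small]
          omega) (Or.inr ⟨le_rfl, fun _ => rfl⟩)
    refine ⟨z, hz, x, hx, or_iff_not_imp_left.2 fun hne => ⟨hne, fun i => ?_, ?_⟩⟩
    · rw [Subsingleton.elim i 0, abs_le]
      simp only [Small] at h
      omega
    · exact (Finset.card_filter_le _ _).trans (by simp)
  | 2, _ =>
    obtain ⟨z, hz, x, hx, h⟩ := planar_borsuk_ulam hab (fun x => f x 0) (fun x => f x 1)
      (fun z hz x hx y hy => by
        rcases hf z hz x hx y hy with h | h
        · simp [h, Small]
        · obtain ⟨i, -, h1, h2⟩ := h.exists_eq_off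
          rw [abs_le] at h1
          simp only [Small]
          fin_cases i
          · have := h2 1 (by decide)
            simp only [Fin.zero_eta] at h1
            omega
          · have := h2 0 (by decide)
            simp only [Fin.mk_one] at h1
            omega) (Or.inl le_rfl)
    refine ⟨z, hz, x, hx, or_iff_not_imp_left.2 fun hne => ⟨hne, fun i => ?_, ?_⟩⟩
    · rw [abs_le]
      simp only [Small] at h
      fin_cases i
      · simp only [Fin.zero_eta]
        omega
      · simp only [Fin.mk_one]
        omega
    · rw [Finset.card_le_one]
      intro i hi j hj
      simp only [Finset.mem_filter, Finset.mem_univ, true_and] at hi hj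
      simp only [Small] at h
      fin_cases i <;> fin_cases j <;>
        simp only [Fin.zero_eta, Fin.mk_one] at hi hj ⊢ <;> omega
  | m + 3, _ => exact borsuk_ulam_of_three_le hab (by omega) f hf

end DoubledBox

/-- Digital Borsuk–Ulam for `(cₙ,c₁)`-continuous maps: if `B ⊂ ℤⁿ` is an
`n`-box (`n = m + 1 ≥ 1`) with boundary `∂B` and canonical involution `τ`, and
`f : ∂B → ℤ^{n-1}` is `(cₙ,c₁)`-continuous, then there is `x ∈ ∂B` with
`f x = f (τ x)` or `f x` `c₁`-adjacent to `f (τ x)`. -/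
theorem digital_borsuk_ulam_cn_c1 (m : ℕ) (a b : Fin (m + 1) → ℤ)
    (hab : ∀ i, a i < b i)
    (B : Set (Fin (m + 1) → ℤ))
    (hB : B = {x | ∀ i, a i ≤ x i ∧ x i ≤ b i})
    (bdry : Set (Fin (m + 1) → ℤ))
    (hbdry : bdry = {x ∈ B | ∃ i, x i = a i ∨ x i = b i})
    (τ : (Fin (m + 1) → ℤ) → (Fin (m + 1) → ℤ))
    (hτ : τ = fun x i => a i + b i - x i)
    (f : (Fin (m + 1) → ℤ) → (Fin m → ℤ))
    (hf : ∀ x ∈ bdry, ∀ y ∈ bdry, CAdj (m + 1) (m + 1) x y →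
      f x = f y ∨ CAdj m 1 (f x) (f y)) :
    ∃ x ∈ bdry, f x = f (τ x) ∨ CAdj m 1 (f x) (f (τ x)) := by
  subst hB hbdry hτ
  have hcorner : ∀ z ∈ DoubledBox.sphere a b m, ∀ x ∈ DoubledBox.corners z,
      (∀ i, a i ≤ x i ∧ x i ≤ b i) ∧ ∃ i, x i = a i ∨ x i = b i := by
    rintro z ⟨h1, -, i, -, h3⟩ x hx
    refine ⟨fun j => ?_, i, ?_⟩
    · have := h1 j
      have := hx j
      omega
    · have := hx i
      omega
  rcases Nat.eq_zero_or_pos m with rfl | hm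
  · exact ⟨a, ⟨fun i => ⟨le_rfl, (hab i).le⟩, 0, Or.inl rfl⟩, Or.inl (Subsingleton.elim _ _)⟩
  · obtain ⟨z, hz, x, hx, h⟩ := DoubledBox.borsuk_ulam hab hm f fun z hz x hx y hy => by
      by_cases hxy : x = y
      · exact Or.inl (congrArg f hxy)
      · refine hf x (hcorner z hz x hx) y (hcorner z hz y hy) ⟨hxy, fun i => ?_, ?_⟩
        · have := hx i
          have := hy i
          rw [abs_le]
          omega
        · exact (Finset.card_filter_le _ _).trans (by simp)
    exact ⟨x, hcorner z hz x hx, h⟩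
end

section
/- (Digital Borsuk–Ulam for (cₙ,c₁^m)-continuous maps.) Let n ≥ 1 and m ≥ 1, let B ⊂ ℤⁿ be an n-box with boundary ∂B and canonical involution τ, and let f : ∂B → ℤ^{n−1} be (cₙ,c₁^m)-continuous, i.e. x ↔_{cₙ} y implies the ℓ¹-distance between f(x) and f(y) is at most m. Then there is a point x ∈ ∂B such that the ℓ¹-distance between f(x) and f(τ(x)) is at most 2m. -/
/-- The adjacency `cₙ` on `ℤⁿ`: two points are adjacent iff they are distinct
and every coordinate differs by at most 1. -/
def CnAdj (n : ℕ) (x y : Fin n → ℤ) : Prop :=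
  x ≠ y ∧ ∀ i, |x i - y i| ≤ 1

/-- The ℓ¹-distance on `ℤⁿ`. -/
def l1Dist (n : ℕ) (u v : Fin n → ℤ) : ℤ :=
  ∑ i, |u i - v i|

section ListCochains

variable {E : Type*}

/-- The mod 2 coboundary of a cochain on ordered simplices (lists of vertices), augmented by the
empty simplex. -/
def coboundary : (List E → ZMod 2) → List E → ZMod 2
  | _, [] => 0
  | φ, v :: σ => φ σ + coboundary (fun ρ => φ (v :: ρ)) σ

/-- The dual of the prism operator between two vertex maps. -/
def prism (s t : E → E) : (List E → ZMod 2) → List E → ZMod 2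
  | _, [] => 0
  | φ, v :: σ => φ (s v :: t v :: σ.map t) + prism s t (fun ρ => φ (s v :: ρ)) σ

theorem coboundary_zero (σ : List E) : coboundary (fun _ => 0) σ = 0 := by
  induction σ with
  | nil => rfl
  | cons v σ ih => simp [coboundary, ih]

theorem coboundary_add (φ ψ : List E → ZMod 2) (σ : List E) :
    coboundary (fun ρ => φ ρ + ψ ρ) σ = coboundary φ σ + coboundary ψ σ := by
  induction σ generalizing φ ψ with
  | nil => simp [coboundary]
  | cons v σ ih => simp only [coboundary, ih]; ring

theorem coboundary_coboundary (φ : List E → ZMod 2) (σ : List E) :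
    coboundary (coboundary φ) σ = 0 := by
  induction σ generalizing φ with
  | nil => rfl
  | cons v σ ih =>
    simp only [coboundary, coboundary_add, ih, add_zero, CharTwo.add_self_eq_zero]

theorem coboundary_map (g : E → E) (φ : List E → ZMod 2) (σ : List E) :
    coboundary φ (σ.map g) = coboundary (fun ρ => φ (ρ.map g)) σ := by
  induction σ generalizing φ with
  | nil => rfl
  | cons v σ ih => simp only [List.map_cons, coboundary, ih]

theorem coboundary_congr {φ ψ : List E → ZMod 2} {σ : List E}
    (h : ∀ ρ, ρ ⊆ σ → φ ρ = ψ ρ) : coboundary φ σ = coboundary ψ σ := by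
  induction σ generalizing φ ψ with
  | nil => rfl
  | cons v σ ih =>
    rw [coboundary, coboundary, h σ (List.subset_cons_self v σ),
      ih fun ρ hρ => h _ (List.cons_subset_cons v hρ)]

theorem prism_coboundary (s t : E → E) (φ : List E → ZMod 2) (σ : List E) :
    prism s t (coboundary φ) σ =
      coboundary (prism s t φ) σ + (φ (σ.map t) + φ (σ.map s)) := by
  have prism_add : ∀ (σ : List E) (φ ψ : List E → ZMod 2),
      prism s t (fun ρ => φ ρ + ψ ρ) σ = prism s t φ σ + prism s t ψ σ := by
    intro σ
    induction σ with
    | nil => intro φ ψ; simp [prism]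
    | cons v σ ih => intro φ ψ; simp only [prism, ih]; ring
  induction σ generalizing φ with
  | nil => simp [prism, coboundary, CharTwo.add_self_eq_zero]
  | cons v σ ih =>
    simp only [prism, coboundary, prism_add, coboundary_add, ih, coboundary_map, List.map_cons]
    linear_combination CharTwo.add_self_eq_zero (φ (s v :: σ.map t))

theorem exists_of_prism_ne_zero {s t : E → E} {φ : List E → ZMod 2} {σ : List E}
    (h : prism s t φ σ ≠ 0) :
    ∃ ρ, ρ ≠ [] ∧ (∀ x ∈ ρ, ∃ v ∈ σ, x = s v ∨ x = t v) ∧ φ ρ ≠ 0 := by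
  induction σ generalizing φ with
  | nil => exact absurd rfl h
  | cons v σ ih =>
    by_cases h0 : φ (s v :: t v :: σ.map t) = 0
    · rw [prism, h0, zero_add] at h
      obtain ⟨ρ, -, hρ, hφ⟩ := ih h
      refine ⟨s v :: ρ, by simp, ?_, hφ⟩
      intro x hx
      rcases List.mem_cons.1 hx with rfl | hx
      · exact ⟨v, by simp, Or.inl rfl⟩
      · obtain ⟨w, hw, hxw⟩ := hρ x hx
        exact ⟨w, List.mem_cons_of_mem _ hw, hxw⟩
    · refine ⟨_, by simp, ?_, h0⟩
      intro x hx
      simp only [List.mem_cons, List.mem_map] at hx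
      rcases hx with rfl | rfl | ⟨w, hw, rfl⟩
      · exact ⟨v, by simp, Or.inl rfl⟩
      · exact ⟨v, by simp, Or.inr rfl⟩
      · exact ⟨w, List.mem_cons_of_mem _ hw, Or.inr rfl⟩

/-- Evaluation of cochains on the `d`-th hemisphere: the hemisphere of dimension `d + 1` is
obtained by contracting the `d`-sphere, made of the `d`-th hemisphere and its image under `ν`,
to a point through the `N` steps `s d 0, …, s d N`. -/
def hemisphere (ν : E → E) (s : ℕ → ℕ → E → E) (N : ℕ) (p : E) :
    ℕ → (List E → ZMod 2) → ZMod 2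
  | 0, φ => φ [p]
  | d + 1, φ => ∑ j ∈ Finset.range N,
      (hemisphere ν s N p d (prism (s d j) (s d (j + 1)) φ) +
        hemisphere ν s N p d fun σ => prism (s d j) (s d (j + 1)) φ (σ.map ν))

theorem hemisphere_add (ν : E → E) (s : ℕ → ℕ → E → E) (N : ℕ) (p : E) (d : ℕ)
    (φ ψ : List E → ZMod 2) :
    hemisphere ν s N p d (fun ρ => φ ρ + ψ ρ) =
      hemisphere ν s N p d φ + hemisphere ν s N p d ψ := by
  have prism_add : ∀ (s t : E → E) (φ ψ : List E → ZMod 2),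
      prism s t (fun ρ => φ ρ + ψ ρ) = fun σ => prism s t φ σ + prism s t ψ σ := by
    intro s t φ ψ
    funext σ
    induction σ generalizing φ ψ with
    | nil => simp [prism]
    | cons v σ ih => simp only [prism, ih]; ring
  induction d generalizing φ ψ with
  | zero => rfl
  | succ d ih =>
    simp only [hemisphere, ← Finset.sum_add_distrib]
    refine Finset.sum_congr rfl fun j _ => ?_
    rw [prism_add, ih, ih (fun σ => prism _ _ φ (σ.map ν))]
    ring

/-- If the `d`-sphere is closed, then it is the boundary of the `(d + 1)`-st hemisphere. -/
theorem hemisphere_succ_coboundary_of_closed {ν : E → E} {s : ℕ → ℕ → E → E} {N : ℕ}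
    (hs0 : ∀ d x, s d 0 x = x) (hsN : ∀ d x y, s d N x = s d N y) {p : E} {d : ℕ}
    (hd : ∀ φ : List E → ZMod 2, hemisphere ν s N p d (coboundary φ) +
      hemisphere ν s N p d (fun σ => coboundary φ (σ.map ν)) = 0) (φ : List E → ZMod 2) :
    hemisphere ν s N p (d + 1) (coboundary φ) =
      hemisphere ν s N p d φ + hemisphere ν s N p d fun σ => φ (σ.map ν) := by
  set x : ℕ → ZMod 2 := fun j => hemisphere ν s N p d (fun σ => φ (σ.map (s d j))) +
    hemisphere ν s N p d (fun σ => φ ((σ.map ν).map (s d j))) with hx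
  have hstep : ∀ j, hemisphere ν s N p d (prism (s d j) (s d (j + 1)) (coboundary φ)) +
      hemisphere ν s N p d (fun σ => prism (s d j) (s d (j + 1)) (coboundary φ) (σ.map ν)) =
        x (j + 1) - x j := by
    intro j
    rw [funext (prism_coboundary (s d j) (s d (j + 1)) φ)]
    simp only [hemisphere_add, hx, CharTwo.sub_eq_add]
    linear_combination hd (prism (s d j) (s d (j + 1)) φ)
  have hx0 : x 0 = hemisphere ν s N p d φ + hemisphere ν s N p d fun σ => φ (σ.map ν) := by
    have h : s d 0 = id := funext (hs0 d)
    simp only [hx, h, List.map_id]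
  have hxN : x N = 0 := by
    have h : s d N ∘ ν = s d N := funext fun y => hsN d _ _
    simp only [hx, List.map_map, h, CharTwo.add_self_eq_zero]
  rw [hemisphere, Finset.sum_congr rfl fun j _ => hstep j, Finset.sum_range_sub, hxN, hx0,
    CharTwo.sub_eq_add, zero_add]

theorem hemisphere_sphere_closed {ν : E → E} (hν : Function.Involutive ν)
    {s : ℕ → ℕ → E → E} {N : ℕ} (hs0 : ∀ d x, s d 0 x = x)
    (hsN : ∀ d x y, s d N x = s d N y) (p : E) (d : ℕ) (φ : List E → ZMod 2) :
    hemisphere ν s N p d (coboundary φ) +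
      hemisphere ν s N p d (fun σ => coboundary φ (σ.map ν)) = 0 := by
  simp only [coboundary_map]
  induction d generalizing φ with
  | zero => simp [hemisphere, coboundary, CharTwo.add_self_eq_zero]
  | succ d ih =>
    have hd := hemisphere_succ_coboundary_of_closed hs0 hsN (ν := ν) (p := p) (d := d)
      (by simpa only [coboundary_map] using ih)
    rw [hd, hd]
    simp only [List.map_map, hν.comp_self, List.map_id]
    rw [add_comm (hemisphere ν s N p d φ), CharTwo.add_self_eq_zero]

/-- The antipodal cochains built from vertex cochains `a 0, a 1, …`. -/
def antipodalCochain (a : ℕ → E → ZMod 2) : ℕ → List E → ZMod 2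
  | 0, [] => 1
  | 0, _ :: _ => 0
  | _ + 1, [] => 0
  | d + 1, v :: σ => a d v * coboundary (antipodalCochain a d) (v :: σ)

theorem antipodalCochain_succ_map {ν : E → E} {a : ℕ → E → ZMod 2}
    (ha : ∀ d x, a d (ν x) = a d x + 1) (d : ℕ) (σ : List E) :
    antipodalCochain a (d + 1) (σ.map ν) =
      antipodalCochain a (d + 1) σ + coboundary (antipodalCochain a d) σ := by
  have key : ∀ d σ, coboundary (antipodalCochain a d) (σ.map ν) =
      coboundary (antipodalCochain a d) σ → antipodalCochain a (d + 1) (σ.map ν) =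
      antipodalCochain a (d + 1) σ + coboundary (antipodalCochain a d) σ := by
    rintro d (_ | ⟨v, σ⟩) h
    · simp [antipodalCochain, coboundary]
    · rw [List.map_cons, antipodalCochain, antipodalCochain, ← List.map_cons, h, ha]
      ring
  refine key d σ ?_
  induction d generalizing σ with
  | zero =>
    rw [coboundary_map]
    refine coboundary_congr fun ρ _ => ?_
    cases ρ <;> rfl
  | succ d ih =>
    rw [coboundary_map, funext fun ρ => key d ρ (ih ρ), coboundary_add, coboundary_coboundary,
      add_zero]

theorem hemisphere_antipodalCochain {ν : E → E} (hν : Function.Involutive ν)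
    {s : ℕ → ℕ → E → E} {N : ℕ} (hs0 : ∀ d x, s d 0 x = x)
    (hsN : ∀ d x y, s d N x = s d N y) (p : E) {a : ℕ → E → ZMod 2}
    (ha : ∀ d x, a d (ν x) = a d x + 1) (d : ℕ) :
    hemisphere ν s N p d (coboundary (antipodalCochain a d)) = 1 := by
  induction d with
  | zero => simp [hemisphere, coboundary, antipodalCochain]
  | succ d ih =>
    rw [hemisphere_succ_coboundary_of_closed hs0 hsN (hemisphere_sphere_closed hν hs0 hsN p d),
      funext (antipodalCochain_succ_map ha d), hemisphere_add, ih, ← add_assoc,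
      CharTwo.add_self_eq_zero, zero_add]

theorem exists_ne_of_coboundary_antipodalCochain_ne_zero {a : ℕ → E → ZMod 2} {d : ℕ}
    {σ : List E} (h : coboundary (antipodalCochain a d) σ ≠ 0) {i : ℕ} (hi : i < d) :
    ∃ v ∈ σ, ∃ w ∈ σ, a i v = 0 ∧ a i w = 1 := by
  induction d generalizing σ with
  | zero => omega
  | succ d ih =>
    rcases Nat.lt_succ_iff_lt_or_eq.1 hi with hi | rfl
    · obtain ⟨ρ, hρ, hne⟩ : ∃ ρ, ρ ⊆ σ ∧ antipodalCochain a (d + 1) ρ ≠ 0 := by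
        by_contra! hall
        exact h ((coboundary_congr hall).trans (coboundary_zero σ))
      cases ρ with
      | nil => exact absurd rfl hne
      | cons v ρ =>
        obtain ⟨x, hx, y, hy, hxy⟩ := ih (right_ne_zero_of_mul hne) hi
        exact ⟨x, hρ hx, y, hρ hy, hxy⟩
    · by_contra! hall
      have h01 : ∀ z : ZMod 2, z ≠ 0 → z = 1 := by decide
      by_cases h0 : ∃ v ∈ σ, a i v = 0
      · obtain ⟨v, hv, hv0⟩ := h0
        refine h ((coboundary_congr fun ρ hρ => ?_).trans (coboundary_zero σ))
        cases ρ with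
        | nil => rfl
        | cons w ρ =>
          have hw : a i w = 0 := by
            by_contra hw
            exact hall v hv w (hρ (by simp)) hv0 (h01 _ hw)
          rw [antipodalCochain, hw, zero_mul]
      · push Not at h0
        refine h ((coboundary_congr fun ρ hρ => ?_).trans
          (coboundary_coboundary (antipodalCochain a i) σ))
        cases ρ with
        | nil => rfl
        | cons w ρ => rw [antipodalCochain, h01 _ (h0 w (hρ (by simp))), one_mul]

/-- A property of simplices passing to images under `ν` and to prisms, indexed by dimension, holds
for some simplex on which a cochain with nonzero evaluation on the hemisphere does not vanish. -/
theorem exists_of_hemisphere_ne_zero {ν : E → E} {s : ℕ → ℕ → E → E} {N : ℕ} {p : E} {k : ℕ}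
    (good : ℕ → List E → Prop) (hp : good 0 [p])
    (hgν : ∀ d σ, good d σ → good d (σ.map ν))
    (hgs : ∀ d < k, ∀ j < N, ∀ σ ρ, good d σ → ρ ≠ [] →
      (∀ x ∈ ρ, ∃ v ∈ σ, x = s d j v ∨ x = s d (j + 1) v) → good (d + 1) ρ)
    {φ : List E → ZMod 2} (h : hemisphere ν s N p k φ ≠ 0) : ∃ σ, good k σ ∧ φ σ ≠ 0 := by
  suffices H : ∀ d ≤ k, ∀ φ, hemisphere ν s N p d φ ≠ 0 → ∃ σ, good d σ ∧ φ σ ≠ 0 from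
    H k le_rfl φ h
  intro d
  induction d with
  | zero => exact fun _ φ h => ⟨[p], hp, h⟩
  | succ d ih =>
    intro hd φ h
    obtain ⟨j, hj, hne⟩ := Finset.exists_ne_zero_of_sum_ne_zero h
    obtain ⟨σ, hσ, hφ⟩ : ∃ σ, good d σ ∧ prism (s d j) (s d (j + 1)) φ σ ≠ 0 := by
      by_cases h0 : hemisphere ν s N p d (prism (s d j) (s d (j + 1)) φ) = 0
      · rw [h0, zero_add] at hne
        obtain ⟨σ, hσ, hφ⟩ := ih (by omega) _ hne
        exact ⟨σ.map ν, hgν d σ hσ, hφ⟩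
      · exact ih (by omega) _ h0
    obtain ⟨ρ, hρ, hmem, hne⟩ := exists_of_prism_ne_zero hφ
    exact ⟨ρ, hgs d (by omega) j (Finset.mem_range.1 hj) σ ρ hσ hρ hmem, hne⟩

end ListCochains

/-- Fine antipodal triangulations of the cross-polytope: any antipodal family of `k` binary labels
admits a simplex of arbitrarily small diameter on which each of the labels takes both values. The
points carry an additional sign, which makes the antipodal map free. -/
theorem exists_small_simplex (k N : ℕ) (hN : 0 < N) (a : ℕ → (Fin (k + 1) → ℝ) × Bool → ZMod 2)
    (ha : ∀ i x, a i (-x.1, !x.2) = a i x + 1) :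
    ∃ σ : List ((Fin (k + 1) → ℝ) × Bool), σ ≠ [] ∧ (∀ v ∈ σ, ∑ i, |v.1 i| = 1) ∧
      (∀ v ∈ σ, ∀ w ∈ σ, dist v.1 w.1 ≤ 2 * k / N) ∧
      ∀ i < k, ∃ v ∈ σ, ∃ w ∈ σ, a i v = 0 ∧ a i w = 1 := by
  have hN' : (0 : ℝ) < N := by exact_mod_cast hN
  let e : ℕ → Fin (k + 1) → ℝ := fun d i => if i.val = d then 1 else 0
  have he : ∀ d ≤ k, ∑ i, e d i = 1 := by
    intro d hd
    rw [Finset.sum_eq_single (⟨d, by omega⟩ : Fin (k + 1))]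
    · simp [e]
    · intro i _ hi
      exact if_neg fun h => hi (Fin.ext h)
    · simp
  have he0 : ∀ d i, 0 ≤ e d i := fun d i => by simp only [e]; split_ifs <;> norm_num
  have he1 : ∀ d i, e d i ≤ 1 := fun d i => by simp only [e]; split_ifs <;> norm_num
  let s : ℕ → ℕ → (Fin (k + 1) → ℝ) × Bool → (Fin (k + 1) → ℝ) × Bool := fun d j x =>
    (fun i => (1 - j / N) * x.1 i + j / N * e (d + 1) i, if j = 0 then x.2 else true)
  let ν : (Fin (k + 1) → ℝ) × Bool → (Fin (k + 1) → ℝ) × Bool := fun x => (-x.1, !x.2)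
  have hν : Function.Involutive ν := fun x => by simp [ν]
  have hs0 : ∀ d x, s d 0 x = x := fun d x => by simp [s]
  have hsN : ∀ d x y, s d N x = s d N y := fun d x y => by simp [s, hN.ne', hN'.ne']
  let good : ℕ → List ((Fin (k + 1) → ℝ) × Bool) → Prop := fun d σ =>
    σ ≠ [] ∧ (∀ v ∈ σ, ∑ i, |v.1 i| = 1 ∧ ∀ i : Fin (k + 1), d < i.val → v.1 i = 0) ∧
      ∀ v ∈ σ, ∀ w ∈ σ, dist v.1 w.1 ≤ 2 * d / N
  have hp : good 0 [(e 0, true)] := by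
    refine ⟨by simp, ?_, by simp⟩
    intro v hv
    obtain rfl := List.mem_singleton.1 hv
    exact ⟨by simp only [abs_of_nonneg (he0 _ _), he 0 k.zero_le],
      fun i hi => if_neg (Nat.ne_of_gt hi)⟩
  have hgν : ∀ d σ, good d σ → good d (σ.map ν) := by
    rintro d σ ⟨h0, h1, h2⟩
    refine ⟨by simpa using h0, ?_, ?_⟩
    · intro v hv
      obtain ⟨w, hw, rfl⟩ := List.mem_map.1 hv
      simpa [ν] using h1 w hw
    · intro v hv v' hv'
      obtain ⟨w, hw, rfl⟩ := List.mem_map.1 hv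
      obtain ⟨w', hw', rfl⟩ := List.mem_map.1 hv'
      simpa [ν] using h2 w hw w' hw'
  have hgs : ∀ d < k, ∀ j < N, ∀ σ ρ, good d σ → ρ ≠ [] →
      (∀ x ∈ ρ, ∃ v ∈ σ, x = s d j v ∨ x = s d (j + 1) v) → good (d + 1) ρ := by
    rintro d hd j hj σ ρ ⟨-, h1, h2⟩ hρ hmem
    have hstep : ∀ x ∈ ρ, ∃ v ∈ σ, ∃ l : ℕ, j ≤ l ∧ l ≤ j + 1 ∧ x = s d l v := by
      intro x hx
      obtain ⟨v, hv, h | h⟩ := hmem x hx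
      · exact ⟨v, hv, j, le_rfl, j.le_succ, h⟩
      · exact ⟨v, hv, j + 1, j.le_succ, le_rfl, h⟩
    have hfrac : ∀ l : ℕ, l ≤ j + 1 → (0 : ℝ) ≤ l / N ∧ (l : ℝ) / N ≤ 1 := fun l hl =>
      ⟨by positivity, (div_le_one hN').2 (by exact_mod_cast hl.trans hj)⟩
    refine ⟨hρ, ?_, ?_⟩
    · intro x hx
      obtain ⟨v, hv, l, -, hl, rfl⟩ := hstep x hx
      obtain ⟨hl0, hl1⟩ := hfrac l hl
      obtain ⟨hv1, hv0⟩ := h1 v hv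
      refine ⟨?_, ?_⟩
      · have habs : ∀ i, |(1 - (l : ℝ) / N) * v.1 i + l / N * e (d + 1) i| =
            (1 - l / N) * |v.1 i| + l / N * e (d + 1) i := by
          intro i
          by_cases hi : i.val = d + 1
          · rw [hv0 i (by omega), mul_zero, zero_add, abs_zero, mul_zero, zero_add,
              abs_of_nonneg (mul_nonneg hl0 (he0 _ _))]
          · have : e (d + 1) i = 0 := if_neg hi
            rw [this, mul_zero, add_zero, add_zero, abs_mul, abs_of_nonneg (sub_nonneg.2 hl1)]
        simp only [s, habs, Finset.sum_add_distrib, ← Finset.mul_sum, hv1, he (d + 1) hd]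
        ring
      · intro i hi
        have : e (d + 1) i = 0 := if_neg (by omega)
        simp only [s, this, hv0 i (by omega), mul_zero, add_zero]
    · intro x hx y hy
      obtain ⟨v, hv, l, hjl, hl, rfl⟩ := hstep x hx
      obtain ⟨w, hw, l', hjl', hl', rfl⟩ := hstep y hy
      obtain ⟨hl0, hl1⟩ := hfrac l hl
      refine (dist_pi_le_iff (by positivity)).2 fun i => ?_
      have hvw : |v.1 i - w.1 i| ≤ 2 * d / N :=
        (dist_le_pi_dist v.1 w.1 i).trans (h2 v hv w hw)
      have hwi : |w.1 i| ≤ 1 := by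
        rw [← (h1 w hw).1]
        exact Finset.single_le_sum (f := fun i => |w.1 i|) (fun _ _ => abs_nonneg _)
          (Finset.mem_univ i)
      have hll : |(l' : ℝ) / N - l / N| ≤ 1 / N := by
        rw [← sub_div, abs_div, abs_of_pos hN']
        refine div_le_div_of_nonneg_right (abs_le.2 ⟨?_, ?_⟩) hN'.le
        · have : (l : ℝ) ≤ l' + 1 := by exact_mod_cast (by omega : l ≤ l' + 1)
          linarith
        · have : (l' : ℝ) ≤ l + 1 := by exact_mod_cast (by omega : l' ≤ l + 1)
          linarith
      have hew : |w.1 i - e (d + 1) i| ≤ 2 := by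
        have := he0 (d + 1) i
        have := he1 (d + 1) i
        rw [abs_le] at hwi ⊢
        constructor <;> linarith
      calc |(1 - (l : ℝ) / N) * v.1 i + l / N * e (d + 1) i -
            ((1 - (l' : ℝ) / N) * w.1 i + l' / N * e (d + 1) i)|
          = |(1 - (l : ℝ) / N) * (v.1 i - w.1 i) +
              ((l' : ℝ) / N - l / N) * (w.1 i - e (d + 1) i)| := by congr 1; ring
        _ ≤ (1 - (l : ℝ) / N) * |v.1 i - w.1 i| +
              |(l' : ℝ) / N - l / N| * |w.1 i - e (d + 1) i| := by
            refine (abs_add_le _ _).trans_eq ?_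
            rw [abs_mul, abs_mul, abs_of_nonneg (sub_nonneg.2 hl1)]
        _ ≤ 1 * (2 * d / N) + 1 / N * 2 := by
            gcongr
            linarith
        _ = 2 * ((d + 1 : ℕ) : ℝ) / N := by push_cast; ring
  have hne : hemisphere ν s N (e 0, true) k (coboundary (antipodalCochain a k)) ≠ 0 := by
    rw [hemisphere_antipodalCochain hν hs0 hsN _ ha]
    exact one_ne_zero
  obtain ⟨σ, ⟨h0, h1, h2⟩, hσ⟩ := exists_of_hemisphere_ne_zero good hp hgν hgs hne
  exact ⟨σ, h0, fun v hv => (h1 v hv).1, h2,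
    fun i hi => exists_ne_of_coboundary_antipodalCochain_ne_zero hσ hi⟩

/-- The Borsuk–Ulam theorem for odd maps defined off the origin. -/
theorem borsuk_ulam {k : ℕ} (F : (Fin (k + 1) → ℝ) → Fin k → ℝ) (hF : ContinuousOn F {0}ᶜ)
    (hodd : ∀ x, F (-x) = -F x) : ∃ x, x ≠ 0 ∧ F x = 0 := by
  by_contra! hne
  let S : Set (Fin (k + 1) → ℝ) := {x | ∑ i, |x i| = 1}
  have hS0 : ∀ x ∈ S, x ≠ 0 := by
    rintro x hx rfl
    simp [S] at hx
  have hSc : IsCompact S := by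
    refine Metric.isCompact_of_isClosed_isBounded
      (isClosed_eq (by fun_prop) continuous_const) ?_
    refine (Metric.isBounded_closedBall (x := (0 : Fin (k + 1) → ℝ)) (r := 1)).subset ?_
    intro x hx
    rw [mem_closedBall_zero_iff, pi_norm_le_iff_of_nonneg zero_le_one]
    intro i
    rw [← show ∑ i, |x i| = 1 from hx]
    exact Finset.single_le_sum (f := fun i => |x i|) (fun _ _ => abs_nonneg _)
      (Finset.mem_univ i)
  have hFS : ContinuousOn F S := hF.mono hS0
  have hSne : S.Nonempty := ⟨Pi.single 0 1, by simp [S, Pi.single_apply, apply_ite abs]⟩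
  obtain ⟨x₀, hx₀, hmin⟩ := hSc.exists_isMinOn hSne hFS.norm
  have hδ : 0 < ‖F x₀‖ := norm_pos_iff.2 (hne x₀ (hS0 x₀ hx₀))
  obtain ⟨η, hη, hunif⟩ := Metric.uniformContinuousOn_iff.1
    (hSc.uniformContinuousOn_of_continuous hFS) _ hδ
  obtain ⟨N, hN⟩ := exists_nat_gt (2 * k / η)
  have hN' : (0 : ℝ) < N := lt_of_le_of_lt (by positivity) hN
  let G : ℕ → (Fin (k + 1) → ℝ) → ℝ := fun i x => if h : i < k then F x ⟨i, h⟩ else 0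
  have hG : ∀ i x, G i (-x) = -G i x := by
    intro i x
    simp only [G]
    split_ifs <;> simp [hodd]
  let a : ℕ → (Fin (k + 1) → ℝ) × Bool → ZMod 2 := fun i x =>
    if 0 < G i x.1 then 1 else if G i x.1 < 0 then 0 else if x.2 then 1 else 0
  have ha : ∀ i x, a i (-x.1, !x.2) = a i x + 1 := by
    rintro i ⟨x, b⟩
    have h11 : (1 : ZMod 2) + 1 = 0 := by decide
    rcases lt_trichotomy (G i x) 0 with h | h | h
    · simp [a, hG, h, not_lt.2 h.le]
    · cases b <;> simp [a, hG, h, h11]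
    · simp [a, hG, h, not_lt.2 h.le, h11]
  obtain ⟨σ, hσ, hσS, hσd, hσa⟩ := exists_small_simplex k N (by exact_mod_cast hN') a ha
  obtain ⟨u, hu⟩ := List.exists_mem_of_ne_nil σ hσ
  have hclose : ∀ v ∈ σ, ∀ i, |F u.1 i - F v.1 i| < ‖F x₀‖ := by
    intro v hv i
    refine (dist_le_pi_dist (F u.1) (F v.1) i).trans_lt
      (hunif _ (hσS u hu) _ (hσS v hv) ((hσd u hu v hv).trans_lt ?_))
    rw [div_lt_iff₀ hN', mul_comm η]
    exact (div_lt_iff₀ hη).1 hN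
  have hlt : ‖F u.1‖ < ‖F x₀‖ := by
    refine (pi_norm_lt_iff hδ).2 fun i => ?_
    obtain ⟨v, hv, w, hw, hav, haw⟩ := hσa i i.2
    have hGF : ∀ x, G i x = F x i := fun x => by simp [G]
    have hFv : F v.1 i ≤ 0 := by
      by_contra! h
      simp [a, hGF, h] at hav
    have hFw : 0 ≤ F w.1 i := by
      by_contra! h
      simp [a, hGF, h, not_lt.2 h.le] at haw
    have h1 := abs_lt.1 (hclose v hv i)
    have h2 := abs_lt.1 (hclose w hw i)
    exact abs_lt.2 ⟨by linarith, by linarith⟩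
  exact absurd (hmin (hσS u hu)) (not_le.2 hlt)

/-- Digital Borsuk–Ulam for `(cₙ,c₁^m)`-continuous maps: if `B ⊂ ℤⁿ` is an
`n`-box (`n = k + 1 ≥ 1`) with boundary `∂B` and canonical involution `τ`, and
`f : ∂B → ℤ^{n-1}` is `(cₙ,c₁^m)`-continuous (`m ≥ 1`), i.e. `cₙ`-adjacent
points have images at ℓ¹-distance at most `m`, then there is `x ∈ ∂B` with
ℓ¹-distance between `f x` and `f (τ x)` at most `2 * m`. -/
theorem digital_borsuk_ulam_cn_c1m (k : ℕ) (m : ℕ) (hm : 1 ≤ m)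
    (a b : Fin (k + 1) → ℤ) (hab : ∀ i, a i < b i)
    (B : Set (Fin (k + 1) → ℤ))
    (hB : B = {x | ∀ i, a i ≤ x i ∧ x i ≤ b i})
    (bdry : Set (Fin (k + 1) → ℤ))
    (hbdry : bdry = {x ∈ B | ∃ i, x i = a i ∨ x i = b i})
    (τ : (Fin (k + 1) → ℤ) → (Fin (k + 1) → ℤ))
    (hτ : τ = fun x i => a i + b i - x i)
    (f : (Fin (k + 1) → ℤ) → (Fin k → ℤ))
    (hf : ∀ x ∈ bdry, ∀ y ∈ bdry, CnAdj (k + 1) x y →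
      l1Dist k (f x) (f y) ≤ (m : ℤ)) :
    ∃ x ∈ bdry, l1Dist k (f x) (f (τ x)) ≤ 2 * (m : ℤ) := by
  have hτbdry : ∀ v ∈ bdry, τ v ∈ bdry := by
    subst hbdry hB hτ
    rintro v ⟨hv, i, hi⟩
    refine ⟨fun i => ?_, i, ?_⟩
    · have := hv i
      dsimp only
      omega
    · dsimp only
      omega
  have hclose : ∀ u ∈ bdry, ∀ v ∈ bdry, (∀ i, |u i - v i| ≤ 1) →
      l1Dist k (f u) (f v) ≤ m := by
    intro u hu v hv huv
    by_cases h : u = v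
    · subst h
      simp [l1Dist]
    · exact hf u hu v hv ⟨h, huv⟩
  let g : (Fin (k + 1) → ℤ) → Fin k → ℝ := fun v j => f v j - f (τ v) j
  have hgτ : ∀ v j, g (τ v) j = -g v j := by
    intro v j
    have : τ (τ v) = v := by subst hτ; funext i; dsimp only; ring
    simp [g, this]
  have hgclose : ∀ u ∈ bdry, ∀ v ∈ bdry, (∀ i, |u i - v i| ≤ 1) →
      ∑ j, |g u j - g v j| ≤ 2 * m := by
    intro u hu v hv huv
    have h1 := hclose u hu v hv huv
    have h2 := hclose (τ u) (hτbdry u hu) (τ v) (hτbdry v hv) fun i => by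
      subst hτ
      simpa [abs_sub_comm] using huv i
    have h1' : ∑ j, |(f u j : ℝ) - f v j| ≤ m := by exact_mod_cast h1
    have h2' : ∑ j, |(f (τ u) j : ℝ) - f (τ v) j| ≤ m := by exact_mod_cast h2
    calc ∑ j, |g u j - g v j|
        ≤ ∑ j, (|(f u j : ℝ) - f v j| + |(f (τ u) j : ℝ) - f (τ v) j|) := by
          refine Finset.sum_le_sum fun j _ => ?_
          refine le_of_eq_of_le ?_ (abs_sub _ _)
          congr 1
          simp only [g]
          ring
      _ ≤ 2 * m := by rw [Finset.sum_add_distrib]; linarith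
  let y : (Fin (k + 1) → ℝ) → Fin (k + 1) → ℝ := fun x i =>
    (a i + b i) / 2 + (b i - a i) / 2 * (x i / ‖x‖)
  let w : (Fin (k + 1) → ℝ) → (Fin (k + 1) → ℤ) → ℝ := fun x v =>
    ∏ i, max 0 (1 - |y x i - v i|)
  let V : Finset (Fin (k + 1) → ℤ) := Fintype.piFinset fun i => Finset.Icc (a i) (b i)
  have hV : ∀ v, v ∈ V ↔ ∀ i, a i ≤ v i ∧ v i ≤ b i := fun v => by
    simp only [V, Fintype.mem_piFinset, Finset.mem_Icc]
  have hw0 : ∀ x v, 0 ≤ w x v := fun x v => Finset.prod_nonneg fun i _ => le_max_left _ _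
  have hwτ : ∀ x v, w (-x) (τ v) = w x v := by
    intro x v
    refine Finset.prod_congr rfl fun i _ => ?_
    rw [← abs_neg]
    congr 3
    simp only [y, hτ, norm_neg, Pi.neg_apply]
    push_cast
    ring
  obtain ⟨x, hx, hFx⟩ := borsuk_ulam (fun x j => ∑ v ∈ V, w x v * g v j)
    (by
      refine continuousOn_pi.2 fun j => continuousOn_finsetSum _ fun v _ => ?_
      refine ContinuousOn.mul (continuousOn_finsetProd _ fun i _ => ?_) continuousOn_const
      have : ContinuousOn (fun x : Fin (k + 1) → ℝ => x i / ‖x‖) {0}ᶜ :=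
        (continuous_apply i).continuousOn.div continuous_norm.continuousOn
          fun x hx => norm_ne_zero_iff.2 hx
      exact continuousOn_const.sup (continuousOn_const.sub
        (((continuousOn_const.add (continuousOn_const.mul this)).sub continuousOn_const).abs)))
    (by
      intro x
      funext j
      rw [Pi.neg_apply, ← Finset.sum_neg_distrib]
      have hττ : ∀ v, τ (τ v) = v := fun v => by subst hτ; funext i; dsimp only; ring
      have hτV : ∀ v ∈ V, τ v ∈ V := fun v hv => by
        rw [hV] at hv ⊢
        intro i
        have := hv i
        simp only [hτ]
        omega
      refine Finset.sum_nbij' τ τ hτV hτV (fun v _ => hττ v) (fun v _ => hττ v) fun v _ => ?_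
      rw [← hwτ, neg_neg, hgτ]
      ring)
  have hnorm : 0 < ‖x‖ := norm_pos_iff.2 hx
  have hab' : ∀ i, (a i : ℝ) < b i := fun i => by exact_mod_cast hab i
  have hy : ∀ i, (a i : ℝ) ≤ y x i ∧ y x i ≤ b i := by
    intro i
    have h := abs_le.1 (norm_le_pi_norm x i)
    have h1 : -1 ≤ x i / ‖x‖ := by rw [le_div_iff₀ hnorm]; linarith [h.1]
    have h2 : x i / ‖x‖ ≤ 1 := by rw [div_le_iff₀ hnorm]; linarith [h.2]
    have := hab' i
    constructor <;> simp only [y] <;> nlinarith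
  obtain ⟨i₀, hi₀⟩ : ∃ i, y x i = a i ∨ y x i = b i := by
    obtain ⟨i, hi⟩ := Finite.exists_max fun i => ‖x i‖
    have hxi : ‖x‖ = |x i| := le_antisymm
      ((pi_norm_le_iff_of_nonneg (abs_nonneg _)).2 hi) (norm_le_pi_norm x i)
    refine ⟨i, ?_⟩
    rcases abs_choice (x i) with h | h
    · right
      have : x i / ‖x‖ = 1 := by rw [hxi, h, div_self]; rw [← h, ← hxi]; exact hnorm.ne'
      simp only [y, this]
      ring
    · left
      have : x i / ‖x‖ = -1 := by
        rw [div_eq_iff hnorm.ne', hxi, h]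
        ring
      simp only [y, this]
      ring
  have hwpos : ∀ v, 0 < w x v → ∀ i, |y x i - v i| < 1 := by
    intro v hv i
    by_contra! h
    refine hv.ne' (Finset.prod_eq_zero (Finset.mem_univ i) (max_eq_left ?_))
    linarith
  have hwbdry : ∀ v ∈ V, 0 < w x v → v ∈ bdry := by
    intro v hv hwv
    rw [hbdry, hB]
    refine ⟨(hV v).1 hv, i₀, ?_⟩
    have h := hwpos v hwv i₀
    refine hi₀.imp (fun h₀ => ?_) fun h₀ => ?_ <;>
    · rw [h₀] at h
      have h' := Int.abs_lt_one_iff.1 (by exact_mod_cast h)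
      omega
  obtain ⟨u, huV, hu⟩ : ∃ u ∈ V, 0 < w x u := by
    refine ⟨fun i => ⌊y x i⌋, (hV _).2 fun i => ⟨Int.le_floor.2 (hy i).1, ?_⟩,
      Finset.prod_pos fun i _ => lt_max_of_lt_right ?_⟩
    · exact_mod_cast (Int.floor_le (y x i)).trans (hy i).2
    · rw [sub_pos, abs_lt]
      constructor <;> linarith [Int.floor_le (y x i), Int.lt_floor_add_one (y x i)]
  refine ⟨u, hwbdry u huV hu, ?_⟩
  have hW : 0 < ∑ v ∈ V, w x v := Finset.sum_pos' (fun v _ => hw0 x v) ⟨u, huV, hu⟩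
  have hterm : ∀ v ∈ V, w x v * ∑ j, |g u j - g v j| ≤ w x v * (2 * m) := by
    intro v hv
    rcases (hw0 x v).eq_or_lt with h | h
    · rw [← h, zero_mul, zero_mul]
    · refine mul_le_mul_of_nonneg_left
        (hgclose u (hwbdry u huV hu) v (hwbdry v hv h) fun i => ?_) (hw0 x v)
      have h1 := abs_lt.1 (hwpos u hu i)
      have h2 := abs_lt.1 (hwpos v h i)
      have h3 : u i < v i + 2 := by exact_mod_cast (by linarith : (u i : ℝ) < v i + 2)
      have h4 : v i < u i + 2 := by exact_mod_cast (by linarith : (v i : ℝ) < u i + 2)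
      exact abs_le.2 ⟨by omega, by omega⟩
  have hmain : (∑ v ∈ V, w x v) * ∑ j, |g u j| ≤ (∑ v ∈ V, w x v) * (2 * m) := by
    calc (∑ v ∈ V, w x v) * ∑ j, |g u j|
        = ∑ j, |∑ v ∈ V, w x v * (g u j - g v j)| := by
          rw [Finset.mul_sum]
          refine Finset.sum_congr rfl fun j _ => ?_
          simp only [mul_sub, Finset.sum_sub_distrib]
          rw [show ∑ v ∈ V, w x v * g v j = 0 from congrFun hFx j, sub_zero, ← Finset.sum_mul,
            abs_mul, abs_of_pos hW]
      _ ≤ ∑ j, ∑ v ∈ V, w x v * |g u j - g v j| := by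
          refine Finset.sum_le_sum fun j _ => (Finset.abs_sum_le_sum_abs _ _).trans_eq ?_
          simp only [abs_mul, abs_of_nonneg (hw0 x _)]
      _ = ∑ v ∈ V, w x v * ∑ j, |g u j - g v j| := by
          rw [Finset.sum_comm]
          simp only [Finset.mul_sum]
      _ ≤ ∑ v ∈ V, w x v * (2 * m) := Finset.sum_le_sum hterm
      _ = (∑ v ∈ V, w x v) * (2 * m) := by rw [Finset.sum_mul]
  have hle : ∑ j, |(f u j : ℝ) - f (τ u) j| ≤ 2 * m := le_of_mul_le_mul_left hmain hW
  exact_mod_cast hle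
end

section
/- Let σ and ρ be cₙ-simplices in ℤⁿ whose convex hulls in ℝⁿ have nonempty intersection. Then there is a vertex x ∈ σ such that for every vertex y ∈ ρ, either x = y or x is cₙ-adjacent to y. -/
/-- A point of the convex hull of a finite set has a supporting vertex: a vertex which lies on
every supporting hyperplane of the set through that point. -/
theorem exists_mem_le_of_mem_convexHull {E : Type*} [AddCommGroup E] [Module ℝ E]
    {s : Finset E} {z : E} (hz : z ∈ convexHull ℝ (s : Set E)) :
    ∃ x ∈ s, ∀ (f : E →ₗ[ℝ] ℝ) (c : ℝ), (∀ u ∈ s, c ≤ f u) → f z ≤ c → f x ≤ c := by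
  obtain ⟨w, hw0, hw1, rfl⟩ := Finset.mem_convexHull'.1 hz
  obtain ⟨x, hx, hwx⟩ : ∃ x ∈ s, 0 < w x :=
    Finset.exists_lt_of_sum_lt (f := fun _ => (0 : ℝ)) (by simp [hw1])
  refine ⟨x, hx, fun f c hc hz => ?_⟩
  by_contra! h
  have hlt : ∑ u ∈ s, w u * c < ∑ u ∈ s, w u * f u :=
    Finset.sum_lt_sum (fun u hu => mul_le_mul_of_nonneg_left (hc u hu) (hw0 u hu))
      ⟨x, hx, mul_lt_mul_of_pos_left h hwx⟩
  rw [← Finset.sum_mul, hw1, one_mul] at hlt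
  simp only [map_sum, map_smul, smul_eq_mul] at hz
  exact hlt.not_ge hz

theorem map_le_of_mem_convexHull {E : Type*} [AddCommGroup E] [Module ℝ E]
    {s : Set E} {z : E} (hz : z ∈ convexHull ℝ s) (f : E →ₗ[ℝ] ℝ) {c : ℝ}
    (h : ∀ u ∈ s, f u ≤ c) : f z ≤ c :=
  convexHull_min (t := {u | f u ≤ c}) h (convex_halfSpace_le f.isLinear c) hz

/-- Any two vertices of a `cₙ`-simplex differ by at most 1 in each coordinate. -/
theorem abs_sub_le_one_of_pairwise_cnAdj {n : ℕ} {σ : Finset (Fin n → ℤ)}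
    (hσ : ∀ x ∈ σ, ∀ y ∈ σ, x ≠ y → CnAdj n x y) {x y : Fin n → ℤ} (hx : x ∈ σ) (hy : y ∈ σ)
    (i : Fin n) : |x i - y i| ≤ 1 := by
  by_cases h : x = y
  · simp [h]
  · exact (hσ x hx y hy h).2 i

/-- Regularity of `cₙ`: if `σ` and `ρ` are `cₙ`-simplices in `ℤⁿ` whose convex
hulls in `ℝⁿ` intersect, then some vertex of `σ` is equal or `cₙ`-adjacent to
every vertex of `ρ`. -/
theorem cn_regular (n : ℕ) (σ ρ : Finset (Fin n → ℤ))
    (hσne : σ.Nonempty) (hρne : ρ.Nonempty)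
    (hσ : ∀ x ∈ σ, ∀ y ∈ σ, x ≠ y → CnAdj n x y)
    (hρ : ∀ x ∈ ρ, ∀ y ∈ ρ, x ≠ y → CnAdj n x y)
    (hint : (convexHull ℝ (intToReal n '' ↑σ) ∩
      convexHull ℝ (intToReal n '' ↑ρ)).Nonempty) :
    ∃ x ∈ σ, ∀ y ∈ ρ, x = y ∨ CnAdj n x y := by
  classical
  obtain ⟨z, hzσ, hzρ⟩ := hint
  rw [← Finset.coe_image] at hzσ
  obtain ⟨_, hx', hsupp⟩ := exists_mem_le_of_mem_convexHull hzσ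
  obtain ⟨x, hx, rfl⟩ := Finset.mem_image.1 hx'
  refine ⟨x, hx, fun y hy => or_iff_not_imp_left.2 fun hne => ⟨hne, fun i => ?_⟩⟩
  have key (e : ℤ) (he : |e| = 1) : e * x i ≤ e * y i + 1 := by
    let f : (Fin n → ℝ) →ₗ[ℝ] ℝ := (e : ℝ) • LinearMap.proj i
    have hf (u : Fin n → ℤ) : f (intToReal n u) = ((e * u i : ℤ) : ℝ) := by
      simp [f, intToReal]
    have hdiff (u v : Fin n → ℤ) (h : |u i - v i| ≤ 1) : e * u i ≤ e * v i + 1 := by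
      have : e * (u i - v i) ≤ 1 := by
        calc e * (u i - v i) ≤ |e * (u i - v i)| := le_abs_self _
          _ ≤ 1 := by rwa [abs_mul, he, one_mul]
      linarith
    by_contra! hlt
    have hz : f z ≤ ((e * y i + 1 : ℤ) : ℝ) := by
      refine map_le_of_mem_convexHull hzρ f ?_
      rintro _ ⟨u, hu, rfl⟩
      rw [hf]
      exact_mod_cast hdiff u y (abs_sub_le_one_of_pairwise_cnAdj hρ hu hy i)
    have hxle := hsupp f _ (fun u hu => by
      obtain ⟨v, hv, rfl⟩ := Finset.mem_image.1 hu
      rw [hf]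
      have := hdiff x v (abs_sub_le_one_of_pairwise_cnAdj hσ hx hv i)
      exact_mod_cast (by lia : e * y i + 1 ≤ e * v i)) hz
    rw [hf, Int.cast_le] at hxle
    exact hlt.not_ge hxle
  have h₁ := key 1 (by simp)
  have h₂ := key (-1) (by simp)
  rw [abs_le]
  constructor <;> linarith
end

section
/- (Digital Borsuk–Ulam for (cₙ,c_{n−1})-continuous maps.) Let n ≥ 2, let B ⊂ ℤⁿ be an n-box with boundary ∂B and canonical involution τ, and let f : ∂B → ℤ^{n−1} be (cₙ,c_{n−1})-continuous. Then there is a point x ∈ ∂B such that f(x) = f(τ(x)) or f(x) is c_{n−1}-adjacent to f(τ(x)). -/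
namespace DigitalBorsukUlam

/-! Cells of the cubical complex of `ℤⁿ` are written in doubled coordinates: the point `z : Fin n → ℤ`
stands for the cube whose vertices are the `v` with `|2 * v i - z i| ≤ 1`, so that odd coordinates
are the directions of the cube. Cochains take values in `ZMod 2`. -/

/-- The cubical coboundary modulo 2, in doubled coordinates. -/
def coboundary {n : ℕ} (φ : (Fin n → ℤ) → ZMod 2) (z : Fin n → ℤ) : ZMod 2 :=
  ∑ i, if Odd (z i) then
    φ (Function.update z i (z i + 1)) + φ (Function.update z i (z i - 1)) else 0

/-- The central reflection of the doubled box `[2a, 2b]`. -/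
def reflect {n : ℕ} (a b z : Fin n → ℤ) : Fin n → ℤ := fun i => 2 * a i + 2 * b i - z i

/-- Evaluation of a cochain on the `k`-th hemisphere chain of the box `[a, b]`, a chain `H k` with
`∂ (H (k + 1)) = H k + τ (H k)`. -/
def hemisphere : (n : ℕ) → (a b : Fin n → ℤ) → ℕ → ((Fin n → ℤ) → ZMod 2) → ZMod 2
  | 0, _, _, 0, φ => φ Fin.elim0
  | 0, _, _, _ + 1, _ => 0
  | n + 1, a, b, 0, φ => hemisphere n (Fin.tail a) (Fin.tail b) 0 fun z => φ (Fin.cons (2 * a 0) z)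
  | n + 1, a, b, k + 1, φ =>
    hemisphere n (Fin.tail a) (Fin.tail b) (k + 1) (fun z => φ (Fin.cons (2 * a 0) z)) +
    hemisphere n (Fin.tail a) (Fin.tail b) k (fun z =>
      ∑ j ∈ Finset.range (b 0 - a 0).toNat,
        φ (Fin.cons (2 * a 0 + 2 * j + 1) (reflect (Fin.tail a) (Fin.tail b) z)))

/-- Cells of the boundary of the box `[a, b]`. -/
def IsBoundaryCell {n : ℕ} (a b z : Fin n → ℤ) : Prop :=
  (∀ i, 2 * a i ≤ z i ∧ z i ≤ 2 * b i) ∧ ∃ i, z i = 2 * a i ∨ z i = 2 * b i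

/-- For a sign `σ` on cells, the mod 2 number of flags of codimension-one faces descending `k`
times from a cell along which the signs alternate, starting with `s`. -/
def altFlags {n : ℕ} (σ : (Fin n → ℤ) → Bool) : ℕ → Bool → (Fin n → ℤ) → ZMod 2
  | 0, s, z => if σ z = s then 1 else 0
  | k + 1, s, z => if σ z = s then coboundary (altFlags σ k !s) z else 0

theorem coboundary_cons {n : ℕ} (φ : (Fin (n + 1) → ℤ) → ZMod 2) (x : ℤ) (z : Fin n → ℤ) :
    coboundary φ (Fin.cons x z) =
      (if Odd x then φ (Fin.cons (x + 1) z) + φ (Fin.cons (x - 1) z) else 0) +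
        coboundary (fun w => φ (Fin.cons x w)) z := by
  simp only [coboundary, Fin.sum_univ_succ, Fin.cons_zero, Fin.cons_succ, Fin.update_cons_zero,
    Fin.cons_update]

theorem coboundary_add {n : ℕ} (φ ψ : (Fin n → ℤ) → ZMod 2) (z : Fin n → ℤ) :
    coboundary (fun w => φ w + ψ w) z = coboundary φ z + coboundary ψ z := by
  simp only [coboundary, ← Finset.sum_add_distrib]
  refine Finset.sum_congr rfl fun i _ => ?_
  split_ifs <;> ring

theorem coboundary_zero {n : ℕ} (z : Fin n → ℤ) :
    coboundary (fun _ => 0) z = 0 := by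
  simp [coboundary]

theorem coboundary_one {n : ℕ} (z : Fin n → ℤ) :
    coboundary (fun _ => 1) z = 0 := by
  simp [coboundary, CharTwo.add_self_eq_zero]

theorem coboundary_sum {n : ℕ} (N : ℕ) (φ : ℕ → (Fin n → ℤ) → ZMod 2) (z : Fin n → ℤ) :
    coboundary (fun w => ∑ j ∈ Finset.range N, φ j w) z =
      ∑ j ∈ Finset.range N, coboundary (φ j) z := by
  induction N with
  | zero => simp [coboundary_zero]
  | succ N ih => simp only [Finset.sum_range_succ, coboundary_add, ih]

theorem coboundary_coboundary {n : ℕ} (φ : (Fin n → ℤ) → ZMod 2) (z : Fin n → ℤ) :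
    coboundary (coboundary φ) z = 0 := by
  induction n with
  | zero => simp [coboundary]
  | succ n ih =>
    induction z using Fin.consCases with
    | _ x z =>
      rw [coboundary_cons]
      simp only [coboundary_cons, coboundary_add, ih]
      by_cases hx : Odd x
      · have h1 : ¬ Odd (x + 1) := by grind
        have h2 : ¬ Odd (x - 1) := by grind
        simp only [hx, h1, h2, if_true, if_false, coboundary_add, zero_add, add_zero]
        exact CharTwo.add_self_eq_zero _
      · simp [hx, coboundary_zero]

theorem reflect_reflect {n : ℕ} (a b z : Fin n → ℤ) : reflect a b (reflect a b z) = z := by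
  funext i; simp [reflect]

theorem reflect_cons {n : ℕ} (a b : Fin (n + 1) → ℤ) (x : ℤ) (z : Fin n → ℤ) :
    reflect a b (Fin.cons x z) =
      Fin.cons (2 * a 0 + 2 * b 0 - x) (reflect (Fin.tail a) (Fin.tail b) z) := by
  funext i
  refine Fin.cases ?_ (fun i => ?_) i <;> simp [reflect, Fin.tail]

theorem reflect_update {n : ℕ} (a b z : Fin n → ℤ) (i : Fin n) (x : ℤ) :
    reflect a b (Function.update z i x) =
      Function.update (reflect a b z) i (2 * a i + 2 * b i - x) := by
  funext j
  by_cases h : j = i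
  · subst h; simp [reflect]
  · simp [reflect, h]

theorem coboundary_reflect {n : ℕ} (a b : Fin n → ℤ) (φ : (Fin n → ℤ) → ZMod 2) (z : Fin n → ℤ) :
    coboundary φ (reflect a b z) = coboundary (fun w => φ (reflect a b w)) z := by
  refine Finset.sum_congr rfl fun i _ => ?_
  have h : Odd (reflect a b z i) ↔ Odd (z i) := by simp only [reflect]; grind
  simp only [h, reflect_update]
  split_ifs
  · have h1 : reflect a b z i + 1 = 2 * a i + 2 * b i - (z i - 1) := by simp only [reflect]; ring
    have h2 : reflect a b z i - 1 = 2 * a i + 2 * b i - (z i + 1) := by simp only [reflect]; ring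
    rw [h1, h2, add_comm]
  · rfl

theorem hemisphere_add {n : ℕ} (a b : Fin n → ℤ) (k : ℕ) (φ ψ : (Fin n → ℤ) → ZMod 2) :
    hemisphere n a b k (fun z => φ z + ψ z) = hemisphere n a b k φ + hemisphere n a b k ψ := by
  induction n generalizing k with
  | zero => cases k <;> simp [hemisphere]
  | succ n ih =>
    cases k with
    | zero => simp only [hemisphere, ih]
    | succ k =>
      simp only [hemisphere, Finset.sum_add_distrib, ih]
      ring

theorem hemisphere_zero_right {n : ℕ} (a b : Fin n → ℤ) (k : ℕ) :
    hemisphere n a b k (fun _ => 0) = 0 := by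
  simpa using hemisphere_add a b k (fun _ => 0) (fun _ => 0)

theorem hemisphere_zero_left {n : ℕ} (a b : Fin n → ℤ) (φ : (Fin n → ℤ) → ZMod 2) :
    hemisphere n a b 0 φ = φ fun i => 2 * a i := by
  induction n with
  | zero => simp only [hemisphere]; congr 1; exact Subsingleton.elim _ _
  | succ n ih =>
    simp only [hemisphere, ih]
    congr 1
    funext i
    refine Fin.cases ?_ (fun i => ?_) i <;> simp [Fin.tail]

theorem hemisphere_zero_coboundary {n : ℕ} (a b : Fin n → ℤ) (φ : (Fin n → ℤ) → ZMod 2) :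
    hemisphere n a b 0 (coboundary φ) = 0 := by
  rw [hemisphere_zero_left]
  exact Finset.sum_eq_zero fun i _ => if_neg (by grind)

theorem sum_range_endpoints (φ : ℤ → ZMod 2) (x : ℤ) (N : ℕ) :
    ∑ j ∈ Finset.range N, (φ (x + 2 * j + 1 + 1) + φ (x + 2 * j + 1 - 1)) =
      φ x + φ (x + 2 * N) := by
  induction N with
  | zero => simp [CharTwo.add_self_eq_zero]
  | succ N ih =>
    have h1 : x + 2 * (N : ℤ) + 1 + 1 = x + 2 * ((N + 1 : ℕ) : ℤ) := by push_cast; ring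
    have h2 : x + 2 * (N : ℤ) + 1 - 1 = x + 2 * N := by ring
    rw [Finset.sum_range_succ, ih, h1, h2]
    linear_combination CharTwo.add_self_eq_zero (φ (x + 2 * N))

/-- Stokes' formula for the hemisphere chains. -/
theorem hemisphere_coboundary {n : ℕ} (a b : Fin n → ℤ) (hab : ∀ i, a i ≤ b i) (k : ℕ)
    (φ : (Fin n → ℤ) → ZMod 2) :
    hemisphere n a b (k + 1) (coboundary φ) =
      hemisphere n a b k φ + hemisphere n a b k (fun z => φ (reflect a b z)) := by
  induction n generalizing k with
  | zero =>
    cases k with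
    | zero =>
      simp only [hemisphere]
      rw [Subsingleton.elim (reflect a b Fin.elim0) Fin.elim0, CharTwo.add_self_eq_zero]
    | succ k => simp [hemisphere]
  | succ n ih =>
    have hab' : ∀ i, Fin.tail a i ≤ Fin.tail b i := fun i => hab i.succ
    have hN : 2 * a 0 + 2 * (((b 0 - a 0).toNat : ℕ) : ℤ) = 2 * b 0 := by
      have := hab 0; omega
    have heven : ¬ Odd (2 * a 0) := by grind
    have hodd : ∀ j : ℕ, Odd (2 * a 0 + 2 * (j : ℤ) + 1) := fun j => by grind
    set N := (b 0 - a 0).toNat with hNdef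
    set a' := Fin.tail a
    set b' := Fin.tail b
    set Ψ : (Fin n → ℤ) → ZMod 2 := fun z =>
      ∑ j ∈ Finset.range N, φ (Fin.cons (2 * a 0 + 2 * j + 1) z) with hΨ
    have key : ∀ z : Fin n → ℤ,
        ∑ j ∈ Finset.range N, coboundary φ (Fin.cons (2 * a 0 + 2 * j + 1) z) =
          φ (Fin.cons (2 * a 0) z) + φ (Fin.cons (2 * b 0) z) + coboundary Ψ z := by
      intro z
      simp only [coboundary_cons, hodd, if_true, Finset.sum_add_distrib (f := fun j : ℕ =>
        φ (Fin.cons (2 * a 0 + 2 * (j : ℤ) + 1 + 1) z) +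
          φ (Fin.cons (2 * a 0 + 2 * (j : ℤ) + 1 - 1) z))]
      rw [sum_range_endpoints (fun x => φ (Fin.cons x z)), hN, hΨ, coboundary_sum]
    have hrefl : ∀ z : Fin n → ℤ,
        ∑ j ∈ Finset.range N, φ (Fin.cons (2 * a 0 + 2 * b 0 - (2 * a 0 + 2 * j + 1)) z) =
          Ψ z := by
      intro z
      rw [hΨ]
      dsimp only
      rw [← Finset.sum_range_reflect]
      refine Finset.sum_congr rfl fun j hj => ?_
      have := Finset.mem_range.1 hj
      congr 2
      omega
    have hL : hemisphere (n + 1) a b (k + 1) (coboundary φ) =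
        hemisphere n a' b' k (fun z => φ (Fin.cons (2 * a 0) z)) +
        hemisphere n a' b' k (fun z => φ (Fin.cons (2 * b 0) (reflect a' b' z))) +
        hemisphere n a' b' k (coboundary fun z => Ψ (reflect a' b' z)) := by
      simp only [hemisphere]
      simp only [← hNdef, key, hemisphere_add]
      simp only [coboundary_cons, heven, if_false, zero_add]
      change hemisphere n a' b' (k + 1) (coboundary fun w => φ (Fin.cons (2 * a 0) w)) + _ = _
      rw [ih a' b' hab']
      simp only [coboundary_reflect]
      linear_combination CharTwo.add_self_eq_zero
        (hemisphere n a' b' k (fun z => φ (Fin.cons (2 * a 0) (reflect a' b' z))))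
    rw [hL]
    have hend : ∀ z : Fin n → ℤ, φ (reflect a b (Fin.cons (2 * a 0) z)) =
        φ (Fin.cons (2 * b 0) (reflect a' b' z)) := fun z => by
      rw [reflect_cons]; congr 2; ring
    cases k with
    | zero => simp only [hemisphere, hend, hemisphere_zero_coboundary, add_zero]; rfl
    | succ k =>
      rw [ih a' b' hab']
      simp only [hemisphere, hend]
      simp only [reflect_cons, ← hNdef]
      change _ = hemisphere n a' b' (k + 1) (fun z => φ (Fin.cons (2 * a 0) z)) +
        hemisphere n a' b' k (fun z => Ψ (reflect a' b' z)) +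
        (hemisphere n a' b' (k + 1) (fun z => φ (Fin.cons (2 * b 0) (reflect a' b' z))) +
        hemisphere n a' b' k (fun z => ∑ j ∈ Finset.range N,
          φ (Fin.cons (2 * a 0 + 2 * b 0 - (2 * a 0 + 2 * j + 1))
            (reflect a' b' (reflect a' b' z)))))
      simp only [hrefl]
      ring

theorem hemisphere_congr_aux {n : ℕ} (a b : Fin n → ℤ) (hab : ∀ i, a i ≤ b i) (k : ℕ)
    (φ ψ : (Fin n → ℤ) → ZMod 2)
    (h : ∀ z, (∀ i, 2 * a i ≤ z i ∧ z i ≤ 2 * b i) →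
      (k < n → ∃ i, z i = 2 * a i ∨ z i = 2 * b i) → φ z = ψ z) :
    hemisphere n a b k φ = hemisphere n a b k ψ := by
  induction n generalizing k with
  | zero =>
    cases k with
    | zero => exact h _ (fun i => i.elim0) (fun h => absurd h (lt_irrefl _))
    | succ k => rfl
  | succ n ih =>
    have hab' : ∀ i, Fin.tail a i ≤ Fin.tail b i := fun i => hab i.succ
    have hbase : ∀ k, hemisphere n (Fin.tail a) (Fin.tail b) k
          (fun z => φ (Fin.cons (2 * a 0) z)) =
        hemisphere n (Fin.tail a) (Fin.tail b) k (fun z => ψ (Fin.cons (2 * a 0) z)) := by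
      refine fun k => ih _ _ hab' _ _ _ fun z hz _ => h _ (fun i => ?_) fun _ => ⟨0, by simp⟩
      refine Fin.cases ?_ (fun i => ?_) i
      · have := hab 0; simp; omega
      · simpa [Fin.tail] using hz i
    cases k with
    | zero => exact hbase 0
    | succ k =>
      simp only [hemisphere]
      congr 1
      · exact hbase (k + 1)
      · refine ih _ _ hab' _ _ _ fun z hz hz' => Finset.sum_congr rfl fun j hj => ?_
        have hj' := Finset.mem_range.1 hj
        refine h _ (fun i => ?_) fun hk => ?_
        · refine Fin.cases ?_ (fun i => ?_) i
          · simp; omega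
          · have := hz i
            simp only [Fin.cons_succ, reflect, Fin.tail] at *
            omega
        · obtain ⟨i, hi⟩ := hz' (by omega)
          refine ⟨i.succ, ?_⟩
          simp only [Fin.cons_succ, reflect, Fin.tail] at *
          omega

theorem hemisphere_congr {n : ℕ} {a b : Fin n → ℤ} (hab : ∀ i, a i ≤ b i) {k : ℕ} (hk : k < n)
    {φ ψ : (Fin n → ℤ) → ZMod 2} (h : ∀ z, IsBoundaryCell a b z → φ z = ψ z) :
    hemisphere n a b k φ = hemisphere n a b k ψ :=
  hemisphere_congr_aux a b hab k φ ψ fun z hz hz' => h z ⟨hz, hz' hk⟩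

theorem IsBoundaryCell.update {n : ℕ} {a b z : Fin n → ℤ} (hz : IsBoundaryCell a b z) {i : Fin n}
    (hi : Odd (z i)) {x : ℤ} (hx : x = z i + 1 ∨ x = z i - 1) :
    IsBoundaryCell a b (Function.update z i x) := by
  obtain ⟨h, j, hj⟩ := hz
  obtain ⟨r, hr⟩ := hi
  refine ⟨fun l => ?_, j, ?_⟩
  · have := h l
    by_cases hl : l = i
    · subst hl; simp; omega
    · simpa [hl] using this
  · have : j ≠ i := by rintro rfl; omega
    simpa [this] using hj

theorem altFlags_add_altFlags {n : ℕ} (σ : (Fin n → ℤ) → Bool) (k : ℕ) (s : Bool)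
    (z : Fin n → ℤ) :
    altFlags σ (k + 1) s z + altFlags σ (k + 1) (!s) z = coboundary (altFlags σ k s) z := by
  have indep : ∀ s, coboundary (altFlags σ k s) z + coboundary (altFlags σ k (!s)) z = 0 := by
    induction k generalizing z with
    | zero =>
      intro s
      rw [← coboundary_add, ← coboundary_one z]
      congr 1
      funext w
      cases s <;> cases h : σ w <;> simp [altFlags, h]
    | succ k ih =>
      intro s
      rw [← coboundary_add, ← coboundary_coboundary (altFlags σ k s) z]
      congr 1
      funext w
      have := CharTwo.add_eq_zero.1 (ih w s)
      cases s <;> cases h : σ w <;> simp_all [altFlags]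
  have := CharTwo.add_eq_zero.1 (indep s)
  cases s <;> cases h : σ z <;> simp_all [altFlags]

theorem altFlags_reflect {n : ℕ} {a b : Fin n → ℤ} {σ : (Fin n → ℤ) → Bool}
    (hσ : ∀ z, IsBoundaryCell a b z → σ (reflect a b z) = !σ z) (k : ℕ) (s : Bool)
    (z : Fin n → ℤ) (hz : IsBoundaryCell a b z) :
    altFlags σ k s (reflect a b z) = altFlags σ k (!s) z := by
  induction k generalizing s z with
  | zero => cases s <;> cases h : σ z <;> simp [altFlags, hσ z hz, h]
  | succ k ih =>
    have : coboundary (altFlags σ k (!s)) (reflect a b z) =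
        coboundary (altFlags σ k (!!s)) z := by
      rw [coboundary_reflect]
      refine Finset.sum_congr rfl fun i _ => ?_
      split_ifs with hi
      · dsimp only
        rw [ih _ _ (hz.update hi (Or.inl rfl)), ih _ _ (hz.update hi (Or.inr rfl))]
      · rfl
    rw [altFlags, altFlags, this, hσ z hz]
    cases s <;> cases σ z <;> rfl

theorem sum_altFlags_hemisphere {n : ℕ} {a b : Fin n → ℤ} (hab : ∀ i, a i ≤ b i)
    {σ : (Fin n → ℤ) → Bool} (hσ : ∀ z, IsBoundaryCell a b z → σ (reflect a b z) = !σ z)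
    (k : ℕ) (hk : k < n) (s : Bool) :
    hemisphere n a b k (altFlags σ k s) + hemisphere n a b k (altFlags σ k (!s)) = 1 := by
  induction k with
  | zero =>
    simp only [hemisphere_zero_left, altFlags]
    cases s <;> cases σ (fun i => 2 * a i) <;> simp
  | succ k ih =>
    rw [← hemisphere_add]
    simp only [altFlags_add_altFlags]
    change hemisphere n a b (k + 1) (coboundary (altFlags σ k s)) = 1
    rw [hemisphere_coboundary a b hab, ← ih (by omega)]
    congr 1
    exact hemisphere_congr hab (by omega) fun z hz => altFlags_reflect hσ k s z hz

theorem add_lt_of_altFlags_ne_zero {n d : ℕ} {a b : Fin n → ℤ} {σ : (Fin n → ℤ) → Bool}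
    {ι : (Fin n → ℤ) → ℕ} (hd : ∀ z, IsBoundaryCell a b z → ι z < d)
    (hface : ∀ z, IsBoundaryCell a b z → ∀ i x, Odd (z i) → x = z i + 1 ∨ x = z i - 1 →
      ι z ≤ ι (Function.update z i x) ∧
        (ι z = ι (Function.update z i x) → σ z = σ (Function.update z i x)))
    (k : ℕ) (s : Bool) (z : Fin n → ℤ) (hz : IsBoundaryCell a b z) (h : altFlags σ k s z ≠ 0) :
    σ z = s ∧ ι z + k < d := by
  induction k generalizing s z with
  | zero =>
    refine ⟨?_, hd z hz⟩
    by_contra hs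
    simp [altFlags, hs] at h
  | succ k ih =>
    rw [altFlags] at h
    split_ifs at h with hs
    · refine ⟨hs, ?_⟩
      obtain ⟨i, -, hi⟩ := Finset.exists_ne_zero_of_sum_ne_zero h
      split_ifs at hi with ho
      · obtain ⟨x, hx, hne⟩ : ∃ x, (x = z i + 1 ∨ x = z i - 1) ∧
            altFlags σ k (!s) (Function.update z i x) ≠ 0 := by
          by_contra! hc
          exact hi (by rw [hc _ (Or.inl rfl), hc _ (Or.inr rfl), add_zero])
        obtain ⟨h1, h2⟩ := ih _ _ (hz.update ho hx) hne
        obtain ⟨h3, h4⟩ := hface z hz i x ho hx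
        have : ι z ≠ ι (Function.update z i x) := fun he => by
          have := h4 he
          rw [h1, hs] at this
          cases s <;> simp at this
        omega
      · exact absurd rfl hi
    · exact absurd rfl h

/-- Tucker's lemma for the boundary of an `n`-box, for labels on cells whose absolute value `ι` is
antitone and whose sign is `σ`: at least `n` absolute values are needed. -/
theorem le_of_antipodal_labelling {n d : ℕ} (hn : 0 < n) {a b : Fin n → ℤ} (hab : ∀ i, a i ≤ b i)
    {σ : (Fin n → ℤ) → Bool} {ι : (Fin n → ℤ) → ℕ}
    (hd : ∀ z, IsBoundaryCell a b z → ι z < d)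
    (hσ : ∀ z, IsBoundaryCell a b z → σ (reflect a b z) = !σ z)
    (hface : ∀ z, IsBoundaryCell a b z → ∀ i x, Odd (z i) → x = z i + 1 ∨ x = z i - 1 →
      ι z ≤ ι (Function.update z i x) ∧
        (ι z = ι (Function.update z i x) → σ z = σ (Function.update z i x))) :
    n ≤ d := by
  by_contra hlt
  have hzero : ∀ s, hemisphere n a b (n - 1) (altFlags σ (n - 1) s) = 0 := fun s => by
    rw [← hemisphere_zero_right a b (n - 1)]
    refine hemisphere_congr hab (by omega) fun z hz => ?_
    by_contra hne
    have := (add_lt_of_altFlags_ne_zero hd hface _ _ z hz hne).2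
    omega
  have := sum_altFlags_hemisphere hab hσ (n - 1) (by omega) true
  rw [hzero, hzero] at this
  simp at this

/-- An antipodal map `g` on the boundary of a box in `ℤⁿ` whose coordinates vary by at most `2`
between adjacent points and which always has a coordinate of absolute value at least `2` has at
least `n` coordinates. -/
theorem le_of_antipodal_map {n d : ℕ} (hn : 0 < n) {a b : Fin n → ℤ} (hab : ∀ i, a i ≤ b i)
    (D : Set (Fin n → ℤ))
    (hD : D = {v | (∀ i, a i ≤ v i ∧ v i ≤ b i) ∧ ∃ i, v i = a i ∨ v i = b i})
    (g : (Fin n → ℤ) → ℕ → ℤ)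
    (hodd : ∀ v i, g (fun j => a j + b j - v j) i = - g v i)
    (hcont : ∀ v ∈ D, ∀ w ∈ D, (∀ i, |v i - w i| ≤ 1) → ∀ i, |g v i - g w i| ≤ 2)
    (hlarge : ∀ v ∈ D, ∃ i < d, 2 ≤ |g v i|) :
    n ≤ d := by
  classical
  let V : (Fin n → ℤ) → Set (Fin n → ℤ) := fun z => {v | ∀ i, |2 * v i - z i| ≤ 1}
  let S : (Fin n → ℤ) → Set ℕ := fun z => {i | ∃ v ∈ V z, 2 ≤ |g v i|}
  let ι : (Fin n → ℤ) → ℕ := fun z => sInf (S z)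
  let σ : (Fin n → ℤ) → Bool := fun z => decide (∃ v ∈ V z, 2 ≤ g v (ι z))
  have hVD : ∀ z, IsBoundaryCell a b z → ∀ v ∈ V z, v ∈ D := by
    rintro z ⟨hz, j, hj⟩ v hv
    rw [hD]
    refine ⟨fun i => ?_, j, ?_⟩
    · have := hz i; have := abs_le.1 (hv i); omega
    · have := abs_le.1 (hv j); omega
  have hVne : ∀ z, ∃ v, v ∈ V z := fun z =>
    ⟨fun i => z i / 2, fun i => abs_le.2 (by dsimp only; omega)⟩
  have hconf : ∀ z, IsBoundaryCell a b z → ∀ v ∈ V z, ∀ w ∈ V z, ∀ i, 2 ≤ g v i → g w i ≤ -2 →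
      False := by
    intro z hz v hv w hw i h1 h2
    have := abs_le.1 (hcont v (hVD z hz v hv) w (hVD z hz w hw) (fun j => abs_le.2 (by
      have := abs_le.1 (hv j); have := abs_le.1 (hw j); omega)) i)
    omega
  have hVr : ∀ z, ∀ v ∈ V z, (fun j => a j + b j - v j) ∈ V (reflect a b z) := by
    intro z v hv j
    have := abs_le.1 (hv j)
    simp only [reflect]
    exact abs_le.2 (by omega)
  have hSr : ∀ z, S z ⊆ S (reflect a b z) := by
    rintro z i ⟨v, hv, hi⟩
    exact ⟨_, hVr z v hv, by rwa [hodd, abs_neg]⟩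
  have hιr : ∀ z, ι (reflect a b z) = ι z := fun z => by
    have h := hSr (reflect a b z)
    rw [reflect_reflect] at h
    exact congrArg sInf (h.antisymm (hSr z))
  have hSne : ∀ z, IsBoundaryCell a b z → ∃ i < d, i ∈ S z := fun z hz => by
    obtain ⟨v, hv⟩ := hVne z
    obtain ⟨i, hi, h⟩ := hlarge v (hVD z hz v hv)
    exact ⟨i, hi, v, hv, h⟩
  have hmem : ∀ z, IsBoundaryCell a b z → ∃ v ∈ V z, 2 ≤ |g v (ι z)| := fun z hz =>
    Nat.sInf_mem ((hSne z hz).imp fun _ h => h.2)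
  have hneg : ∀ z, IsBoundaryCell a b z → (¬ ∃ v ∈ V z, 2 ≤ g v (ι z)) →
      ∃ v ∈ V z, g v (ι z) ≤ -2 := by
    intro z hz h
    obtain ⟨v, hv, h2⟩ := hmem z hz
    rcases le_abs.1 h2 with h2 | h2
    · exact absurd ⟨v, hv, h2⟩ h
    · exact ⟨v, hv, by omega⟩
  refine le_of_antipodal_labelling (σ := σ) (ι := ι) hn hab ?_ ?_ ?_
  · intro z hz
    obtain ⟨i, hi, h⟩ := hSne z hz
    exact (Nat.sInf_le h).trans_lt hi
  · intro z hz
    by_cases h : ∃ v ∈ V z, 2 ≤ g v (ι z)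
    · have : ¬ ∃ v ∈ V (reflect a b z), 2 ≤ g v (ι z) := by
        rintro ⟨w, hw, h2⟩
        obtain ⟨v, hv, h1⟩ := h
        have hw' := hVr _ w hw
        rw [reflect_reflect] at hw'
        exact hconf z hz v hv _ hw' _ h1 (by rw [hodd]; omega)
      simp [σ, hιr, h, this]
    · have : ∃ v ∈ V (reflect a b z), 2 ≤ g v (ι z) := by
        obtain ⟨v, hv, h1⟩ := hneg z hz h
        exact ⟨_, hVr z v hv, by rw [hodd]; omega⟩
      simp [σ, hιr, h, this]
  · intro z hz i x ho hx
    have hsub : V (Function.update z i x) ⊆ V z := by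
      intro v hv j
      have := abs_le.1 (hv j)
      by_cases hj : j = i
      · subst hj
        obtain ⟨r, hr⟩ := ho
        simp only [Function.update_self] at this
        exact abs_le.2 (by omega)
      · simp only [Function.update_of_ne hj] at this
        exact abs_le.2 (by omega)
    have hw := hz.update ho hx
    refine ⟨?_, fun he => ?_⟩
    · obtain ⟨v, hv, h⟩ := hmem _ hw
      exact Nat.sInf_le ⟨v, hsub hv, h⟩
    · by_cases h : ∃ v ∈ V (Function.update z i x), 2 ≤ g v (ι (Function.update z i x))
      · have h' : ∃ v ∈ V z, 2 ≤ g v (ι z) := by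
          obtain ⟨v, hv, h1⟩ := h
          exact ⟨v, hsub hv, he ▸ h1⟩
        simp [σ, h, h']
      · have h' : ¬ ∃ v ∈ V z, 2 ≤ g v (ι z) := by
          rintro ⟨v, hv, h1⟩
          obtain ⟨w, hw', h2⟩ := hneg _ hw h
          exact hconf z hz v hv w (hsub hw') _ h1 (he ▸ h2)
        simp only [σ, h, h']

end DigitalBorsukUlam


/-- Digital Borsuk–Ulam for `(cₙ,c_{n-1})`-continuous maps: if `B ⊂ ℤⁿ` is an
`n`-box (`n = m + 2 ≥ 2`) with boundary `∂B` and canonical involution `τ`, and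
`f : ∂B → ℤ^{n-1}` is `(cₙ,c_{n-1})`-continuous, then there is `x ∈ ∂B` with
`f x = f (τ x)` or `f x` `c_{n-1}`-adjacent to `f (τ x)`. -/
theorem digital_borsuk_ulam_cn_cn_sub_one (m : ℕ) (a b : Fin (m + 2) → ℤ)
    (hab : ∀ i, a i < b i)
    (B : Set (Fin (m + 2) → ℤ))
    (hB : B = {x | ∀ i, a i ≤ x i ∧ x i ≤ b i})
    (bdry : Set (Fin (m + 2) → ℤ))
    (hbdry : bdry = {x ∈ B | ∃ i, x i = a i ∨ x i = b i})
    (τ : (Fin (m + 2) → ℤ) → (Fin (m + 2) → ℤ))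
    (hτ : τ = fun x i => a i + b i - x i)
    (f : (Fin (m + 2) → ℤ) → (Fin (m + 1) → ℤ))
    (hf : ∀ x ∈ bdry, ∀ y ∈ bdry, CAdj (m + 2) (m + 2) x y →
      f x = f y ∨ CAdj (m + 1) (m + 1) (f x) (f y)) :
    ∃ x ∈ bdry, f x = f (τ x) ∨ CAdj (m + 1) (m + 1) (f x) (f (τ x)) := by
  by_contra! hcon
  have hclose : ∀ x ∈ bdry, ∀ y ∈ bdry, (∀ i, |x i - y i| ≤ 1) → ∀ i, |f x i - f y i| ≤ 1 := by
    intro x hx y hy hxy i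
    by_cases he : x = y
    · simp [he]
    · rcases hf x hx y hy ⟨he, hxy, (Finset.card_le_univ _).trans (by simp)⟩ with h | h
      · simp [h]
      · exact h.2.1 i
  have hfar : ∀ x ∈ bdry, ∃ i, 2 ≤ |f x i - f (τ x) i| := by
    intro x hx
    by_contra! hc
    refine (hcon x hx).2 ⟨(hcon x hx).1, fun i => ?_, (Finset.card_le_univ _).trans (by simp)⟩
    have := hc i
    omega
  have hD : bdry = {v | (∀ i, a i ≤ v i ∧ v i ≤ b i) ∧ ∃ i, v i = a i ∨ v i = b i} := by
    rw [hbdry, hB]; rfl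
  have hτD : ∀ v ∈ bdry, τ v ∈ bdry := by
    rw [hD, hτ]
    rintro v ⟨h, j, hj⟩
    refine ⟨fun i => ?_, j, ?_⟩
    · have := h i; dsimp only; omega
    · dsimp only; omega
  have hττ : ∀ v, τ (τ v) = v := fun v => by
    subst hτ
    funext i
    simp
  let g : (Fin (m + 2) → ℤ) → ℕ → ℤ := fun v i =>
    if h : i < m + 1 then f v ⟨i, h⟩ - f (τ v) ⟨i, h⟩ else 0
  have hle : m + 2 ≤ m + 1 := by
    refine DigitalBorsukUlam.le_of_antipodal_map (by omega) (fun i => (hab i).le) bdry hD g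
      (fun v i => ?_) (fun v hv w hw hvw i => ?_) (fun v hv => ?_)
    · have : (fun j => a j + b j - v j) = τ v := by rw [hτ]
      rw [this]
      simp only [g, hττ]
      split_ifs <;> simp
    · simp only [g]
      split_ifs with hi
      · have h1 := abs_le.1 (hclose v hv w hw hvw ⟨i, hi⟩)
        have h2 := abs_le.1 (hclose _ (hτD v hv) _ (hτD w hw) (fun j => by
          have := abs_le.1 (hvw j)
          rw [hτ]
          exact abs_le.2 (by dsimp only; omega)) ⟨i, hi⟩)
        exact abs_le.2 (by omega)
      · simp
    · obtain ⟨i, hi⟩ := hfar v hv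
      exact ⟨i, i.2, by simpa only [g, i.2, dif_pos] using hi⟩
  omega
end

section
/- (Regularity of c₁.) Let σ and ρ be c₁-simplices in ℤⁿ whose convex hulls in ℝⁿ have nonempty intersection. Then σ and ρ share a vertex, i.e. σ ∩ ρ ≠ ∅. -/
/-- Two `c₁`-adjacent points differ by exactly 1 in exactly one coordinate. -/
theorem CAdj.exists_coord {n : ℕ} {x y : Fin n → ℤ} (h : CAdj n 1 x y) :
    ∃ i, (∀ j, j ≠ i → x j = y j) ∧ (y i = x i + 1 ∨ x i = y i + 1) := by
  obtain ⟨hne, hle, hcard⟩ := h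
  obtain ⟨i, hi⟩ := Function.ne_iff.mp hne
  refine ⟨i, fun j hj => ?_, ?_⟩
  · by_contra hxy
    exact hj (Finset.card_le_one.mp hcard j (by simpa using hxy) i (by simpa using hi))
  · have := abs_le.mp (hle i)
    omega

/-- There are no triangles for the adjacency `c₁`. -/
theorem CAdj.not_triangle {n : ℕ} {x y z : Fin n → ℤ} (hxy : CAdj n 1 x y)
    (hyz : CAdj n 1 y z) (hxz : CAdj n 1 x z) : False := by
  obtain ⟨i, hi, hi'⟩ := hxy.exists_coord
  obtain ⟨j, hj, hj'⟩ := hyz.exists_coord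
  obtain ⟨k, hk, hk'⟩ := hxz.exists_coord
  grind

/-- The coordinatewise floor of a point of a unit segment parallel to a coordinate axis
is an endpoint of that segment. -/
theorem floor_eq_or_of_mem_segment {n : ℕ} {a b : Fin n → ℤ} {i : Fin n}
    (hoff : ∀ j, j ≠ i → a j = b j) (hi : b i = a i + 1) {p : Fin n → ℝ}
    (hp : p ∈ segment ℝ (intToReal n a) (intToReal n b)) :
    (fun j => ⌊p j⌋) = a ∨ (fun j => ⌊p j⌋) = b := by
  obtain ⟨s, t, hs, ht, hst, rfl⟩ := hp
  have hs' : s = 1 - t := by linarith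
  have hfloor_off : ∀ j, j ≠ i →
      ⌊(s • intToReal n a + t • intToReal n b) j⌋ = a j := by
    intro j hj
    have : (s • intToReal n a + t • intToReal n b) j = (a j : ℝ) := by
      simp only [Pi.add_apply, Pi.smul_apply, smul_eq_mul, intToReal, ← hoff j hj, hs']
      ring
    rw [this, Int.floor_intCast]
  have hval : (s • intToReal n a + t • intToReal n b) i = (a i : ℝ) + t := by
    simp only [Pi.add_apply, Pi.smul_apply, smul_eq_mul, intToReal, hi, hs']
    push_cast
    ring
  rcases (show t ≤ 1 by linarith).lt_or_eq with hlt | rfl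
  · left
    funext j
    by_cases hj : j = i
    · subst hj
      rw [hval, Int.floor_eq_iff]
      constructor <;> linarith
    · exact hfloor_off j hj
  · right
    funext j
    by_cases hj : j = i
    · subst hj
      rw [hval, hi]
      simp
    · rw [hfloor_off j hj, hoff j hj]

/-- The coordinatewise floor of a point in the convex hull of a `c₁`-simplex is a vertex. -/
theorem floor_mem_of_mem_convexHull {n : ℕ} {σ : Finset (Fin n → ℤ)}
    (hσ : ∀ x ∈ σ, ∀ y ∈ σ, x ≠ y → CAdj n 1 x y) {p : Fin n → ℝ}
    (hp : p ∈ convexHull ℝ (intToReal n '' ↑σ)) : (fun j => ⌊p j⌋) ∈ σ := by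
  obtain ⟨_, a, ha, rfl⟩ := convexHull_nonempty_iff.mp ⟨p, hp⟩
  rw [Finset.mem_coe] at ha
  by_cases hall : ∀ b ∈ σ, b = a
  · have hσa : (σ : Set (Fin n → ℤ)) = {a} := by
      ext b
      exact ⟨hall b, fun h => h ▸ ha⟩
    rw [hσa, Set.image_singleton, convexHull_singleton, Set.mem_singleton_iff] at hp
    simpa [hp, intToReal] using ha
  · push Not at hall
    obtain ⟨b, hb, hba⟩ := hall
    have hσab : (σ : Set (Fin n → ℤ)) = {a, b} := by
      ext c
      refine ⟨fun hc => ?_, ?_⟩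
      · by_contra hcab
        simp only [Set.mem_insert_iff, Set.mem_singleton_iff, not_or] at hcab
        exact (hσ b hb a ha hba).not_triangle (hσ a ha c hc (Ne.symm hcab.1))
          (hσ b hb c hc (Ne.symm hcab.2))
      · rintro (rfl | rfl) <;> assumption
    rw [hσab, Set.image_pair, convexHull_pair] at hp
    obtain ⟨i, hoff, hi | hi⟩ := (hσ a ha b hb hba.symm).exists_coord
    · rcases floor_eq_or_of_mem_segment hoff hi hp with h | h <;> rwa [h]
    · rw [segment_symm] at hp
      rcases floor_eq_or_of_mem_segment (fun j hj => (hoff j hj).symm) hi hp with h | h <;>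
        rwa [h]

/-- Regularity of `c₁`: if `σ` and `ρ` are `c₁`-simplices in `ℤⁿ` whose convex
hulls in `ℝⁿ` intersect, then `σ` and `ρ` share a vertex. -/
theorem c1_regular (n : ℕ) (σ ρ : Finset (Fin n → ℤ))
    (hσne : σ.Nonempty) (hρne : ρ.Nonempty)
    (hσ : ∀ x ∈ σ, ∀ y ∈ σ, x ≠ y → CAdj n 1 x y)
    (hρ : ∀ x ∈ ρ, ∀ y ∈ ρ, x ≠ y → CAdj n 1 x y)
    (hint : (convexHull ℝ (intToReal n '' ↑σ) ∩
      convexHull ℝ (intToReal n '' ↑ρ)).Nonempty) :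
    (σ ∩ ρ).Nonempty := by
  obtain ⟨p, hpσ, hpρ⟩ := hint
  exact ⟨fun j => ⌊p j⌋, Finset.mem_inter.mpr
    ⟨floor_mem_of_mem_convexHull hσ hpσ, floor_mem_of_mem_convexHull hρ hpρ⟩⟩
end

section
/- Let B = [−1,1]_ℤ³ ⊂ ℤ³ and ∂B = B \ {(0,0,0)}, with the antipodal involution τ(x) = −x. There exists a (c₁,c₁)-continuous function f : ∂B → ℤ² such that for every x ∈ ∂B, f(x) ≠ f(τ(x)) and f(x) is not c₁-adjacent to f(τ(x)). Hence the conclusion of the digital Borsuk–Ulam theorem for (cₙ,c₁)-continuous maps fails when c₁ rather than c₃ is used on the domain ∂B ⊂ ℤ³. -/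
/-- Two `c₁`-adjacent points agree in at least one of any two distinct coordinates. -/
theorem CAdj.eq_or_eq {n : ℕ} {x y : Fin n → ℤ} (h : CAdj n 1 x y) {i j : Fin n}
    (hij : i ≠ j) : x i = y i ∨ x j = y j := by
  by_contra! hne
  exact hij (Finset.card_le_one.mp h.2.2 i (by simp [hne.1]) j (by simp [hne.2]))

/-- Points of `ℤ²` that agree in one coordinate and differ by at most 1 in each are equal or
`c₁`-adjacent. -/
theorem eq_or_cAdj_of_eq_or_eq {u v : Fin 2 → ℤ} (h : u 0 = v 0 ∨ u 1 = v 1)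
    (hle : ∀ i, |u i - v i| ≤ 1) : u = v ∨ CAdj 2 1 u v := by
  refine or_iff_not_imp_left.mpr fun hne => ⟨hne, hle, Finset.card_le_one.mpr ?_⟩
  intro i hi j hj
  fin_cases i <;> fin_cases j <;> simp_all

/-- `1` on positive integers and `0` elsewhere. -/
def posIndicator (a : ℤ) : ℤ := if 0 < a then 1 else 0

theorem abs_posIndicator_sub_le (a b : ℤ) : |posIndicator a - posIndicator b| ≤ 1 := by
  unfold posIndicator
  split_ifs <;> simp

theorem posIndicator_ne_neg {a : ℤ} (ha : a ≠ 0) : posIndicator a ≠ posIndicator (-a) := by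
  unfold posIndicator
  split_ifs <;> omega

/-- The map `∂B → {0,1}²` recording the signs of the lexicographic orders `(x, y, z)` and
`(y, x, -z)`; it commutes with the antipodal involutions. -/
def lexSigns (x : Fin 3 → ℤ) : Fin 2 → ℤ :=
  ![posIndicator (9 * x 0 + 3 * x 1 + x 2), posIndicator (9 * x 1 + 3 * x 0 - x 2)]

/-- On `∂B = [-1,1]³_ℤ \ {0}` with the antipodal involution `τ x = -x`, there
is a `(c₁,c₁)`-continuous function `f : ∂B → ℤ²` such that no point `x ∈ ∂B`
has `f x` equal or `c₁`-adjacent to `f (-x)`: the digital Borsuk–Ulam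
conclusion fails when `c₁` is used on the domain in `ℤ³`. -/
theorem exists_c1_c1_counterexample
    (bdry : Set (Fin 3 → ℤ))
    (hbdry : bdry = {x | (∀ i, |x i| ≤ 1) ∧ x ≠ 0}) :
    ∃ f : (Fin 3 → ℤ) → (Fin 2 → ℤ),
      (∀ x ∈ bdry, ∀ y ∈ bdry, CAdj 3 1 x y →
        f x = f y ∨ CAdj 2 1 (f x) (f y)) ∧
      (∀ x ∈ bdry, f x ≠ f (-x) ∧ ¬ CAdj 2 1 (f x) (f (-x))) := by
  subst hbdry
  refine ⟨lexSigns, ?_, ?_⟩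
  · rintro x ⟨hx, hx0⟩ y ⟨hy, hy0⟩ h
    refine eq_or_cAdj_of_eq_or_eq ?_ fun i => ?_
    · have h01 := h.eq_or_eq (i := 0) (j := 1) (by decide)
      have h02 := h.eq_or_eq (i := 0) (j := 2) (by decide)
      have h12 := h.eq_or_eq (i := 1) (j := 2) (by decide)
      have hd := h.2.1
      simp only [Fin.forall_fin_succ, abs_le, ne_eq, funext_iff] at hx hy hd hx0 hy0
      simp [lexSigns, posIndicator] at *
      have hx_sign : x 0 = -1 ∨ x 0 = 0 ∨ x 0 = 1 := by omega
      rcases hx_sign with h0 | h0 | h0 <;> split_ifs <;> omega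
    · fin_cases i <;> exact abs_posIndicator_sub_le _ _
  · rintro x ⟨hx, hx0⟩
    have hne : lexSigns x 0 ≠ lexSigns (-x) 0 ∧ lexSigns x 1 ≠ lexSigns (-x) 1 := by
      simp only [Fin.forall_fin_succ, abs_le, ne_eq, funext_iff] at hx hx0
      simp at hx hx0
      constructor
      · have h := posIndicator_ne_neg (a := 9 * x 0 + 3 * x 1 + x 2) (by omega)
        rwa [show -(9 * x 0 + 3 * x 1 + x 2) = 9 * -x 0 + 3 * -x 1 + -x 2 by ring] at h
      · have h := posIndicator_ne_neg (a := 9 * x 1 + 3 * x 0 - x 2) (by omega)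
        rwa [show -(9 * x 1 + 3 * x 0 - x 2) = 9 * -x 1 + 3 * -x 0 - -x 2 by ring] at h
    refine ⟨fun h => hne.1 (congrFun h 0), fun h => ?_⟩
    exact (h.eq_or_eq (i := 0) (j := 1) (by decide)).elim hne.1 hne.2
end
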